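/- arXiv:2212.08630 — 4 statements merged into one kernel-verified Lean document; each statement's English description precedes it below -/
import Mathlib

section
/- Let n ≥ 1 and k, l ≥ 0 be integers with n ≤ l + k and n ≡ l + k (mod 2). Then the vector space Hom_{SO(n)}((ℝⁿ)^{⊗k},(ℝⁿ)^{⊗l}) of SO(n)-equivariant linear maps is spanned by the set {E_β : β a (k,l)-Brauer partition} ∪ {H_α : α an (l+k)\n-partition} (where the E_β occur only when l+k is even). -/
open Matrix

noncomputable section

/-- The matrix of `g^{⊗k}` in the standard basis of `(ℝⁿ)^{⊗k}`. -/
def tpowM {n : ℕ} (k : ℕ) (g : Matrix (Fin n) (Fin n) ℝ) :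
    Matrix (Fin k → Fin n) (Fin k → Fin n) ℝ :=
  Matrix.of fun I J => ∏ r, g (I r) (J r)

/-- Equivariance for the set of matrices satisfying `P`. -/
def IsGEquiv {n : ℕ} (k l : ℕ) (P : Matrix (Fin n) (Fin n) ℝ → Prop)
    (φ : ((Fin k → Fin n) → ℝ) →ₗ[ℝ] ((Fin l → Fin n) → ℝ)) : Prop :=
  ∀ g : Matrix (Fin n) (Fin n) ℝ, P g →
    φ ∘ₗ (tpowM k g).mulVecLin = (tpowM l g).mulVecLin ∘ₗ φ

/-- An `(N)\\n`-partition: a choice of `n` "free" elements of `{1, …, N}` together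
with a partition of the remaining `N - n` elements into disjoint pairs; the pairing
is encoded as an involution fixing exactly the free elements, whose nontrivial
orbits `{p, pair p}` are the blocks. -/
structure GroodPartition (N n : ℕ) where
  free : Finset (Fin N)
  card_free : free.card = n
  pair : Fin N → Fin N
  invol : ∀ p, pair (pair p) = p
  fixed_iff_free : ∀ p, pair p = p ↔ p ∈ free

/-- The free elements of `α`, listed in increasing order.  (Since every free
element of the top row precedes every free element of the bottom row, this is the
list `t₁, …, t_s, b₁, …, b_{n-s}`.) -/
def GroodPartition.sorted {N n : ℕ} (α : GroodPartition N n) : Fin n → Fin N :=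
  fun r => (α.free.sort (· ≤ ·)).get
    (Fin.cast (by rw [Finset.length_sort, α.card_free]) r)

/-- `χ(c_{t₁}, …, c_{t_s}, c_{b₁}, …, c_{b_{n-s}})`: zero if the indices attached
to the free vertices are not distinct, and otherwise the sign of the permutation
of `[n]` they determine.  This is exactly the determinant of the corresponding
"would-be permutation" 0/1 matrix. -/
def chiDet {N n : ℕ} (α : GroodPartition N n) (c : Fin N → Fin n) : ℝ :=
  Matrix.det (Matrix.of fun a r : Fin n => if c (α.sorted r) = a then (1 : ℝ) else 0)

/-- The matrix `H_α` of an `(l+k)\\n`-partition `α`: the `(I,J)` entry is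
`χ(c_{t₁},…,c_{b_{n-s}}) ⬝ ∏_{{p,q} a pair of α} δ_{c_p, c_q}` where `c = I ⌢ J`. -/
def groodMatrix (n k l : ℕ) (α : GroodPartition (l + k) n) :
    Matrix (Fin l → Fin n) (Fin k → Fin n) ℝ :=
  Matrix.of fun I J =>
    chiDet α (Fin.append I J) *
      ∏ p ∈ Finset.univ.filter (fun p => p ∉ α.free ∧ p < α.pair p),
        if Fin.append I J p = Fin.append I J (α.pair p) then (1 : ℝ) else 0

/-- The subspace `Hom_G((ℝⁿ)^{⊗k}, (ℝⁿ)^{⊗l})` of linear maps equivariant under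
all matrices satisfying `P`. -/
def EquivSub {n : ℕ} (k l : ℕ) (P : Matrix (Fin n) (Fin n) ℝ → Prop) :
    Submodule ℝ (((Fin k → Fin n) → ℝ) →ₗ[ℝ] ((Fin l → Fin n) → ℝ)) where
  carrier := {φ | ∀ g : Matrix (Fin n) (Fin n) ℝ, P g →
    φ ∘ₗ (tpowM k g).mulVecLin = (tpowM l g).mulVecLin ∘ₗ φ}
  add_mem' := by
    intro φ ψ hφ hψ g hg
    rw [LinearMap.add_comp, LinearMap.comp_add, hφ g hg, hψ g hg]
  zero_mem' := by
    intro g hg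
    rw [LinearMap.zero_comp, LinearMap.comp_zero]
  smul_mem' := by
    intro c φ hφ g hg
    rw [LinearMap.smul_comp, LinearMap.comp_smul, hφ g hg]

/-- A partition of `{1, …, N}` into disjoint pairs (a perfect matching),
encoded as a fixed-point-free involution: the blocks are the sets `{p, pair p}`. -/
structure BrauerPairing (N : ℕ) where
  pair : Fin N → Fin N
  invol : ∀ p, pair (pair p) = p
  ne : ∀ p, pair p ≠ p

/-- The matrix `E_β` of a `(k,l)`-Brauer partition `β`. -/
def brauerMatrix (n k l : ℕ) (β : BrauerPairing (l + k)) :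
    Matrix (Fin l → Fin n) (Fin k → Fin n) ℝ :=
  Matrix.of fun I J =>
    ∏ p ∈ Finset.univ.filter (fun p => p < β.pair p),
      if Fin.append I J p = Fin.append I J (β.pair p) then (1 : ℝ) else 0

/-! ### Invariant tensors -/

/-- The tensor `T` is invariant under `SO(n)`. -/
def InvT {n N : ℕ} (T : (Fin N → Fin n) → ℝ) : Prop :=
  ∀ g : Matrix (Fin n) (Fin n) ℝ, (gᵀ * g = 1 ∧ g.det = 1) →
    ∀ c, ∑ K : Fin N → Fin n, (∏ r, g (c r) (K r)) * T K = T c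

theorem InvT.add {n N : ℕ} {T S : (Fin N → Fin n) → ℝ} (hT : InvT T) (hS : InvT S) :
    InvT (T + S) := by
  intro g hg c
  simp only [Pi.add_apply, mul_add, Finset.sum_add_distrib, hT g hg c, hS g hg c]

theorem InvT.smul {n N : ℕ} {T : (Fin N → Fin n) → ℝ} (hT : InvT T) (a : ℝ) :
    InvT (a • T) := by
  intro g hg c
  simp only [Pi.smul_apply, smul_eq_mul, mul_left_comm, ← Finset.mul_sum, hT g hg c]

/-- The submodule of invariant tensors. -/
def InvSub (n N : ℕ) : Submodule ℝ ((Fin N → Fin n) → ℝ) where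
  carrier := {T | InvT T}
  add_mem' := fun h1 h2 => h1.add h2
  zero_mem' := by intro g hg c; simp
  smul_mem' := fun a _ h => h.smul a

/-- Reindexing of positions. -/
def reix {n N : ℕ} (f : Equiv.Perm (Fin N)) :
    ((Fin N → Fin n) → ℝ) →ₗ[ℝ] ((Fin N → Fin n) → ℝ) where
  toFun T := fun c => T (c ∘ f)
  map_add' _ _ := rfl
  map_smul' _ _ := rfl

theorem InvT.reix {n N : ℕ} {T : (Fin N → Fin n) → ℝ} (hT : InvT T) (f : Equiv.Perm (Fin N)) :
    InvT (reix f T) := by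
  intro g hg c
  simp only [_root_.reix, LinearMap.coe_mk, AddHom.coe_mk]
  rw [← hT g hg (c ∘ f)]
  refine Fintype.sum_equiv (Equiv.arrowCongr f.symm (Equiv.refl _)) _ _ ?_
  intro K
  have : (Equiv.arrowCongr f.symm (Equiv.refl _)) K = K ∘ f := by
    ext; simp
  rw [this]
  congr 1
  exact (Equiv.prod_comp f (fun r => g (c r) (K r))).symm

theorem sum_cons {n M : ℕ} (F : (Fin (M + 1) → Fin n) → ℝ) :
    ∑ K, F K = ∑ a : Fin n, ∑ d : Fin M → Fin n, F (Fin.cons a d) := by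
  rw [← Fintype.sum_prod_type']
  exact (Fintype.sum_equiv (Fin.consEquiv (fun _ : Fin (M + 1) => Fin n)) _ _ (fun _ => rfl)).symm

/-- Insertion of a cup at positions `0`, `1`. -/
def cup {n M : ℕ} :
    ((Fin M → Fin n) → ℝ) →ₗ[ℝ] ((Fin (M + 2) → Fin n) → ℝ) where
  toFun S := fun c => if c 0 = c 1 then S (fun i => c i.succ.succ) else 0
  map_add' _ _ := by ext c; by_cases h : c 0 = c 1 <;> simp [h]
  map_smul' _ _ := by ext c; by_cases h : c 0 = c 1 <;> simp [h]

/-- Contraction of positions `0`, `1`. -/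
def contr {n M : ℕ} (T : (Fin (M + 2) → Fin n) → ℝ) : (Fin M → Fin n) → ℝ :=
  fun d => ∑ a, T (Fin.cons a (Fin.cons a d : Fin (M + 1) → Fin n) : Fin (M + 2) → Fin n)

theorem cup_apply {n M : ℕ} (S : (Fin M → Fin n) → ℝ) (c : Fin (M + 2) → Fin n) :
    cup S c = if c 0 = c 1 then S (fun i => c i.succ.succ) else 0 := rfl

theorem cup_cons {n M : ℕ} (S : (Fin M → Fin n) → ℝ) (a b : Fin n) (d : Fin M → Fin n) :
    cup S (Fin.cons a (Fin.cons b d : Fin (M + 1) → Fin n) : Fin (M + 2) → Fin n)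
      = if a = b then S d else 0 := by
  have h1 : (1 : Fin (M + 2)) = Fin.succ 0 := rfl
  rw [cup_apply, h1]
  simp only [Fin.cons_zero, Fin.cons_succ]

theorem cup_inner {n M : ℕ} (S : (Fin M → Fin n) → ℝ) (T : (Fin (M + 2) → Fin n) → ℝ) :
    ∑ c, cup S c * T c = ∑ d, S d * contr T d := by
  rw [sum_cons]
  simp only [sum_cons, cup_cons, ite_mul, zero_mul, contr, Finset.mul_sum]
  simp only [Finset.sum_comm (s := (Finset.univ : Finset (Fin n)))
    (t := (Finset.univ : Finset (Fin M → Fin n)))]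
  refine Finset.sum_congr rfl fun d _ => ?_
  simp

theorem orth_row {n : ℕ} {g : Matrix (Fin n) (Fin n) ℝ} (hg : gᵀ * g = 1) (x y : Fin n) :
    ∑ a, g x a * g y a = if x = y then 1 else 0 := by
  have h : g * gᵀ = 1 := mul_eq_one_comm.mp hg
  have := congrFun (congrFun h x) y
  simpa [Matrix.mul_apply, Matrix.one_apply] using this

theorem orth_col {n : ℕ} {g : Matrix (Fin n) (Fin n) ℝ} (hg : gᵀ * g = 1) (x y : Fin n) :
    ∑ a, g a x * g a y = if x = y then 1 else 0 := by
  have := congrFun (congrFun hg x) y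
  simpa [Matrix.mul_apply, Matrix.one_apply] using this

theorem InvT.cup {n M : ℕ} {S : (Fin M → Fin n) → ℝ} (hS : InvT S) : InvT (cup S) := by
  intro g hg c
  rw [sum_cons]
  simp only [sum_cons, cup_cons, Fin.prod_univ_succ, Fin.cons_zero, Fin.cons_succ, mul_ite,
    mul_zero]
  simp only [Finset.sum_comm (s := (Finset.univ : Finset (Fin n)))
    (t := (Finset.univ : Finset (Fin M → Fin n)))]
  simp only [Finset.sum_ite_eq, Finset.mem_univ, if_true]
  have : ∀ d : Fin M → Fin n, ∑ a, g (c 0) a * (g (c (Fin.succ 0)) a * ∏ i : Fin M, g (c i.succ.succ) (d i)) * S d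
      = (if c 0 = c 1 then 1 else 0) * ((∏ i : Fin M, g (c i.succ.succ) (d i)) * S d) := by
    intro d
    rw [← orth_row hg.1, Finset.sum_mul]
    refine Finset.sum_congr rfl fun a _ => ?_
    have h1 : (1 : Fin (M + 2)) = Fin.succ 0 := rfl
    rw [h1]; ring
  simp only [this, ← Finset.mul_sum]
  rw [hS g hg (fun i => c i.succ.succ), cup_apply]
  simp

theorem InvT.contr {n M : ℕ} {T : (Fin (M + 2) → Fin n) → ℝ} (hT : InvT T) : InvT (contr T) := by
  intro g hg d
  have key : ∀ a, T (Fin.cons a (Fin.cons a d : Fin (M + 1) → Fin n) : Fin (M + 2) → Fin n)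
     = ∑ x, ∑ y, g a x * g a y * ∑ K, (∏ r, g (d r) (K r)) *
       T (Fin.cons x (Fin.cons y K : Fin (M + 1) → Fin n) : Fin (M + 2) → Fin n) := by
    intro a
    rw [← hT g hg, sum_cons]
    simp only [sum_cons, Fin.prod_univ_succ, Fin.cons_zero, Fin.cons_succ, Finset.mul_sum, mul_assoc]
  simp only [_root_.contr, key]
  rw [Finset.sum_comm]
  have : ∀ x : Fin n, ∑ a, ∑ y, g a x * g a y * ∑ K, (∏ r, g (d r) (K r)) *
       T (Fin.cons x (Fin.cons y K : Fin (M + 1) → Fin n) : Fin (M + 2) → Fin n)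
      = ∑ K, (∏ r, g (d r) (K r)) *
       T (Fin.cons x (Fin.cons x K : Fin (M + 1) → Fin n) : Fin (M + 2) → Fin n) := by
    intro x
    rw [Finset.sum_comm]
    simp only [← Finset.sum_mul, orth_col hg.1, ite_mul, one_mul, zero_mul, Finset.sum_ite_eq,
      Finset.mem_univ, if_true]
  refine Eq.trans ?_ (Finset.sum_congr rfl fun x _ => (this x).symm)
  simp only [Finset.mul_sum]
  rw [Finset.sum_comm]

/-! ### Rotations -/

/-- The rank two projection on the `(i, j)` plane. -/
def planeP {n : ℕ} (i j : Fin n) : Matrix (Fin n) (Fin n) ℝ :=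
  Matrix.single i i 1 + Matrix.single j j 1

/-- The infinitesimal rotation in the `(i, j)` plane. -/
def planeX {n : ℕ} (i j : Fin n) : Matrix (Fin n) (Fin n) ℝ :=
  Matrix.single i j 1 - Matrix.single j i 1

/-- The rotation in the `(i, j)` plane. -/
def rot {n : ℕ} (i j : Fin n) (θ : ℝ) : Matrix (Fin n) (Fin n) ℝ :=
  1 + (Real.cos θ - 1) • planeP i j + Real.sin θ • planeX i j

theorem planePP {n : ℕ} {i j : Fin n} (h : i ≠ j) : planeP i j * planeP i j = planeP i j := by
  simp [planeP, add_mul, mul_add, Matrix.single_mul_single_of_ne, h, h.symm]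

theorem planePX {n : ℕ} {i j : Fin n} (h : i ≠ j) : planeP i j * planeX i j = planeX i j := by
  simp [planeP, planeX, add_mul, mul_sub, Matrix.single_mul_single_of_ne, h, h.symm]

theorem planeXP {n : ℕ} {i j : Fin n} (h : i ≠ j) : planeX i j * planeP i j = planeX i j := by
  simp [planeP, planeX, sub_mul, mul_add, Matrix.single_mul_single_of_ne, h, h.symm]
  abel

theorem planeXX {n : ℕ} {i j : Fin n} (h : i ≠ j) : planeX i j * planeX i j = - planeP i j := by
  simp [planeP, planeX, sub_mul, mul_sub, Matrix.single_mul_single_of_ne, h, h.symm]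
  abel

theorem rot_mul {n : ℕ} {i j : Fin n} (h : i ≠ j) (a b : ℝ) :
    rot i j a * rot i j b = rot i j (a + b) := by
  simp only [rot, add_mul, mul_add, one_mul, mul_one, smul_mul_assoc, mul_smul_comm, planePP h,
    planePX h, planeXP h, planeXX h, Real.cos_add, Real.sin_add]
  module

theorem rot_transpose {n : ℕ} (i j : Fin n) (a : ℝ) : (rot i j a)ᵀ = rot i j (-a) := by
  simp only [rot, planeP, planeX, Matrix.transpose_add, Matrix.transpose_smul,
    Matrix.transpose_sub, Matrix.transpose_single, Matrix.transpose_one, Real.cos_neg, Real.sin_neg]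
  module

theorem rot_zero {n : ℕ} (i j : Fin n) : rot i j 0 = 1 := by
  simp [rot]

theorem rot_mem {n : ℕ} {i j : Fin n} (h : i ≠ j) (a : ℝ) :
    (rot i j a)ᵀ * rot i j a = 1 ∧ (rot i j a).det = 1 := by
  have key : ∀ a, (rot i j a)ᵀ * rot i j a = 1 := by
    intro a
    rw [rot_transpose, rot_mul h, neg_add_cancel, rot_zero]
  refine ⟨key a, ?_⟩
  have h2 : a = a / 2 + a / 2 := by ring
  have h3 := congrArg Matrix.det (key (a / 2))
  rw [Matrix.det_mul, Matrix.det_transpose, Matrix.det_one] at h3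
  rw [h2, ← rot_mul h, Matrix.det_mul, h3]

theorem sum_prod_fn {n N : ℕ} (F : Fin N → Fin n → ℝ) :
    ∑ K : Fin N → Fin n, ∏ r, F r (K r) = ∏ r, ∑ a, F r a := by
  rw [Finset.prod_univ_sum, Fintype.piFinset_univ]

/-- Invariance under a monomial matrix. -/
theorem InvT.monomial {n N : ℕ} {T : (Fin N → Fin n) → ℝ} (hT : InvT T)
    (g : Matrix (Fin n) (Fin n) ℝ) (hg : gᵀ * g = 1 ∧ g.det = 1)
    (ε : Fin n → ℝ) (τ : Fin n → Fin n) (h : ∀ x y, g x y = if y = τ x then ε x else 0)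
    (c : Fin N → Fin n) : T c = (∏ r, ε (c r)) * T (fun r => τ (c r)) := by
  rw [← hT g hg c]
  rw [Finset.sum_eq_single (fun r => τ (c r))]
  · simp [h]
  · intro K _ hK
    have : ∃ r, K r ≠ τ (c r) := by
      by_contra hcon
      push Not at hcon
      exact hK (funext hcon)
    obtain ⟨r, hr⟩ := this
    rw [Finset.prod_eq_zero (Finset.mem_univ r), zero_mul]
    simp [h, hr]
  · simp

theorem InvT.quarter {n N : ℕ} {T : (Fin N → Fin n) → ℝ} (hT : InvT T) {i j : Fin n} (hij : i ≠ j)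
    (c : Fin N → Fin n) :
    T c = (∏ r, if c r = j then (-1 : ℝ) else 1) * T (fun r => Equiv.swap i j (c r)) := by
  refine hT.monomial (rot i j (Real.pi / 2)) (rot_mem hij _) (fun x => if x = j then -1 else 1)
    (Equiv.swap i j) ?_ c
  intro x y
  simp only [rot, planeP, planeX, Real.cos_pi_div_two, Real.sin_pi_div_two, Matrix.add_apply,
    Matrix.smul_apply, Matrix.sub_apply, Matrix.single_apply, Matrix.one_apply, smul_eq_mul,
    Equiv.swap_apply_def]
  grind

/-- Replace `i` by `j`, summed over all positions. -/
def Dop {n N : ℕ} (i j : Fin n) (T : (Fin N → Fin n) → ℝ) : (Fin N → Fin n) → ℝ :=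
  fun c => ∑ r, if c r = i then T (Function.update c r j) else 0

theorem InvT.infinitesimal {n N : ℕ} {T : (Fin N → Fin n) → ℝ} (hT : InvT T) (i j : Fin n) :
    Dop i j T = Dop j i T := by
  by_cases hij : i = j
  · rw [hij]
  have hent : ∀ x y, HasDerivAt (fun θ => rot i j θ x y) (planeX i j x y) 0 := by
    intro x y
    have h1 : HasDerivAt (fun θ : ℝ => (1 : Matrix (Fin n) (Fin n) ℝ) x y +
        (Real.cos θ - 1) * planeP i j x y + Real.sin θ * planeX i j x y)
        (0 + (-Real.sin 0) * planeP i j x y + Real.cos 0 * planeX i j x y) 0 :=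
      ((hasDerivAt_const _ _).add (((Real.hasDerivAt_cos 0).sub_const 1).mul_const _)).add
        ((Real.hasDerivAt_sin 0).mul_const _)
    simpa [rot] using h1
  ext c
  have hd : HasDerivAt (fun θ => ∑ K : Fin N → Fin n, (∏ r, rot i j θ (c r) (K r)) * T K)
      (∑ K : Fin N → Fin n, (∑ r, (∏ s ∈ Finset.univ.erase r, rot i j 0 (c s) (K s)) •
        planeX i j (c r) (K r)) * T K) 0 := by
    refine HasDerivAt.fun_sum fun K _ => ?_
    refine HasDerivAt.mul_const ?_ _
    exact HasDerivAt.fun_finsetProd fun r _ => hent _ _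
  have hc : (fun θ => ∑ K : Fin N → Fin n, (∏ r, rot i j θ (c r) (K r)) * T K)
      = fun _ => T c := by
    funext θ
    exact hT _ (rot_mem hij θ) c
  rw [hc] at hd
  have h0 := hd.unique (hasDerivAt_const _ _)
  simp only [rot_zero, smul_eq_mul, Finset.sum_mul] at h0
  rw [Finset.sum_comm] at h0
  have hr : ∀ r, ∑ K : Fin N → Fin n, (∏ s ∈ Finset.univ.erase r,
      (1 : Matrix (Fin n) (Fin n) ℝ) (c s) (K s)) * planeX i j (c r) (K r) * T K
      = (if c r = i then T (Function.update c r j) else 0)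
        - (if c r = j then T (Function.update c r i) else 0) := by
    intro r
    have h1 : ∑ K : Fin N → Fin n, (∏ s ∈ Finset.univ.erase r,
      (1 : Matrix (Fin n) (Fin n) ℝ) (c s) (K s)) * planeX i j (c r) (K r) * T K
      = ∑ a, planeX i j (c r) a * T (Function.update c r a) := by
      symm
      refine Finset.sum_of_injOn (fun a => Function.update c r a) ?_ ?_ ?_ ?_
      · intro a _ b _ hab
        have := congrFun hab r
        simpa using this
      · intro a _; simp
      · intro K _ hK
        have : ∃ s, s ≠ r ∧ c s ≠ K s := by
          by_contra hcon
          push Not at hcon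
          apply hK
          refine ⟨K r, by simp, ?_⟩
          ext s
          by_cases hs : s = r
          · subst hs; simp
          · simp [hs, hcon s hs]
        obtain ⟨s, hs, hs'⟩ := this
        rw [Finset.prod_eq_zero (i := s) (by simp [hs])]
        · simp
        · simp [hs']
      · intro a _
        rw [Finset.prod_eq_one]
        · simp
        · intro s hs
          have : s ≠ r := by simpa using hs
          show (1 : Matrix (Fin n) (Fin n) ℝ) (c s) (Function.update c r a s) = 1
          rw [Function.update_of_ne this, Matrix.one_apply_eq]
    rw [h1]
    simp only [planeX, Matrix.sub_apply, Matrix.single_apply, sub_mul, Finset.sum_sub_distrib]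
    congr 1
    · by_cases h : c r = i
      · simp [h]
      · simp [h, Ne.symm h]
    · by_cases h : c r = j
      · simp [h]
      · simp [h, Ne.symm h]
  simp only [hr, Finset.sum_sub_distrib] at h0
  exact sub_eq_zero.mp h0

theorem Dop_adj {n N : ℕ} (i j : Fin n) (A B : (Fin N → Fin n) → ℝ) :
    ∑ c, Dop i j A c * B c = ∑ c, A c * Dop j i B c := by
  simp only [Dop, Finset.sum_mul, Finset.mul_sum]
  rw [Finset.sum_comm]
  rw [Finset.sum_comm (s := (Finset.univ : Finset (Fin N → Fin n)))]
  refine Finset.sum_congr rfl fun r _ => ?_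
  simp only [ite_mul, mul_ite, zero_mul, mul_zero, ← Finset.sum_filter]
  refine Finset.sum_nbij' (fun c => Function.update c r j) (fun c => Function.update c r i)
    ?_ ?_ ?_ ?_ ?_
  · intro c hc; simp
  · intro c hc; simp
  · intro c hc
    have : c r = i := by simpa using hc
    simp [← this]
  · intro c hc
    have : c r = j := by simpa using hc
    simp [← this]
  · intro c hc
    have : c r = i := by simpa using hc
    simp [← this]

theorem traceless_support {n N : ℕ} {T : (Fin N → Fin n) → ℝ} (hT : InvT T)
    (htr : ∀ r s : Fin N, r ≠ s → ∀ c : Fin N → Fin n,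
      ∑ j, T (Function.update (Function.update c r j) s j) = 0)
    (c : Fin N → Fin n) (hc : ¬ Function.Injective c) : T c = 0 := by
  -- the Casimir computation
  have hcas : ∀ c, ∑ i, ∑ j, Dop i j (Dop i j T) c = N * T c := by
    intro c
    have h1 : ∀ i j, Dop i j (Dop i j T) c = ∑ r, if c r = i then
        ∑ s, (if Function.update c r j s = i then
          T (Function.update (Function.update c r j) s j) else 0) else 0 := fun i j => rfl
    simp only [h1]
    rw [Finset.sum_comm]
    simp only [Finset.sum_comm (s := (Finset.univ : Finset (Fin n)))
      (t := (Finset.univ : Finset (Fin N)))]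
    have h2 : ∀ r : Fin N, (∑ j : Fin n, ∑ i : Fin n, if c r = i then
        ∑ s, (if Function.update c r j s = i then
          T (Function.update (Function.update c r j) s j) else 0) else 0) = T c := by
      intro r
      simp only [Finset.sum_ite_eq, Finset.mem_univ, if_true]
      rw [Finset.sum_comm, Finset.sum_eq_single r]
      · simp
      · intro s _ hs
        simp only [Function.update_of_ne hs]
        by_cases h : c s = c r
        · simp only [h, if_true]
          exact htr r s hs.symm c
        · simp [h]
      · simp
    simp only [h2]
    simp
  have hsum : ∑ i, ∑ j, ∑ c, Dop i j T c ^ 2 = N * ∑ c, T c ^ 2 := by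
    have : ∀ i j, ∑ c, Dop i j T c ^ 2 = ∑ c, T c * Dop i j (Dop i j T) c := by
      intro i j
      rw [hT.infinitesimal i j, ← Dop_adj]
      refine Finset.sum_congr rfl fun c _ => ?_
      rw [sq]
    simp only [this]
    rw [Finset.sum_congr rfl (fun i _ => Finset.sum_comm), Finset.sum_comm, Finset.mul_sum]
    refine Finset.sum_congr rfl fun c _ => ?_
    simp only [← Finset.mul_sum]
    rw [hcas]; ring
  let m : Fin n → (Fin N → Fin n) → ℕ := fun i c => (Finset.univ.filter fun r => c r = i).card
  have hD : ∀ i c, Dop i i T c = m i c * T c := by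
    intro i c
    have : ∀ r, (if c r = i then T (Function.update c r i) else 0) = if c r = i then T c else 0 := by
      intro r
      by_cases h : c r = i
      · simp [← h]
      · simp [h]
    simp only [Dop, this, ← Finset.sum_filter, Finset.sum_const, nsmul_eq_mul, m]
  have hm : ∀ c, ∑ i, (m i c : ℝ) = N := by
    intro c
    have := Finset.card_eq_sum_card_fiberwise (f := c) (s := Finset.univ) (t := Finset.univ)
      (by intro x _; simp)
    rw [Finset.card_univ, Fintype.card_fin] at this
    exact_mod_cast this.symm
  have hle : ∑ i, ∑ c, Dop i i T c ^ 2 ≤ N * ∑ c, T c ^ 2 := by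
    rw [← hsum]
    refine Finset.sum_le_sum fun i _ => ?_
    exact Finset.single_le_sum (f := fun j => ∑ c, Dop i j T c ^ 2)
      (fun j _ => Finset.sum_nonneg fun c _ => sq_nonneg _) (Finset.mem_univ i)
  have hq : ∑ c, (∑ i, ((m i c : ℝ) * (m i c - 1))) * T c ^ 2 ≤ 0 := by
    have h1 : ∀ c, (∑ i, ((m i c : ℝ) * (m i c - 1))) * T c ^ 2
        = ∑ i, Dop i i T c ^ 2 - N * T c ^ 2 := by
      intro c
      rw [← hm c]
      simp only [hD, Finset.sum_mul, ← Finset.sum_sub_distrib]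
      refine Finset.sum_congr rfl fun i _ => ?_
      ring
    simp only [h1, Finset.sum_sub_distrib, ← Finset.mul_sum]
    rw [Finset.sum_comm]
    linarith
  have hnn : ∀ k : ℕ, 0 ≤ (k : ℝ) * (k - 1) := by
    intro k
    rcases Nat.eq_zero_or_pos k with h | h
    · simp [h]
    · have : (1 : ℝ) ≤ k := by exact_mod_cast h
      nlinarith
  have hterm : ∀ c, 0 ≤ (∑ i, ((m i c : ℝ) * (m i c - 1))) * T c ^ 2 := fun c =>
    mul_nonneg (Finset.sum_nonneg fun i _ => hnn _) (sq_nonneg _)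
  have hz := (Finset.sum_eq_zero_iff_of_nonneg (fun c _ => hterm c)).mp
    (le_antisymm hq (Finset.sum_nonneg fun c _ => hterm c)) c (Finset.mem_univ c)
  rcases mul_eq_zero.mp hz with h | h
  · exfalso
    have hi := (Finset.sum_eq_zero_iff_of_nonneg (fun i _ => hnn (m i c))).mp h
    apply hc
    intro r s hrs
    by_contra hne
    have h2 : 1 < m (c r) c :=
      Finset.one_lt_card.mpr ⟨r, by simp, s, by simp [hrs], hne⟩
    have h3 := hi (c r) (Finset.mem_univ _)
    have h4 : (1 : ℝ) < m (c r) c := by exact_mod_cast h2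
    nlinarith
  · exact pow_eq_zero_iff (two_ne_zero) |>.mp h

/-! ### Diagram tensors -/

/-- The tensor of the involution `β` with fixed points enumerated by `e`, decorated by `w`. -/
def Gten {n m N : ℕ} (β : Fin N → Fin N) (e : Fin m → Fin N) (w : (Fin m → Fin n) → ℝ) :
    (Fin N → Fin n) → ℝ :=
  fun c => if ∀ p, c p = c (β p) then w (c ∘ e) else 0

/-- `β` is an involution with fixed points enumerated by `e`. -/
structure GOK {m N : ℕ} (β : Fin N → Fin N) (e : Fin m → Fin N) : Prop where
  invol : ∀ p, β (β p) = p
  inj : Function.Injective e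
  fix : ∀ p, β p = p ↔ p ∈ Set.range e

/-- The determinant tensor. -/
def detw (n : ℕ) : (Fin n → Fin n) → ℝ :=
  fun c => Matrix.det (Matrix.of fun a r : Fin n => if c r = a then (1 : ℝ) else 0)

/-- The spanning set. -/
def Gset (n N : ℕ) : Set ((Fin N → Fin n) → ℝ) :=
  {T | (∃ (β : Fin N → Fin N) (e : Fin 0 → Fin N), GOK β e ∧ T = Gten β e (fun _ => 1)) ∨
    (∃ (β : Fin N → Fin N) (e : Fin n → Fin N), GOK β e ∧ T = Gten β e (detw n))}

theorem GOK.conj {m N : ℕ} {β : Fin N → Fin N} {e : Fin m → Fin N} (h : GOK β e)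
    (f : Equiv.Perm (Fin N)) : GOK (fun p => f (β (f.symm p))) (fun x => f (e x)) where
  invol p := by simp [h.invol]
  inj := f.injective.comp h.inj
  fix p := by
    rw [← Equiv.eq_symm_apply, h.fix]
    simp [Equiv.eq_symm_apply]

theorem Gten_reix {n m N : ℕ} (β : Fin N → Fin N) (e : Fin m → Fin N) (w : (Fin m → Fin n) → ℝ)
    (f : Equiv.Perm (Fin N)) :
    reix f (Gten β e w) = Gten (fun p => f (β (f.symm p))) (fun x => f (e x)) w := by
  funext c
  have : (∀ p, c (f p) = c (f (β p))) ↔ ∀ p, c p = c (f (β (f.symm p))) := by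
    constructor
    · intro h p
      simpa using h (f.symm p)
    · intro h p
      simpa using h (f p)
  simp only [reix, LinearMap.coe_mk, AddHom.coe_mk, Gten, Function.comp_apply, this]
  rfl

/-- Extension of an involution by the transposition of the two new points. -/
def extβ {M : ℕ} (β : Fin M → Fin M) : Fin (M + 2) → Fin (M + 2) :=
  Fin.cons 1 (Fin.cons 0 (fun i => (β i).succ.succ) : Fin (M + 1) → Fin (M + 2))

theorem extβ_zero {M : ℕ} (β : Fin M → Fin M) : extβ β 0 = 1 := rfl
theorem extβ_one {M : ℕ} (β : Fin M → Fin M) : extβ β 1 = 0 := rfl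
theorem extβ_succ {M : ℕ} (β : Fin M → Fin M) (i : Fin M) :
    extβ β i.succ.succ = (β i).succ.succ := rfl

theorem forall_fin2 {M : ℕ} {P : Fin (M + 2) → Prop} :
    (∀ p, P p) ↔ P 0 ∧ P 1 ∧ ∀ i : Fin M, P i.succ.succ := by
  rw [Fin.forall_fin_succ, Fin.forall_fin_succ]
  rfl

theorem succ_succ_ne_one {M : ℕ} (i : Fin M) : i.succ.succ ≠ (1 : Fin (M + 2)) := by
  have h1 : (1 : Fin (M + 2)) = Fin.succ 0 := rfl
  rw [h1, Ne, Fin.succ_inj]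
  exact Fin.succ_ne_zero _

theorem cup_Gten {n m M : ℕ} (β : Fin M → Fin M) (e : Fin m → Fin M) (w : (Fin m → Fin n) → ℝ) :
    cup (Gten β e w) = Gten (extβ β) (fun x => (e x).succ.succ) w := by
  funext c
  rw [cup_apply]
  simp only [Gten, forall_fin2, extβ_zero, extβ_one, extβ_succ]
  by_cases h : c 0 = c 1
  · simp only [h, true_and]
    rfl
  · simp [h]

theorem GOK.ext {m M : ℕ} {β : Fin M → Fin M} {e : Fin m → Fin M} (h : GOK β e) :
    GOK (extβ β) (fun x => (e x).succ.succ) where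
  invol := by
    rw [forall_fin2]
    simp [extβ_zero, extβ_one, extβ_succ, h.invol]
  inj := by
    intro x y hxy
    apply h.inj
    simpa using hxy
  fix := by
    rw [forall_fin2]
    refine ⟨?_, ?_, ?_⟩
    · simp [extβ_zero]
    · have h1 : (1 : Fin (M + 2)) = Fin.succ 0 := rfl
      simp only [extβ_one, Set.mem_range]
      constructor
      · intro h; exact absurd h (by simp)
      · rintro ⟨x, hx⟩
        rw [h1, Fin.succ_inj] at hx
        exact absurd hx (Fin.succ_ne_zero _)
    · intro i
      simp [extβ_succ, h.fix]

theorem exists_perm {M : ℕ} {r s : Fin (M + 2)} (h : r ≠ s) :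
    ∃ f : Equiv.Perm (Fin (M + 2)), f 0 = r ∧ f 1 = s := by
  refine ⟨Equiv.swap (Equiv.swap 0 r 1) s * Equiv.swap 0 r, ?_, ?_⟩
  · simp only [Equiv.Perm.mul_apply, Equiv.swap_apply_left]
    refine Equiv.swap_apply_of_ne_of_ne ?_ h
    intro h2
    have : Equiv.swap 0 r 0 = Equiv.swap 0 r 1 := by rw [Equiv.swap_apply_left, ← h2]
    exact absurd ((Equiv.swap 0 r).injective this) (by simp)
  · simp

theorem GOK.reduce {m M : ℕ} {β : Fin (M + 2) → Fin (M + 2)} {e : Fin m → Fin (M + 2)}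
    (h : GOK β e) (h0 : β 0 = 1) :
    ∃ (β' : Fin M → Fin M) (e' : Fin m → Fin M), GOK β' e' ∧ β = extβ β' ∧
      e = fun x => (e' x).succ.succ := by
  have h1 : β 1 = 0 := by rw [← h0, h.invol]
  have hex : ∀ p : Fin (M + 2), p ≠ 0 → p ≠ 1 → ∃ i : Fin M, i.succ.succ = p := by
    rw [forall_fin2]
    simp
  have hb : ∀ i : Fin M, ∃ j : Fin M, j.succ.succ = β i.succ.succ := by
    intro i
    apply hex
    · intro h2
      have := congrArg β h2
      rw [h.invol, h0] at this
      exact absurd this (succ_succ_ne_one i)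
    · intro h2
      have := congrArg β h2
      rw [h.invol, h1] at this
      exact absurd this (by simp)
  have he : ∀ x : Fin m, ∃ j : Fin M, j.succ.succ = e x := by
    intro x
    have hx := (h.fix (e x)).mpr ⟨x, rfl⟩
    apply hex
    · intro h2
      rw [h2, h0] at hx
      exact absurd hx (by simp)
    · intro h2
      rw [h2, h1] at hx
      exact absurd hx (by simp)
  choose β' hβ' using hb
  choose e' he' using he
  have hss : Function.Injective (fun i : Fin M => i.succ.succ) :=
    (Fin.succ_injective _).comp (Fin.succ_injective _)
  refine ⟨β', e', ⟨?_, ?_, ?_⟩, ?_, ?_⟩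
  · intro p
    apply hss
    simp only [hβ', h.invol]
  · intro x y hxy
    apply h.inj
    rw [← he', ← he', hxy]
  · intro p
    rw [← hss.eq_iff]
    simp only [hβ', h.fix, ← he', Set.mem_range]
    simp
  · funext p
    revert p
    rw [forall_fin2]
    refine ⟨h0, h1, fun i => ?_⟩
    rw [extβ_succ, hβ']
  · funext x
    exact (he' x).symm

theorem reix_symm {n N : ℕ} (f : Equiv.Perm (Fin N)) (T : (Fin N → Fin n) → ℝ) :
    reix f (reix f.symm T) = T := by
  funext c
  simp only [reix, LinearMap.coe_mk, AddHom.coe_mk]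
  congr 1
  funext x
  simp

theorem InvT.Gten {n m : ℕ} {w : (Fin m → Fin n) → ℝ} (hw : InvT w) :
    ∀ (N : ℕ) (β : Fin N → Fin N) (e : Fin m → Fin N), GOK β e → InvT (Gten β e w) := by
  intro N
  induction N using Nat.strong_induction_on with
  | _ N ih =>
    intro β e h
    by_cases hfix : ∀ p, β p = p
    · have hsurj : Function.Surjective e := fun p => (h.fix p).mp (hfix p)
      have hbij : Function.Bijective e := ⟨h.inj, hsurj⟩
      have hcard := Fintype.card_of_bijective hbij
      simp only [Fintype.card_fin] at hcard
      subst hcard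
      have : _root_.Gten β e w = _root_.reix (Equiv.ofBijective e hbij) w := by
        funext c
        simp only [_root_.Gten, hfix, _root_.reix, LinearMap.coe_mk, AddHom.coe_mk]
        simp
      rw [this]
      exact hw.reix _
    · push Not at hfix
      obtain ⟨p, hp⟩ := hfix
      match N, ih, β, e, h, p, hp with
      | 0, ih, β, e, h, p, hp => exact p.elim0
      | 1, ih, β, e, h, p, hp => exact absurd (Subsingleton.elim _ _) hp
      | M + 2, ih, β, e, h, p, hp =>
        obtain ⟨f, hf0, hf1⟩ := exists_perm hp.symm
        have h' := h.conj f.symm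
        obtain ⟨β', e', hok, hβ, he⟩ := h'.reduce (by
          rw [Equiv.symm_symm, hf0, Equiv.symm_apply_eq, hf1])
        have : _root_.Gten β e w = _root_.reix f (_root_.cup (_root_.Gten β' e' w)) := by
          rw [cup_Gten, ← hβ, ← he, ← Gten_reix, reix_symm]
        rw [this]
        exact (ih M (by omega) β' e' hok).cup.reix f

theorem detw_inv (n : ℕ) : InvT (detw n) := by
  intro g hg c
  have h1 : ∀ K : Fin n → Fin n, (∏ r, g (c r) (K r)) * detw n K
      = ∑ σ : Equiv.Perm (Fin n), (Equiv.Perm.sign σ : ℝ) *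
        ∏ r, (g (c r) (K r) * if K r = σ r then 1 else 0) := by
    intro K
    rw [detw, Matrix.det_apply', Finset.mul_sum]
    refine Finset.sum_congr rfl fun σ _ => ?_
    rw [Finset.prod_mul_distrib]
    simp only [Matrix.of_apply]
    ring
  simp only [h1]
  rw [Finset.sum_comm]
  simp only [← Finset.mul_sum]
  have h2 : ∀ σ : Equiv.Perm (Fin n),
      ∑ K : Fin n → Fin n, ∏ r, (g (c r) (K r) * if K r = σ r then (1 : ℝ) else 0)
      = ∏ r, g (c r) (σ r) := by
    intro σ
    rw [sum_prod_fn (fun r a => g (c r) a * if a = σ r then (1 : ℝ) else 0)]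
    simp
  simp only [h2]
  have h3 : gᵀ * (Matrix.of fun a r : Fin n => if c r = a then (1 : ℝ) else 0)
      = Matrix.of fun a r => g (c r) a := by
    ext a r
    simp [Matrix.mul_apply]
  have h4 := congrArg Matrix.det h3
  rw [Matrix.det_mul, Matrix.det_transpose, hg.2, one_mul] at h4
  rw [detw, h4, Matrix.det_apply']
  rfl

theorem one_inv (n : ℕ) : InvT (fun _ : Fin 0 → Fin n => (1 : ℝ)) := by
  intro g hg c
  simp

theorem Gset_inv {n N : ℕ} {T : (Fin N → Fin n) → ℝ} (hT : T ∈ Gset n N) : InvT T := by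
  rcases hT with ⟨β, e, h, rfl⟩ | ⟨β, e, h, rfl⟩
  · exact (one_inv n).Gten N β e h
  · exact (detw_inv n).Gten N β e h

theorem detw_noninj {n : ℕ} {c : Fin n → Fin n} (hc : ¬ Function.Injective c) : detw n c = 0 := by
  rw [Function.Injective] at hc
  push Not at hc
  obtain ⟨r, s, h, hne⟩ := hc
  refine Matrix.det_zero_of_column_eq hne ?_
  intro a
  simp [h]

theorem detw_id (n : ℕ) : detw n id = 1 := by
  have : (Matrix.of fun a r : Fin n => if id r = a then (1 : ℝ) else 0) = 1 := by
    ext a r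
    simp [Matrix.one_apply, eq_comm]
  rw [detw, this, Matrix.det_one]

/-- An invariant tensor supported on bijections and vanishing at the identity is zero. -/
theorem inv_bij_zero {n : ℕ} {T : (Fin n → Fin n) → ℝ} (hT : InvT T)
    (hs : ∀ c, ¬ Function.Injective c → T c = 0) (hid : T id = 0) : T = 0 := by
  have hsw : ∀ (i j : Fin n), i ≠ j → ∀ σ : Equiv.Perm (Fin n), T σ = 0 →
      T (Equiv.swap i j * σ : Equiv.Perm (Fin n)) = 0 := by
    intro i j hij σ h0
    rw [hT.quarter hij]
    have : (fun r => Equiv.swap i j ((Equiv.swap i j * σ : Equiv.Perm (Fin n)) r)) = σ := by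
      funext r; simp
    rw [this, h0, mul_zero]
  have hperm : ∀ σ : Equiv.Perm (Fin n), T σ = 0 := by
    intro σ
    induction σ using Equiv.Perm.swap_induction_on with
    | one => exact hid
    | swap_mul f x y hxy ih => exact hsw x y hxy f ih
  funext c
  by_cases hc : Function.Injective c
  · exact hperm (Equiv.ofBijective c (Finite.injective_iff_bijective.mp hc))
  · exact hs c hc

theorem traceless_mem {n N : ℕ} {T : (Fin N → Fin n) → ℝ} (hT : InvT T)
    (htr : ∀ r s : Fin N, r ≠ s → ∀ c : Fin N → Fin n,
      ∑ j, T (Function.update (Function.update c r j) s j) = 0) :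
    T ∈ Submodule.span ℝ (Gset n N) := by
  have hsupp := traceless_support hT htr
  rcases Nat.eq_zero_or_pos N with hN | hN
  · subst hN
    have : T = T Fin.elim0 • Gten (n := n) id id (fun _ => (1 : ℝ)) := by
      funext c
      have : c = Fin.elim0 := Subsingleton.elim _ _
      simp [Gten, this]
    rw [this]
    refine Submodule.smul_mem _ _ (Submodule.subset_span (Or.inl ⟨id, id, ⟨?_, ?_, ?_⟩, rfl⟩))
    · intro p; rfl
    · exact Function.injective_id
    · intro p; exact p.elim0
  rcases lt_trichotomy N n with h | h | h
  · -- too few positions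
    have : T = 0 := by
      funext c
      by_cases hc : Function.Injective c
      · have hns : ¬ Function.Surjective c := by
          intro hs
          have := Fintype.card_le_of_surjective c hs
          simp only [Fintype.card_fin] at this
          omega
        rw [Function.Surjective] at hns
        push Not at hns
        obtain ⟨j, hj⟩ := hns
        have h1 := hT.quarter (hj ⟨0, hN⟩) c
        have h2 := hT.quarter (hj ⟨0, hN⟩) (fun r => Equiv.swap (c ⟨0, hN⟩) j (c r))
        have h3 : (∏ r, if c r = j then (-1 : ℝ) else 1) = 1 := by simp [hj]
        have h4 : (∏ r, if Equiv.swap (c ⟨0, hN⟩) j (c r) = j then (-1 : ℝ) else 1) = -1 := by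
          have : ∀ r, Equiv.swap (c ⟨0, hN⟩) j (c r) = j ↔ r = ⟨0, hN⟩ := by
            intro r
            rw [Equiv.swap_apply_eq_iff, Equiv.swap_apply_right, hc.eq_iff]
          simp [this]
        rw [h3, one_mul] at h1
        rw [h4] at h2
        simp only [Equiv.swap_apply_self] at h2
        simp only [Pi.zero_apply]
        linarith
      · exact hsupp c hc
    rw [this]
    exact Submodule.zero_mem _
  · subst h
    have h0 : T + (-T id) • detw N = 0 := by
      refine inv_bij_zero (hT.add ((detw_inv N).smul _)) ?_ ?_
      · intro c hc
        simp [hsupp c hc, detw_noninj hc]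
      · simp [detw_id]
    have h1 : T = T id • Gten id id (detw N) := by
      have : Gten id id (detw N) = detw N := by
        funext c; simp [Gten]
      rw [this]
      rw [neg_smul, ← sub_eq_add_neg, sub_eq_zero] at h0
      exact h0
    rw [h1]
    refine Submodule.smul_mem _ _ (Submodule.subset_span (Or.inr ⟨id, id, ⟨?_, ?_, ?_⟩, rfl⟩))
    · intro p; rfl
    · exact Function.injective_id
    · intro p; simp
  · have : T = 0 := by
      funext c
      refine hsupp c ?_
      intro hc
      have := Fintype.card_le_of_injective c hc
      simp only [Fintype.card_fin] at this
      omega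
    rw [this]
    exact Submodule.zero_mem _

theorem exists_decomp {X : Type*} [Fintype X] (U : Submodule ℝ (X → ℝ)) (T : X → ℝ) :
    ∃ u ∈ U, ∀ v ∈ U, ∑ x, v x * (T x - u x) = 0 := by
  let L : (X → ℝ) ≃ₗ[ℝ] EuclideanSpace ℝ X := (WithLp.linearEquiv 2 ℝ (X → ℝ)).symm
  let V : Submodule ℝ (EuclideanSpace ℝ X) := U.map (L : (X → ℝ) →ₗ[ℝ] EuclideanSpace ℝ X)
  obtain ⟨y, hy, z, hz, hyz⟩ := V.exists_add_mem_mem_orthogonal (L T)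
  obtain ⟨u, hu, rfl⟩ := hy
  refine ⟨u, hu, fun v hv => ?_⟩
  have h1 := (Submodule.mem_orthogonal _ _).mp hz (L v) ⟨v, hv, rfl⟩
  have h2 : z = L (T - u) := by
    rw [map_sub, hyz]; simp
  rw [h2, PiLp.inner_apply] at h1
  rw [← h1]
  refine Finset.sum_congr rfl fun x _ => ?_
  simp [L, mul_comm]

theorem span_cup {n M : ℕ} (f : Equiv.Perm (Fin (M + 2))) {S : (Fin M → Fin n) → ℝ}
    (hS : S ∈ Submodule.span ℝ (Gset n M)) :
    reix f (cup S) ∈ Submodule.span ℝ (Gset n (M + 2)) := by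
  have : Submodule.span ℝ (Gset n M) ≤
      (Submodule.span ℝ (Gset n (M + 2))).comap ((reix f).comp cup) := by
    rw [Submodule.span_le]
    rintro S (⟨β, e, h, rfl⟩ | ⟨β, e, h, rfl⟩)
    · refine Submodule.subset_span (Or.inl ⟨_, _, h.ext.conj f, ?_⟩)
      rw [LinearMap.comp_apply, cup_Gten, Gten_reix]
    · refine Submodule.subset_span (Or.inr ⟨_, _, h.ext.conj f, ?_⟩)
      rw [LinearMap.comp_apply, cup_Gten, Gten_reix]
  exact this hS

theorem sum_reix {n N : ℕ} (f : Equiv.Perm (Fin N)) (A B : (Fin N → Fin n) → ℝ) :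
    ∑ c, reix f A c * B c = ∑ c, A c * reix f.symm B c := by
  refine Fintype.sum_equiv (Equiv.arrowCongr f.symm (Equiv.refl _)) _ _ ?_
  intro K
  have : (Equiv.arrowCongr f.symm (Equiv.refl _)) K = K ∘ f := by
    ext; simp
  rw [this]
  simp only [reix, LinearMap.coe_mk, AddHom.coe_mk]
  congr 2
  funext x
  simp

/-- The first fundamental theorem for `SO(n)`. -/
theorem fft (n : ℕ) : ∀ (N : ℕ) (T : (Fin N → Fin n) → ℝ), InvT T →
    T ∈ Submodule.span ℝ (Gset n N) := by
  intro N
  induction N using Nat.strong_induction_on with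
  | _ N ih =>
    intro T hT
    match N, ih, T, hT with
    | 0, ih, T, hT => exact traceless_mem hT (fun r => r.elim0)
    | 1, ih, T, hT => exact traceless_mem hT (fun r s h => absurd (Subsingleton.elim _ _) h)
    | M + 2, ih, T, hT =>
      let U : Submodule ℝ ((Fin (M + 2) → Fin n) → ℝ) := Submodule.span ℝ
        {A | ∃ (f : Equiv.Perm (Fin (M + 2))) (S : (Fin M → Fin n) → ℝ), InvT S ∧
          A = reix f (cup S)}
      have hU1 : U ≤ Submodule.span ℝ (Gset n (M + 2)) := by
        refine Submodule.span_le.mpr ?_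
        rintro _ ⟨f, S, hS, rfl⟩
        exact span_cup f (ih M (by omega) S hS)
      have hU2 : U ≤ InvSub n (M + 2) := by
        refine Submodule.span_le.mpr ?_
        rintro _ ⟨f, S, hS, rfl⟩
        exact hS.cup.reix f
      obtain ⟨u, hu, hort⟩ := exists_decomp U T
      have hT0 : InvT (T - u) := (InvSub n (M + 2)).sub_mem hT (hU2 hu)
      have hmem : T - u ∈ Submodule.span ℝ (Gset n (M + 2)) := by
        refine traceless_mem hT0 ?_
        intro r s hrs c
        obtain ⟨f, hf0, hf1⟩ := exists_perm hrs
        have hc := (hT0.reix f.symm).contr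
        have h1 := hort (reix f (cup (contr (reix f.symm (T - u)))))
          (Submodule.subset_span ⟨f, _, hc, rfl⟩)
        have h2 := sum_reix f (cup (contr (reix f.symm (T - u)))) (T - u)
        rw [cup_inner] at h2
        simp only [Pi.sub_apply] at h2
        rw [h1] at h2
        have h3 := (Finset.sum_eq_zero_iff_of_nonneg
          (fun d _ => mul_self_nonneg (contr (reix f.symm (T - u)) d))).mp h2.symm
        have h4 := mul_self_eq_zero.mp (h3 (fun i => c (f i.succ.succ)) (Finset.mem_univ _))
        rw [← h4]
        simp only [contr]
        refine Finset.sum_congr rfl fun j _ => ?_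
        simp only [reix, LinearMap.coe_mk, AddHom.coe_mk]
        have h5 : ∀ p, Function.update (Function.update c r j) s j (f p) =
          (Fin.cons j (Fin.cons j (fun i => c (f i.succ.succ)) : Fin (M + 1) → Fin n) :
            Fin (M + 2) → Fin n) p := by
          rw [forall_fin2]
          refine ⟨?_, ?_, ?_⟩
          · rw [hf0, Function.update_of_ne hrs]; simp
          · rw [hf1]
            have : (1 : Fin (M + 2)) = Fin.succ 0 := rfl
            rw [this]
            simp
          · intro i
            have a1 : f i.succ.succ ≠ s := by
              rw [← hf1, f.injective.ne_iff]
              exact succ_succ_ne_one i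
            have a2 : f i.succ.succ ≠ r := by
              rw [← hf0, f.injective.ne_iff]
              simp
            rw [Function.update_of_ne a1, Function.update_of_ne a2]
            simp
        refine congrArg (T - u) (funext fun x => ?_)
        simpa using h5 (f.symm x)
      have := Submodule.add_mem _ hmem (hU1 hu)
      simpa using this

/-! ### Back to linear maps -/

/-- The linear map attached to a tensor. -/
def toMap (n k l : ℕ) : ((Fin (l + k) → Fin n) → ℝ) →ₗ[ℝ]
    (((Fin k → Fin n) → ℝ) →ₗ[ℝ] ((Fin l → Fin n) → ℝ)) where
  toFun T := (Matrix.of fun I J => T (Fin.append I J)).mulVecLin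
  map_add' T S := by
    rw [← Matrix.mulVecLin_add]
    rfl
  map_smul' a T := by
    refine LinearMap.ext fun v => funext fun I => ?_
    simp [Matrix.mulVec, dotProduct, Finset.mul_sum, mul_assoc]

theorem toMap_apply (n k l : ℕ) (T : (Fin (l + k) → Fin n) → ℝ) :
    toMap n k l T = (Matrix.of fun I J => T (Fin.append I J)).mulVecLin := rfl

theorem toMap_surj (n k l : ℕ) (φ : ((Fin k → Fin n) → ℝ) →ₗ[ℝ] ((Fin l → Fin n) → ℝ)) :
    ∃ T, toMap n k l T = φ := by
  refine ⟨fun c => LinearMap.toMatrix' φ (fun i => c (Fin.castAdd k i)) (fun i => c (Fin.natAdd l i)),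
    ?_⟩
  rw [toMap_apply]
  simp only [Fin.append_left, Fin.append_right]
  have : (Matrix.of fun I J => LinearMap.toMatrix' φ (fun i => I i) fun i => J i)
    = LinearMap.toMatrix' φ := rfl
  rw [this, ← Matrix.toLin'_apply', Matrix.toLin'_toMatrix']

theorem sum_append {n k l : ℕ} (F : (Fin (l + k) → Fin n) → ℝ) :
    ∑ K, F K = ∑ I : Fin l → Fin n, ∑ J : Fin k → Fin n, F (Fin.append I J) := by
  rw [← Fintype.sum_prod_type']
  exact (Fintype.sum_equiv (Fin.appendEquiv l k) _ _ (fun _ => rfl)).symm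

theorem tpowM_mul {n : ℕ} (k : ℕ) (g h : Matrix (Fin n) (Fin n) ℝ) :
    tpowM k g * tpowM k h = tpowM k (g * h) := by
  ext I J
  simp only [tpowM, Matrix.mul_apply, Matrix.of_apply, ← Finset.prod_mul_distrib]
  rw [sum_prod_fn (fun r a => g (I r) a * h a (J r))]

theorem tpowM_one {n : ℕ} (k : ℕ) : tpowM k (1 : Matrix (Fin n) (Fin n) ℝ) = 1 := by
  ext I J
  simp only [tpowM, Matrix.of_apply, Matrix.one_apply]
  rw [Finset.prod_ite_zero]
  simp [funext_iff]

theorem tpowM_transpose {n : ℕ} (k : ℕ) (g : Matrix (Fin n) (Fin n) ℝ) :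
    (tpowM k g)ᵀ = tpowM k gᵀ := rfl

theorem toMap_mem (n k l : ℕ) (T : (Fin (l + k) → Fin n) → ℝ) :
    toMap n k l T ∈ EquivSub k l (fun g => gᵀ * g = 1 ∧ g.det = 1) ↔ InvT T := by
  have hsplit : ∀ (g : Matrix (Fin n) (Fin n) ℝ) (I : Fin l → Fin n) (J : Fin k → Fin n),
      ∑ K, (∏ r, g (Fin.append I J r) (K r)) * T K
      = (tpowM l g * (Matrix.of fun I J => T (Fin.append I J)) * (tpowM k g)ᵀ) I J := by
    intro g I J
    rw [sum_append]
    simp only [Matrix.mul_apply, Finset.sum_mul, Fin.prod_univ_add, Fin.append_left,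
      Fin.append_right, tpowM, Matrix.of_apply, Matrix.transpose_apply]
    rw [Finset.sum_comm]
    refine Finset.sum_congr rfl fun J' _ => Finset.sum_congr rfl fun I' _ => ?_
    ring
  have hT : InvT T ↔ ∀ g : Matrix (Fin n) (Fin n) ℝ, (gᵀ * g = 1 ∧ g.det = 1) →
      tpowM l g * (Matrix.of fun I J => T (Fin.append I J)) * (tpowM k g)ᵀ =
        (Matrix.of fun I J => T (Fin.append I J)) := by
    refine forall_congr' fun g => forall_congr' fun hg => ?_
    constructor
    · intro h
      ext I J
      rw [← hsplit, h]
      rfl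
    · intro h c
      have := congrFun (congrFun h (fun i => c (Fin.castAdd k i))) (fun i => c (Fin.natAdd l i))
      rw [← hsplit] at this
      have hc : Fin.append (fun i => c (Fin.castAdd k i)) (fun i => c (Fin.natAdd l i)) = c :=
        Fin.append_castAdd_natAdd
      simpa only [Matrix.of_apply, hc] using this
  rw [hT]
  refine forall_congr' fun g => forall_congr' fun hg => ?_
  rw [toMap_apply, ← Matrix.mulVecLin_mul, ← Matrix.mulVecLin_mul]
  have hk : (tpowM k g)ᵀ * tpowM k g = 1 := by
    rw [tpowM_transpose, tpowM_mul, hg.1, tpowM_one]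
  have hk' : tpowM k g * (tpowM k g)ᵀ = 1 := mul_eq_one_comm.mp hk
  constructor
  · intro h
    have h' : _ * _ = _ * _ := Matrix.toLin'.injective h
    rw [← h', Matrix.mul_assoc, hk', Matrix.mul_one]
  · intro h
    congr 1
    conv_lhs => rw [← h]
    rw [Matrix.mul_assoc, hk, Matrix.mul_one]

theorem prod_pairs {n N : ℕ} (β : Fin N → Fin N) (hβ : ∀ p, β (β p) = p) (c : Fin N → Fin n)
    (s : Finset (Fin N)) (hs : ∀ p, p ∈ s ↔ p < β p) :
    (∏ p ∈ s, if c p = c (β p) then (1 : ℝ) else 0) = if ∀ p, c p = c (β p) then 1 else 0 := by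
  rw [Finset.prod_ite_zero]
  have : (∀ p ∈ s, c p = c (β p)) ↔ ∀ p, c p = c (β p) := by
    constructor
    · intro h p
      rcases lt_trichotomy p (β p) with h1 | h1 | h1
      · exact h p ((hs p).mpr h1)
      · rw [← h1]
      · have := h (β p) ((hs _).mpr (by rw [hβ]; exact h1))
        rw [hβ] at this
        exact this.symm
    · intro h p _
      exact h p
  simp [this]

theorem brauer_eq (n k l : ℕ) (β : BrauerPairing (l + k)) (e : Fin 0 → Fin (l + k)) :
    (brauerMatrix n k l β).mulVecLin = toMap n k l (Gten β.pair e (fun _ => 1)) := by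
  rw [toMap_apply]
  congr 1
  ext I J
  simp only [brauerMatrix, Matrix.of_apply, Gten]
  exact prod_pairs β.pair β.invol _ _ (by simp)

theorem grood_ok {N n : ℕ} (α : GroodPartition N n) : GOK α.pair α.sorted where
  invol := α.invol
  inj := by
    intro a b h
    have := (List.nodup_iff_injective_get.mp (α.free.sort_nodup (· ≤ ·))) h
    simpa using this
  fix p := by
    rw [α.fixed_iff_free, ← Finset.mem_sort (· ≤ ·), List.mem_iff_get]
    constructor
    · rintro ⟨i, hi⟩
      refine ⟨Fin.cast (by rw [Finset.length_sort, α.card_free]) i, ?_⟩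
      rw [← hi]
      rfl
    · rintro ⟨r, hr⟩
      exact ⟨_, hr⟩

theorem grood_eq (n k l : ℕ) (α : GroodPartition (l + k) n) :
    (groodMatrix n k l α).mulVecLin = toMap n k l (Gten α.pair α.sorted (detw n)) := by
  rw [toMap_apply]
  congr 1
  ext I J
  simp only [groodMatrix, Matrix.of_apply, Gten]
  rw [prod_pairs α.pair α.invol]
  · simp only [mul_ite, mul_one, mul_zero]
    rfl
  · intro p
    simp only [Finset.mem_filter, Finset.mem_univ, true_and, ← α.fixed_iff_free]
    constructor
    · exact fun h => h.2
    · exact fun h => ⟨h.ne', h⟩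

theorem Gten_det_change {n N : ℕ} {β : Fin N → Fin N} {e e' : Fin n → Fin N}
    (h : GOK β e) (h' : GOK β e') :
    ∃ a : ℝ, Gten β e (detw n) = a • Gten β e' (detw n) := by
  have hex : ∀ x, ∃ y, e' y = e x := fun x => (h'.fix _).mp ((h.fix _).mpr ⟨x, rfl⟩)
  choose σ hσ using hex
  have hinj : Function.Injective σ := by
    intro x y hxy
    apply h.inj
    rw [← hσ, ← hσ, hxy]
  let τ : Equiv.Perm (Fin n) := Equiv.ofBijective σ (Finite.injective_iff_bijective.mp hinj)
  refine ⟨(Equiv.Perm.sign τ : ℝ), ?_⟩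
  funext c
  simp only [Gten, Pi.smul_apply, smul_eq_mul]
  by_cases hc : ∀ p, c p = c (β p)
  · rw [if_pos hc, if_pos hc]
    rw [detw, detw, ← Matrix.det_permute']
    congr 1
    ext a r
    have : e r = e' (τ r) := (hσ r).symm
    simp [this]
  · rw [if_neg hc, if_neg hc, mul_zero]
/-- For `n ≤ l + k` with `n ≡ l + k (mod 2)`, the space
`Hom_{SO(n)}((ℝⁿ)^{⊗k}, (ℝⁿ)^{⊗l})` is spanned by the `E_β` (over `(k,l)`-Brauer
partitions `β` — these exist only when `l + k` is even) together with the `H_α`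
(over `(l+k)\\n`-partitions `α`). -/
theorem stmt11 (n k l : ℕ) (hn : 1 ≤ n) (hle : n ≤ l + k)
    (hmod : n % 2 = (l + k) % 2) :
    Submodule.span ℝ
      ({φ : ((Fin k → Fin n) → ℝ) →ₗ[ℝ] ((Fin l → Fin n) → ℝ) |
          ∃ β : BrauerPairing (l + k), φ = (brauerMatrix n k l β).mulVecLin} ∪
       {φ : ((Fin k → Fin n) → ℝ) →ₗ[ℝ] ((Fin l → Fin n) → ℝ) |
          ∃ α : GroodPartition (l + k) n, φ = (groodMatrix n k l α).mulVecLin})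
      = EquivSub k l (fun g => gᵀ * g = 1 ∧ g.det = 1) := by
  apply le_antisymm
  · rw [Submodule.span_le]
    rintro φ (⟨β, rfl⟩ | ⟨α, rfl⟩)
    · rw [brauer_eq n k l β Fin.elim0, SetLike.mem_coe, toMap_mem]
      refine Gset_inv (Or.inl ⟨_, _, ⟨β.invol, fun x => x.elim0, fun p => ?_⟩, rfl⟩)
      constructor
      · intro h
        exact absurd h (β.ne p)
      · rintro ⟨x, _⟩
        exact x.elim0
    · rw [grood_eq, SetLike.mem_coe, toMap_mem]
      exact Gset_inv (Or.inr ⟨_, _, grood_ok α, rfl⟩)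
  · intro φ hφ
    obtain ⟨T, rfl⟩ := toMap_surj n k l φ
    rw [toMap_mem] at hφ
    have hT := fft n (l + k) T hφ
    have hle2 : Submodule.span ℝ (Gset n (l + k)) ≤ (Submodule.span ℝ
      ({φ : ((Fin k → Fin n) → ℝ) →ₗ[ℝ] ((Fin l → Fin n) → ℝ) |
          ∃ β : BrauerPairing (l + k), φ = (brauerMatrix n k l β).mulVecLin} ∪
       {φ : ((Fin k → Fin n) → ℝ) →ₗ[ℝ] ((Fin l → Fin n) → ℝ) |
          ∃ α : GroodPartition (l + k) n, φ = (groodMatrix n k l α).mulVecLin})).comap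
            (toMap n k l) := by
      rw [Submodule.span_le]
      rintro S (⟨β, e, h, rfl⟩ | ⟨β, e, h, rfl⟩)
      · have hne : ∀ p, β p ≠ p := by
          intro p hp
          obtain ⟨x, _⟩ := (h.fix p).mp hp
          exact x.elim0
        refine Submodule.subset_span (Or.inl ⟨⟨β, h.invol, hne⟩, ?_⟩)
        rw [brauer_eq n k l _ e]
      · let α : GroodPartition (l + k) n :=
          { free := Finset.univ.image e
            card_free := by
              rw [Finset.card_image_of_injective _ h.inj, Finset.card_univ, Fintype.card_fin]
            pair := β
            invol := h.invol
            fixed_iff_free := by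
              intro p
              rw [h.fix]
              simp }
        obtain ⟨a, ha⟩ := Gten_det_change h (grood_ok α)
        rw [ha, SetLike.mem_coe, Submodule.mem_comap, map_smul]
        refine Submodule.smul_mem _ _ (Submodule.subset_span (Or.inr ⟨α, ?_⟩))
        rw [grood_eq]
    exact hle2 hT
end
end

section
/- Let n ≥ 1 and N ≥ 0 be integers, and let f : (ℝⁿ)^N → ℝ be a multilinear map that is O(n)-invariant, i.e. f(gz₁,…,gz_N) = f(z₁,…,z_N) for all g ∈ O(n) and all z₁,…,z_N ∈ ℝⁿ. Then f lies in the linear span of the multilinear maps (z₁,…,z_N) ↦ ∏_{{p,q}∈β} ⟨z_p, z_q⟩, where β ranges over all partitions of {1,…,N} into disjoint pairs and ⟨·,·⟩ is the Euclidean inner product. In particular, if N is odd then f = 0. -/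
open Matrix

noncomputable section

open MvPolynomial

/-- Gaussian moments. -/
def gmom : ℕ → ℝ
  | 0 => 1
  | 1 => 0
  | (k+2) => (k+1) * gmom k

/-- Formal Gaussian expectation on polynomials. -/
def gE (m : ℕ) : MvPolynomial (Fin m) ℝ →ₗ[ℝ] ℝ :=
  (basisMonomials (Fin m) ℝ).constr ℝ (fun d => ∏ i, gmom (d i))

lemma gE_monomial (m : ℕ) (d : Fin m →₀ ℕ) : gE m (monomial d 1) = ∏ i, gmom (d i) := by
  have := (basisMonomials (Fin m) ℝ).constr_basis ℝ (fun d => ∏ i, gmom (d i)) d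
  simpa [gE] using this

lemma gE_one (m : ℕ) : gE m 1 = 1 := by
  have := gE_monomial m 0
  simpa [gmom] using this

lemma gmom_succ (k : ℕ) : gmom (k+1) = k * gmom (k-1) := by
  cases k with
  | zero => simp [gmom]
  | succ k => simp [gmom]

lemma gE_stein (m : ℕ) (a : Fin m) (p : MvPolynomial (Fin m) ℝ) :
    gE m (X a * p) = gE m (pderiv a p) := by
  have key : (gE m) ∘ₗ (LinearMap.mulLeft ℝ (X a)) = (gE m) ∘ₗ (pderiv a).toLinearMap := by
    apply (basisMonomials (Fin m) ℝ).ext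
    intro d
    simp only [coe_basisMonomials, LinearMap.comp_apply, LinearMap.mulLeft_apply,
      Derivation.coeFn_coe, pderiv_monomial, one_mul]
    rw [X, monomial_mul, mul_one, gE_monomial]
    have : (monomial (d - Finsupp.single a 1) (d a : ℝ)) =
      (d a : ℝ) • (monomial (d - Finsupp.single a 1) (1 : ℝ)) := by
      rw [smul_monomial]; simp
    rw [this, map_smul, gE_monomial, ← Finset.mul_prod_erase _ _ (Finset.mem_univ a),
      ← Finset.mul_prod_erase _ _ (Finset.mem_univ a), smul_eq_mul, ← mul_assoc]
    congr 1
    · simp [add_comm 1, gmom_succ]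
    · apply Finset.prod_congr rfl
      intro i hi
      have : i ≠ a := Finset.ne_of_mem_erase hi
      simp [this.symm]
  exact congrArg (fun L => L p) key

/-- Squared norm polynomial. -/
def nsq (m : ℕ) : MvPolynomial (Fin m) ℝ := ∑ a, X a * X a

/-- Linear form polynomial. -/
def lf {m : ℕ} (v : Fin m → ℝ) : MvPolynomial (Fin m) ℝ := ∑ a, C (v a) * X a

lemma nsq_hom (m : ℕ) : (nsq m).IsHomogeneous 2 := by
  apply IsHomogeneous.sum
  intro a _
  exact (isHomogeneous_X ℝ a).mul (isHomogeneous_X ℝ a)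

lemma lf_hom {m : ℕ} (v : Fin m → ℝ) : (lf v).IsHomogeneous 1 := by
  apply IsHomogeneous.sum
  intro a _
  exact isHomogeneous_C_mul_X _ _

lemma gE_nsq (m d : ℕ) (h : MvPolynomial (Fin m) ℝ) (hh : h.IsHomogeneous d) :
    gE m (nsq m * h) = (m + d : ℝ) * gE m h := by
  have e := hh.sum_X_mul_pderiv
  have : nsq m * h = ∑ a, X a * (X a * h) := by
    simp only [nsq, Finset.sum_mul, mul_assoc]
  rw [this, map_sum]
  have : ∀ a, gE m (X a * (X a * h)) = gE m (X a * pderiv a h) + gE m h := by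
    intro a
    rw [gE_stein, Derivation.leibniz, pderiv_X_self, smul_eq_mul, map_add, smul_eq_mul, mul_one]
  simp only [this]
  rw [Finset.sum_add_distrib, ← map_sum, e, map_nsmul, nsmul_eq_mul]
  simp
  ring

lemma gE_nsq_pow (m d k : ℕ) (hm : 0 < m) : ∃ c : ℝ, 0 < c ∧
    ∀ h : MvPolynomial (Fin m) ℝ, h.IsHomogeneous d → gE m (nsq m ^ k * h) = c * gE m h := by
  induction k with
  | zero => exact ⟨1, one_pos, by simp⟩
  | succ k ih =>
    obtain ⟨c, hc, H⟩ := ih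
    refine ⟨(m + (2 * k + d : ℕ)) * c, by positivity, fun h hh => ?_⟩
    rw [pow_succ', mul_assoc, gE_nsq m (2*k+d), H h hh, mul_assoc]
    exact ((nsq_hom m).pow k).mul hh

lemma eval_lf {m : ℕ} (v w : Fin m → ℝ) : eval w (lf v) = v ⬝ᵥ w := by
  simp [lf, dotProduct]

lemma eval_nsq {m : ℕ} (w : Fin m → ℝ) : eval w (nsq m) = w ⬝ᵥ w := by
  simp [nsq, dotProduct]

/-- Directional derivative. -/
def dd {m : ℕ} (v : Fin m → ℝ) (p : MvPolynomial (Fin m) ℝ) : MvPolynomial (Fin m) ℝ :=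
  ∑ a, C (v a) * pderiv a p

lemma gE_lf {m : ℕ} (v : Fin m → ℝ) (p : MvPolynomial (Fin m) ℝ) :
    gE m (lf v * p) = gE m (dd v p) := by
  simp only [lf, dd, Finset.sum_mul, map_sum, mul_assoc]
  simp only [← smul_eq_C_mul, map_smul, gE_stein]

lemma dd_mul {m : ℕ} (v : Fin m → ℝ) (p q : MvPolynomial (Fin m) ℝ) :
    dd v (p * q) = dd v p * q + p * dd v q := by
  simp only [dd, Derivation.leibniz, Finset.sum_mul, Finset.mul_sum, ← Finset.sum_add_distrib,
    smul_eq_mul]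
  exact Finset.sum_congr rfl fun a _ => by ring

lemma dd_C {m : ℕ} (v : Fin m → ℝ) (c : ℝ) : dd v (C c) = 0 := by
  simp [dd]

lemma dd_lf {m : ℕ} (v w : Fin m → ℝ) : dd v (lf w) = C (v ⬝ᵥ w) := by
  simp [dd, lf, dotProduct, pderiv_X, Pi.single_apply]

/-- Homogeneous polynomial vanishing on the unit sphere vanishes. -/
lemma hom_zero {m d : ℕ} (p : MvPolynomial (Fin m) ℝ) (hp : p.IsHomogeneous (d+1))
    (h : ∀ w : Fin m → ℝ, w ⬝ᵥ w = 1 → eval w p = 0) : p = 0 := by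
  have hs : ∀ (r : ℝ) (w : Fin m → ℝ), eval (r • w) p = r ^ (d+1) * eval w p := by
    intro r w
    rw [eval_eq, eval_eq, Finset.mul_sum]
    apply Finset.sum_congr rfl
    intro e he
    have h1 : ∑ i ∈ e.support, e i = d + 1 := by
      rw [← hp.degree_eq_sum_deg_support he]
    simp only [Pi.smul_apply, smul_eq_mul, mul_pow, Finset.prod_mul_distrib,
      Finset.prod_pow_eq_pow_sum, h1]
    ring
  apply MvPolynomial.funext
  intro w
  rw [map_zero]
  by_cases hw : w = 0
  · have := hs 0 w
    simpa [hw] using this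
  · have hpos : 0 < w ⬝ᵥ w := by
      have h1 : 0 ≤ w ⬝ᵥ w := Finset.sum_nonneg fun i _ => mul_self_nonneg _
      have h2 : w ⬝ᵥ w ≠ 0 := fun h => hw (dotProduct_self_eq_zero.1 h)
      exact lt_of_le_of_ne h1 h2.symm
    set r := Real.sqrt (w ⬝ᵥ w) with hr
    have hr0 : 0 < r := Real.sqrt_pos.2 hpos
    have hrr : r * r = w ⬝ᵥ w := Real.mul_self_sqrt hpos.le
    have e : w = r • (r⁻¹ • w) := by rw [smul_smul, mul_inv_cancel₀ hr0.ne', one_smul]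
    rw [e, hs, h, mul_zero]
    rw [smul_dotProduct, dotProduct_smul, ← hrr]
    simp only [smul_eq_mul]
    field_simp

section pm
variable {ι : Type} [DecidableEq ι]

/-- Products of pairings over a perfect matching of `s`. -/
inductive PM (m : ℕ) : Finset ι → ((ι → Fin m → ℝ) → ℝ) → Prop
  | nil : PM m ∅ (fun _ => 1)
  | pair (s : Finset ι) (F : (ι → Fin m → ℝ) → ℝ) (p q : ι) (hp : p ∉ s) (hq : q ∉ s)
      (hpq : p ≠ q) (h : PM m s F) :
      PM m (insert p (insert q s)) (fun z => (z p ⬝ᵥ z q) * F z)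

/-- Products of pairings and linear forms. -/
inductive PMW (m : ℕ) : Finset ι → ℕ → ((ι → Fin m → ℝ) → MvPolynomial (Fin m) ℝ) → Prop
  | nil : PMW m ∅ 0 (fun _ => 1)
  | pair (s : Finset ι) (k : ℕ) (F : (ι → Fin m → ℝ) → MvPolynomial (Fin m) ℝ) (p q : ι)
      (hp : p ∉ s) (hq : q ∉ s) (hpq : p ≠ q) (h : PMW m s k F) :
      PMW m (insert p (insert q s)) k (fun z => C (z p ⬝ᵥ z q) * F z)
  | single (s : Finset ι) (k : ℕ) (F : (ι → Fin m → ℝ) → MvPolynomial (Fin m) ℝ) (p : ι)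
      (hp : p ∉ s) (h : PMW m s k F) :
      PMW m (insert p s) (k+1) (fun z => lf (z p) * F z)

/-- Span of matchings. -/
def BS (m : ℕ) (s : Finset ι) : Submodule ℝ ((ι → Fin m → ℝ) → ℝ) :=
  Submodule.span ℝ {F | PM m s F}

/-- Span of products with fewer than `K` linear forms. -/
def WS (m : ℕ) (s : Finset ι) (K : ℕ) :
    Submodule ℝ ((ι → Fin m → ℝ) → MvPolynomial (Fin m) ℝ) :=
  Submodule.span ℝ {F | ∃ k, k < K ∧ PMW m s k F}

lemma PMW.hom {m : ℕ} {s : Finset ι} {k : ℕ} {F} (h : PMW m s k F) (z : ι → Fin m → ℝ) :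
    (F z).IsHomogeneous k := by
  induction h with
  | nil => exact isHomogeneous_one _ _
  | pair s k F p q hp hq hpq h ih => simpa using (isHomogeneous_C (Fin m) (z p ⬝ᵥ z q)).mul ih
  | single s k F p hp h ih => simpa [add_comm] using (lf_hom (z p)).mul ih

lemma PMW.parity {m : ℕ} {s : Finset ι} {k : ℕ} {F} (h : PMW m s k F) :
    ∃ j, s.card = k + 2 * j := by
  induction h with
  | nil => exact ⟨0, rfl⟩
  | pair s k F p q hp hq hpq h ih =>
    obtain ⟨j, hj⟩ := ih
    refine ⟨j+1, ?_⟩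
    rw [Finset.card_insert_of_notMem (by simp [hp, hpq]), Finset.card_insert_of_notMem hq, hj]
    ring
  | single s k F p hp h ih =>
    obtain ⟨j, hj⟩ := ih
    refine ⟨j, ?_⟩
    rw [Finset.card_insert_of_notMem hp, hj]
    ring

lemma PMW.inv {m : ℕ} {s : Finset ι} {k : ℕ} {F} (h : PMW m s k F)
    (g : Matrix (Fin m) (Fin m) ℝ) (hg : gᵀ * g = 1) (w : Fin m → ℝ) (z : ι → Fin m → ℝ) :
    eval (g *ᵥ w) (F (fun i => g *ᵥ z i)) = eval w (F z) := by
  have hd : ∀ x y : Fin m → ℝ, (g *ᵥ x) ⬝ᵥ (g *ᵥ y) = x ⬝ᵥ y := by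
    intro x y
    rw [dotProduct_mulVec, ← mulVec_transpose, mulVec_mulVec, hg, one_mulVec]
  induction h with
  | nil => simp
  | pair s k F p q hp hq hpq h ih => simp [ih, hd]
  | single s k F p hp h ih => simp [ih, hd, eval_lf]

lemma BS.pair {m : ℕ} {s : Finset ι} {F} (h : F ∈ BS m s) {p q : ι} (hp : p ∉ s) (hq : q ∉ s)
    (hpq : p ≠ q) : (fun z => (z p ⬝ᵥ z q) * F z) ∈ BS m (insert p (insert q s)) := by
  induction h using Submodule.span_induction with
  | mem F h => exact Submodule.subset_span (PM.pair s F p q hp hq hpq h)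
  | zero => simp only [Pi.zero_apply, mul_zero, map_zero]; exact Submodule.zero_mem (BS m (insert p (insert q s)))
  | add F G _ _ h1 h2 =>
    convert Submodule.add_mem _ h1 h2 using 1
    funext z; simp [mul_add]
  | smul c F _ h1 =>
    convert Submodule.smul_mem _ c h1 using 1
    funext z; simp; ring

lemma WS.pair {m : ℕ} {s : Finset ι} {K F} (h : F ∈ WS m s K) {p q : ι} (hp : p ∉ s) (hq : q ∉ s)
    (hpq : p ≠ q) : (fun z => C (z p ⬝ᵥ z q) * F z) ∈ WS m (insert p (insert q s)) K := by
  induction h using Submodule.span_induction with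
  | mem F h =>
    obtain ⟨k, hk, h⟩ := h
    exact Submodule.subset_span ⟨k, hk, PMW.pair s k F p q hp hq hpq h⟩
  | zero => simp only [Pi.zero_apply, mul_zero, map_zero]; exact Submodule.zero_mem (WS m (insert p (insert q s)) K)
  | add F G _ _ h1 h2 =>
    convert Submodule.add_mem _ h1 h2 using 1
    funext z; simp [mul_add]
  | smul c F _ h1 =>
    convert Submodule.smul_mem _ c h1 using 1
    funext z; simp

lemma WS.single {m : ℕ} {s : Finset ι} {K F} (h : F ∈ WS m s K) {p : ι} (hp : p ∉ s) :
    (fun z => lf (z p) * F z) ∈ WS m (insert p s) (K+1) := by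
  induction h using Submodule.span_induction with
  | mem F h =>
    obtain ⟨k, hk, h⟩ := h
    exact Submodule.subset_span ⟨k+1, by omega, PMW.single s k F p hp h⟩
  | zero => simp only [Pi.zero_apply, mul_zero, map_zero]; exact Submodule.zero_mem (WS m (insert p s) (K+1))
  | add F G _ _ h1 h2 =>
    convert Submodule.add_mem _ h1 h2 using 1
    funext z; simp [mul_add]
  | smul c F _ h1 =>
    convert Submodule.smul_mem _ c h1 using 1
    funext z; simp

lemma WS.mono {m : ℕ} {s : Finset ι} {K L} (h : K ≤ L) : WS m s K ≤ WS m s L :=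
  Submodule.span_mono fun _ ⟨k, hk, hF⟩ => ⟨k, by omega, hF⟩

lemma PMW.dd {m : ℕ} {s : Finset ι} {k : ℕ} {F} (h : PMW m s k F) {p : ι} (hp : p ∉ s) :
    (fun z => dd (z p) (F z)) ∈ WS m (insert p s) k := by
  induction h with
  | nil =>
    have : (fun z : ι → Fin m → ℝ => _root_.dd (z p) 1) = 0 := by
      funext z
      rw [← C_1, dd_C]; rfl
    rw [this]; exact Submodule.zero_mem _
  | pair s k F q r hq hr hqr h ih =>
    simp only [Finset.mem_insert, not_or] at hp
    have e : (fun z : ι → Fin m → ℝ => _root_.dd (z p) (C (z q ⬝ᵥ z r) * F z)) =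
        fun z => C (z q ⬝ᵥ z r) * _root_.dd (z p) (F z) := by
      funext z
      rw [dd_mul, dd_C, zero_mul, zero_add]
    rw [e]
    have := WS.pair (ih hp.2.2) (p := q) (q := r) (by simp [hq, Ne.symm hp.1])
      (by simp [hr, Ne.symm hp.2.1]) hqr
    convert this using 2
    ext; simp; tauto
  | single s k F q hq h ih =>
    simp only [Finset.mem_insert, not_or] at hp
    have e : (fun z : ι → Fin m → ℝ => _root_.dd (z p) (lf (z q) * F z)) =
        (fun z => C (z p ⬝ᵥ z q) * F z) + fun z => lf (z q) * _root_.dd (z p) (F z) := by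
      funext z
      rw [dd_mul, dd_lf]; rfl
    rw [e]
    apply Submodule.add_mem
    · exact Submodule.subset_span ⟨k, by omega, PMW.pair s k F p q hp.2 hq hp.1 h⟩
    · have := WS.single (ih hp.2) (p := q) (by simp [hq, Ne.symm hp.1])
      rwa [Finset.insert_comm] at this

lemma PMW.gE {m : ℕ} (k : ℕ) : ∀ {s : Finset ι} {F} (_ : PMW m s k F),
    (fun z => gE m (F z)) ∈ BS m s := by
  induction k using Nat.strong_induction_on with
  | _ k IH =>
  intro s F h
  induction h with
  | nil =>
    simp only [gE_one]
    exact Submodule.subset_span PM.nil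
  | pair s k F p q hp hq hpq h ih =>
    have := BS.pair (ih IH) hp hq hpq
    convert this using 2
    beta_reduce
    rw [← smul_eq_C_mul, map_smul, smul_eq_mul]
  | single s k F p hp h ih =>
    simp only [gE_lf]
    have h1 := h.dd hp
    have : ∀ G ∈ WS m (insert p s) k, (fun z => _root_.gE m (G z)) ∈ BS m (insert p s) := by
      intro G hG
      induction hG using Submodule.span_induction with
      | mem G h =>
        obtain ⟨j, hj, h⟩ := h
        exact IH j (by omega) h
      | zero => simp only [Pi.zero_apply, mul_zero, map_zero]; exact Submodule.zero_mem (BS m (insert p s))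
      | add F G _ _ h1 h2 =>
        convert Submodule.add_mem _ h1 h2 using 1
        funext z; simp
      | smul c F _ h1 =>
        convert Submodule.smul_mem _ c h1 using 1
        funext z; simp
    exact this _ h1

/-- Homogenization. -/
lemma WS.homog {m : ℕ} (hm : 0 < m) {s : Finset ι} {M : ℕ} (hs : s.card = 2 * M + 1) {K F}
    (h : F ∈ WS m s K) {p : ι} (hp : p ∉ s) :
    ∃ G : (ι → Fin m → ℝ) → MvPolynomial (Fin m) ℝ, (∀ z, (G z).IsHomogeneous (2 * M + 1)) ∧
      (∀ z w, w ⬝ᵥ w = 1 → eval w (G z) = eval w (F z)) ∧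
      (fun z => gE m (lf (z p) * G z)) ∈ BS m (insert p s) := by
  induction h using Submodule.span_induction with
  | mem F h =>
    obtain ⟨k, -, h⟩ := h
    obtain ⟨j, hj⟩ := h.parity
    refine ⟨fun z => nsq m ^ j * F z, fun z => ?_, fun z w hw => ?_, ?_⟩
    · have := ((nsq_hom m).pow j).mul (h.hom z)
      convert this using 1
      omega
    · simp [eval_nsq, hw]
    · obtain ⟨c, -, hc⟩ := gE_nsq_pow m (k+1) j hm
      have h2 := h.single s k F p hp
      have h3 := Submodule.smul_mem _ c (PMW.gE _ h2)
      convert h3 using 1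
      funext z
      simp only [Pi.smul_apply, smul_eq_mul]
      rw [← hc _ (h2.hom z)]
      congr 1
      ring
  | zero => exact ⟨fun z => 0, fun z => isHomogeneous_zero _ _ _, fun z w _ => rfl,
      by simp only [Pi.zero_apply, mul_zero, map_zero]; exact Submodule.zero_mem (BS m (insert p s))⟩
  | add F F' _ _ h1 h2 =>
    obtain ⟨G, a, b, c⟩ := h1
    obtain ⟨G', a', b', c'⟩ := h2
    refine ⟨fun z => G z + G' z, fun z => (a z).add (a' z), fun z w hw => ?_, ?_⟩
    · simp [b z w hw, b' z w hw]
    · convert Submodule.add_mem _ c c' using 1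
      funext z; simp [mul_add]
  | smul r F _ h1 =>
    obtain ⟨G, a, b, c⟩ := h1
    refine ⟨fun z => C r * G z, fun z => by simpa using (isHomogeneous_C (Fin m) r).mul (a z),
      fun z w hw => ?_, ?_⟩
    · simp [b z w hw]
    · convert Submodule.smul_mem _ r c using 1
      funext z
      have : lf (z p) * (C r * G z) = r • (lf (z p) * G z) := by rw [smul_eq_C_mul]; ring
      simp only [this, map_smul]; rfl

lemma WS.inv {m : ℕ} {s : Finset ι} {K : ℕ} {F} (h : F ∈ WS m s K)
    (g : Matrix (Fin m) (Fin m) ℝ) (hg : gᵀ * g = 1) (w : Fin m → ℝ) (z : ι → Fin m → ℝ) :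
    eval (g *ᵥ w) (F (fun i => g *ᵥ z i)) = eval w (F z) := by
  induction h using Submodule.span_induction with
  | mem F h =>
    obtain ⟨k, -, h⟩ := h
    exact h.inv g hg w z
  | zero => simp
  | add F F' _ _ h1 h2 => simp [h1, h2]
  | smul r F _ h1 => simp [h1]

/-- Restriction from dimension `n` to dimension `n+1` with distinguished vector. -/
lemma PM.lift {κ : Type} [DecidableEq κ] (j : κ ↪ ι) {n : ℕ} {s : Finset κ} {F}
    (h : PM n s F) : ∃ K, ∃ H ∈ WS (n+1) (s.map j) K, ∀ z : ι → Fin (n+1) → ℝ,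
      F (fun p => Fin.tail (z (j p))) = eval (Pi.single 0 1) (H z) := by
  induction h with
  | nil => exact ⟨1, fun _ => 1, Submodule.subset_span ⟨0, by omega, by simpa using PMW.nil⟩,
      by simp⟩
  | pair s F p q hp hq hpq h ih =>
    obtain ⟨K, H, hH, e⟩ := ih
    have hp' : j p ∉ s.map j := by simpa using hp
    have hq' : j q ∉ s.map j := by simpa using hq
    have hpq' : j p ≠ j q := by simpa using hpq
    refine ⟨K+2, (fun z => C (z (j p) ⬝ᵥ z (j q)) * H z) -
      (fun z => lf (z (j p)) * (lf (z (j q)) * H z)), ?_, ?_⟩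
    · rw [Finset.map_insert, Finset.map_insert]
      apply Submodule.sub_mem
      · exact WS.mono (by omega) (WS.pair hH hp' hq' hpq')
      · exact WS.single (WS.single hH hq') (by simp [hpq, hp])
    · intro z
      have : ∀ x y : Fin (n+1) → ℝ, Fin.tail x ⬝ᵥ Fin.tail y = x ⬝ᵥ y - x 0 * y 0 := by
        intro x y
        simp [dotProduct, Fin.sum_univ_succ, Fin.tail]
      simp [e, this, eval_lf]
      ring

lemma BS.lift {κ : Type} [DecidableEq κ] (j : κ ↪ ι) {n : ℕ} {s : Finset κ} {F}
    (h : F ∈ BS n s) : ∃ K, ∃ H ∈ WS (n+1) (s.map j) K, ∀ z : ι → Fin (n+1) → ℝ,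
      F (fun p => Fin.tail (z (j p))) = eval (Pi.single 0 1) (H z) := by
  induction h using Submodule.span_induction with
  | mem F h => exact PM.lift j h
  | zero => exact ⟨0, 0, Submodule.zero_mem _, by simp⟩
  | add F F' _ _ h1 h2 =>
    obtain ⟨K, H, h, e⟩ := h1
    obtain ⟨K', H', h', e'⟩ := h2
    exact ⟨max K K', H + H', Submodule.add_mem _ (WS.mono (le_max_left _ _) h)
      (WS.mono (le_max_right _ _) h'), fun z => by simp [e, e']⟩
  | smul r F _ h1 =>
    obtain ⟨K, H, h, e⟩ := h1
    exact ⟨K, r • H, Submodule.smul_mem _ _ h, fun z => by simp [e]⟩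

lemma WS.prod {m : ℕ} {s : Finset ι} {K F} (h : F ∈ WS m s K) (t : Finset ι)
    (ht : Disjoint t s) : ∃ K', (fun z => (∏ p ∈ t, lf (z p)) * F z) ∈ WS m (t ∪ s) K' := by
  induction t using Finset.induction_on with
  | empty => exact ⟨K, by simpa using h⟩
  | insert a t ha ih =>
    rw [Finset.disjoint_insert_left] at ht
    obtain ⟨K', h'⟩ := ih ht.2
    refine ⟨K'+1, ?_⟩
    have := WS.single h' (p := a) (by simp [ha, ht.1])
    rw [Finset.insert_union]
    convert this using 2
    rw [Finset.prod_insert ha, mul_assoc]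

end pm

/-- Block extension of an orthogonal matrix. -/
lemma ext_orth {n : ℕ} (g : Matrix (Fin n) (Fin n) ℝ) (hg : gᵀ * g = 1) :
    ∃ G : Matrix (Fin (n+1)) (Fin (n+1)) ℝ, Gᵀ * G = 1 ∧
      ∀ (a : ℝ) (y : Fin n → ℝ), G *ᵥ (Fin.cons a y : Fin (n+1) → ℝ) = Fin.cons a (g *ᵥ y) := by
  refine ⟨Matrix.of (Fin.cons (Fin.cons 1 0) (fun i => Fin.cons 0 (g i))), ?_, ?_⟩
  · ext i j
    have h := fun i j => congrFun (congrFun hg i) j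
    simp only [Matrix.mul_apply, Matrix.transpose_apply, Matrix.one_apply] at h
    refine Fin.cases ?_ (fun i => ?_) i <;> refine Fin.cases ?_ (fun j => ?_) j <;>
      simp [Matrix.mul_apply, Fin.sum_univ_succ, Matrix.one_apply, h, (Fin.succ_ne_zero _).symm]
  · intro a y
    funext i
    refine Fin.cases ?_ (fun i => ?_) i <;>
      simp [Matrix.mulVec, dotProduct, Fin.sum_univ_succ]

/-- Transitivity on the unit sphere. -/
lemma refl_orth {m : ℕ} (u w : Fin m → ℝ) (hu : u ⬝ᵥ u = 1) (hw : w ⬝ᵥ w = 1) :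
    ∃ g : Matrix (Fin m) (Fin m) ℝ, gᵀ * g = 1 ∧ g *ᵥ u = w ∧ g * gᵀ = 1 := by
  by_cases h : u = w
  · exact ⟨1, by simp, by simp [h], by simp⟩
  · set v := u - w with hv
    have hvv : v ⬝ᵥ v ≠ 0 := fun h0 => h (sub_eq_zero.1 (dotProduct_self_eq_zero.1 h0))
    have e1 : v ⬝ᵥ v = 2 * (v ⬝ᵥ u) := by
      simp only [hv, sub_dotProduct, dotProduct_sub, hu, hw, dotProduct_comm w u]; ring
    have key : (1 - (2 / (v ⬝ᵥ v)) • vecMulVec v v) * (1 - (2 / (v ⬝ᵥ v)) • vecMulVec v v) = 1 := by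
      have : vecMulVec v v * vecMulVec v v = (v ⬝ᵥ v) • vecMulVec v v := by
        rw [vecMulVec_mul_vecMulVec]
        ext i j; simp [vecMulVec_apply]; try ring
      simp only [sub_mul, mul_sub, one_mul, mul_one, smul_mul_assoc, mul_smul_comm, this]
      simp only [smul_sub, smul_smul]
      have : 2 / (v ⬝ᵥ v) * (2 / (v ⬝ᵥ v) * (v ⬝ᵥ v)) = 2 / (v ⬝ᵥ v) + 2 / (v ⬝ᵥ v) := by
        field_simp; norm_num
      rw [this, add_smul]
      abel
    have ht : (1 - (2 / (v ⬝ᵥ v)) • vecMulVec v v)ᵀ = 1 - (2 / (v ⬝ᵥ v)) • vecMulVec v v := by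
      simp [transpose_vecMulVec]
    refine ⟨1 - (2 / (v ⬝ᵥ v)) • vecMulVec v v, by rw [ht, key], ?_, by rw [ht, key]⟩
    have h2 : (2 / (v ⬝ᵥ v)) * (v ⬝ᵥ u) = 1 := by
      have : v ⬝ᵥ u ≠ 0 := by intro h0; rw [h0] at e1; simp at e1; exact hvv (by simpa using e1)
      rw [e1]; field_simp
    funext i
    have h3 : ((1 - (2 / (v ⬝ᵥ v)) • vecMulVec v v) *ᵥ u) i =
        u i - (2 / (v ⬝ᵥ v)) * (v ⬝ᵥ u) * v i := by
      rw [sub_mulVec, one_mulVec, smul_mulVec, vecMulVec_mulVec]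
      simp; ring
    rw [h3, h2]; simp [hv]

lemma odd_zero {ι : Type} [Fintype ι] {n : ℕ}
    (f : MultilinearMap ℝ (fun _ : ι => (Fin n → ℝ)) ℝ)
    (hf : ∀ g : Matrix (Fin n) (Fin n) ℝ, gᵀ * g = 1 →
      ∀ z : ι → (Fin n → ℝ), f (fun i => g.mulVec (z i)) = f z)
    (ho : Odd (Fintype.card ι)) : f = 0 := by
  refine MultilinearMap.ext fun z => ?_
  have h := hf (-1) (by simp) z
  have h2 := f.map_smul_univ (fun _ => (-1 : ℝ)) z
  simp only [Finset.prod_const, Finset.card_univ, ho.neg_one_pow, neg_smul, one_smul] at h2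
  simp only [neg_mulVec, one_mulVec] at h
  rw [h2] at h
  change f z = 0
  linarith

/-- Inclusion of the hyperplane. -/
def incl (n : ℕ) : (Fin n → ℝ) →ₗ[ℝ] (Fin (n+1) → ℝ) where
  toFun y := Fin.cons 0 y
  map_add' x y := by funext i; refine Fin.cases ?_ (fun i => ?_) i <;> simp
  map_smul' x y := by funext i; refine Fin.cases ?_ (fun i => ?_) i <;> simp

lemma incl_apply (n : ℕ) (y) : incl n y = Fin.cons 0 y := rfl

/-- The FFT statement in dimension `n`. -/
def FFT (n : ℕ) : Prop := ∀ (ι : Type) [Fintype ι] [DecidableEq ι]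
    (f : MultilinearMap ℝ (fun _ : ι => (Fin n → ℝ)) ℝ)
    (_ : ∀ g : Matrix (Fin n) (Fin n) ℝ, gᵀ * g = 1 →
      ∀ z : ι → (Fin n → ℝ), f (fun i => g.mulVec (z i)) = f z), ⇑f ∈ BS n (Finset.univ : Finset ι)

lemma empty_case {ι : Type} [Fintype ι] [DecidableEq ι] [IsEmpty ι] {n : ℕ}
    (f : MultilinearMap ℝ (fun _ : ι => (Fin n → ℝ)) ℝ) :
    ⇑f ∈ BS n (Finset.univ : Finset ι) := by
  have h : (fun _ : ι → Fin n → ℝ => (1:ℝ)) ∈ BS n (Finset.univ : Finset ι) := by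
    apply Submodule.subset_span
    rw [Finset.univ_eq_empty]
    exact PM.nil
  convert Submodule.smul_mem _ (f 0) h using 1
  funext z
  simp [Subsingleton.elim z 0]

lemma FFT_zero : FFT 0 := by
  intro ι _ _ f hf
  cases isEmpty_or_nonempty ι
  · exact empty_case f
  · have : ⇑f = 0 := by
      funext z
      obtain ⟨i⟩ := ‹Nonempty ι›
      exact f.map_coord_zero i (Subsingleton.elim _ _)
    rw [this]; exact Submodule.zero_mem _

lemma step1 {n : ℕ} (IH : FFT n) {ι : Type} [Fintype ι] [DecidableEq ι]
    (f : MultilinearMap ℝ (fun _ : ι => (Fin (n+1) → ℝ)) ℝ)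
    (hf : ∀ g : Matrix (Fin (n+1)) (Fin (n+1)) ℝ, gᵀ * g = 1 →
      ∀ z : ι → (Fin (n+1) → ℝ), f (fun i => g.mulVec (z i)) = f z) (i0 : ι) :
    ∃ K, ∃ H ∈ WS (n+1) (Finset.univ.erase i0) K, ∀ z,
      f (Function.update z i0 (Pi.single 0 1)) = eval (Pi.single 0 1) (H z) := by
  -- the term attached to a subset
  have hS : ∀ S : Finset ι, ∃ K, ∃ H ∈ WS (n+1) (Finset.univ.erase i0) K, ∀ z : ι → Fin (n+1) → ℝ,
      f (S.piecewise (fun p => (if p = i0 then (1:ℝ) else z p 0) • Pi.single 0 1)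
        (fun p => if p = i0 then 0 else Fin.cons 0 (Fin.tail (z p)))) =
        eval (Pi.single 0 1) (H z) := by
    intro S
    by_cases hi : i0 ∈ S
    · let fS : MultilinearMap ℝ (fun _ : {p // p ∉ S} => (Fin n → ℝ)) ℝ :=
        (f.domDomRestrict (fun p => p ∉ S) (fun _ => Pi.single 0 1)).compLinearMap
          (fun _ => incl n)
      have hfS : ∀ y, fS y = f (fun p => if h : p ∉ S then Fin.cons 0 (y ⟨p, h⟩)
          else Pi.single 0 1) := by
        intro y
        rfl
      have e0 : (Pi.single 0 1 : Fin (n+1) → ℝ) = Fin.cons 1 0 := by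
        funext i; refine Fin.cases ?_ (fun i => ?_) i <;> simp
      have h1 := IH _ fS (by
        intro g hg y
        obtain ⟨G, hG, hGc⟩ := ext_orth g hg
        rw [hfS, hfS]
        refine Eq.trans ?_ (hf G hG _)
        congr 1
        funext p
        by_cases h : p ∈ S
        · simp only [h, not_true_eq_false, dite_false]
          rw [e0, hGc]; simp
        · simp only [h, not_false_eq_true, dite_true]
          rw [hGc])
      obtain ⟨K, H, hH, e⟩ := BS.lift (Function.Embedding.subtype _) h1
      obtain ⟨K', hH'⟩ := WS.prod hH (S.erase i0) (by
        rw [Finset.disjoint_left]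
        intro a ha
        simp at ha ⊢
        exact ha.2)
      have es : S.erase i0 ∪ Finset.map (Function.Embedding.subtype (fun p => p ∉ S)) Finset.univ
          = Finset.univ.erase i0 := by
        ext a
        simp
        by_cases ha : a ∈ S
        · simp [ha]
        · simp [ha]; rintro rfl; exact ha hi
      rw [es] at hH'
      refine ⟨K', _, hH', fun z => ?_⟩
      have h2 : S.piecewise (fun p => (if p = i0 then (1:ℝ) else z p 0) • Pi.single 0 1)
        (fun p => if p = i0 then 0 else Fin.cons 0 (Fin.tail (z p))) =
        S.piecewise (fun p => (if p = i0 then (1:ℝ) else z p 0) •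
          (fun p => if h : p ∉ S then Fin.cons 0 (Fin.tail (z p))
            else (Pi.single 0 1 : Fin (n+1) → ℝ)) p)
         (fun p => if h : p ∉ S then Fin.cons 0 (Fin.tail (z p))
            else (Pi.single 0 1 : Fin (n+1) → ℝ)) := by
        funext p
        by_cases hp : p ∈ S
        · simp [hp]
        · have : p ≠ i0 := by rintro rfl; exact hp hi
          simp [hp, this]
      rw [h2, f.map_piecewise_smul]
      have h3 := e z
      rw [hfS] at h3
      simp only [Function.Embedding.subtype_apply] at h3
      rw [h3, map_mul, map_prod, smul_eq_mul, ← Finset.mul_prod_erase _ _ hi]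
      congr 1
      simp only [if_true, one_mul, eval_lf]
      apply Finset.prod_congr rfl
      intro p hp
      simp [Finset.ne_of_mem_erase hp]
    · refine ⟨0, 0, Submodule.zero_mem _, fun z => ?_⟩
      rw [f.map_coord_zero i0 (by simp [hi])]
      simp
  choose K H hH e using hS
  refine ⟨Finset.univ.sup K, ∑ S, H S, Submodule.sum_mem _ fun S _ =>
    WS.mono (Finset.le_sup (Finset.mem_univ S)) (hH S), fun z => ?_⟩
  have h2 : Function.update z i0 (Pi.single 0 1) =
    (fun p => (if p = i0 then (1:ℝ) else z p 0) • (Pi.single 0 1 : Fin (n+1) → ℝ)) +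
        (fun p => if p = i0 then 0 else Fin.cons 0 (Fin.tail (z p))) := by
    funext p
    by_cases hp : p = i0
    · subst hp; simp
    · funext a
      refine Fin.cases ?_ (fun a => ?_) a <;> simp [hp, Fin.tail]
  rw [h2, f.map_add_univ]
  simp only [e, Finset.sum_apply, map_sum]

lemma FFT_succ {n : ℕ} (IH : FFT n) : FFT (n+1) := by
  intro ι _ _ f hf
  rcases Nat.even_or_odd (Fintype.card ι) with he | ho
  swap
  · rw [odd_zero f hf ho]; exact Submodule.zero_mem _
  cases isEmpty_or_nonempty ι
  · exact empty_case f
  obtain ⟨i0⟩ := ‹Nonempty ι›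
  obtain ⟨K, H, hH, e⟩ := step1 IH f hf i0
  have hcard : ∃ M, (Finset.univ.erase i0).card = 2 * M + 1 := by
    rw [Finset.card_erase_of_mem (Finset.mem_univ _), Finset.card_univ]
    obtain ⟨r, hr⟩ := he
    have : 0 < Fintype.card ι := Fintype.card_pos_iff.2 ⟨i0⟩
    exact ⟨r - 1, by omega⟩
  obtain ⟨M, hM⟩ := hcard
  obtain ⟨G, hGhom, hGe, hGB⟩ := WS.homog (Nat.succ_pos n) hM hH (p := i0) (by simp)
  rw [Finset.insert_erase (Finset.mem_univ _)] at hGB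
  have e2 : ∀ w : Fin (n+1) → ℝ, w ⬝ᵥ w = 1 → ∀ z,
      f (Function.update z i0 w) = eval w (H z) := by
    intro w hw z
    obtain ⟨g, hg, hgw, hg'⟩ := refl_orth (Pi.single 0 1) w (by simp) hw
    have hz : z = fun i => g *ᵥ (gᵀ *ᵥ z i) := by
      funext i; rw [mulVec_mulVec, hg', one_mulVec]
    have h1 := e (fun i => gᵀ *ᵥ z i)
    rw [← hf g hg, ← WS.inv hH g hg, hgw, ← hz] at h1
    rw [← h1]
    congr 1
    funext p
    by_cases hp : p = i0
    · subst hp; simp [← hgw]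
    · simp only [Function.update_of_ne hp]
      exact congrFun hz p
  -- the linear form
  let φ : (ι → Fin (n+1) → ℝ) → (Fin (n+1) → ℝ) :=
    fun z a => f (Function.update z i0 (Pi.single a 1))
  have hφ : ∀ z w, f (Function.update z i0 w) = φ z ⬝ᵥ w := by
    intro z w
    have hw : w = ∑ a, w a • (Pi.single a 1 : Fin (n+1) → ℝ) := by
      simpa using pi_eq_sum_univ' w
    have := congrArg (f.toLinearMap z i0) hw
    rw [map_sum] at this
    simp only [map_smul, MultilinearMap.toLinearMap_apply, smul_eq_mul] at this
    rw [this]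
    exact Finset.sum_congr rfl fun a _ => mul_comm _ _
  have hpoly : ∀ z, nsq (n+1) ^ M * lf (φ z) = G z := by
    intro z
    rw [← sub_eq_zero]
    apply hom_zero (d := 2 * M)
    · exact (((nsq_hom (n+1)).pow M).mul (lf_hom _)).sub (hGhom z)
    · intro w hw
      rw [map_sub, hGe z w hw, ← e2 w hw, hφ]
      simp [eval_nsq, eval_lf, hw]
  obtain ⟨c, hc, hcE⟩ := gE_nsq_pow (n+1) 2 M (Nat.succ_pos n)
  have hfin : ∀ z, gE (n+1) (lf (z i0) * G z) = c * f z := by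
    intro z
    have : lf (z i0) * G z = nsq (n+1) ^ M * (lf (z i0) * lf (φ z)) := by
      rw [← hpoly]; ring
    rw [this, hcE _ ((lf_hom _).mul (lf_hom _)), gE_lf, dd_lf, ← mul_one (C _), ← smul_eq_C_mul,
      map_smul, gE_one, smul_eq_mul, mul_one, dotProduct_comm, ← hφ, Function.update_eq_self]
  simp only [hfin] at hGB
  have := Submodule.smul_mem _ c⁻¹ hGB
  convert this using 1
  funext z
  simp [hc.ne']

lemma FFT_all (n : ℕ) : FFT n := by
  induction n with
  | zero => exact FFT_zero
  | succ n ih => exact FFT_succ ih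

lemma PM.brauer {N m : ℕ} {s : Finset (Fin N)} {F} (h : PM m s F) :
    ∃ σ : Fin N → Fin N, (∀ p, σ (σ p) = p) ∧ (∀ p, σ p ≠ p ↔ p ∈ s) ∧
      F = fun z => ∏ p ∈ Finset.univ.filter (fun p => p < σ p), (z p ⬝ᵥ z (σ p)) := by
  induction h with
  | nil => exact ⟨id, by simp, by simp, by simp⟩
  | pair s F p q hp hq hpq h ih =>
    obtain ⟨σ, h1, h2, h3⟩ := ih
    have fp : σ p = p := by by_contra h; exact hp ((h2 p).1 h)
    have fq : σ q = q := by by_contra h; exact hq ((h2 q).1 h)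
    have np : ∀ x, σ x = p → x = p := fun x hx => by rw [← h1 x, hx, fp]
    have nq : ∀ x, σ x = q → x = q := fun x hx => by rw [← h1 x, hx, fq]
    refine ⟨fun x => if x = p then q else if x = q then p else σ x, ?_, ?_, ?_⟩
    · intro x; grind
    · intro x; grind
    · have aux : ∀ p q : Fin N, p < q → σ p = p → σ q = q →
          (∀ x, σ x = p → x = p) → (∀ x, σ x = q → x = q) → ∀ z : Fin N → Fin m → ℝ,
          z p ⬝ᵥ z q * ∏ p ∈ Finset.univ.filter (fun p => p < σ p), (z p ⬝ᵥ z (σ p)) =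
          ∏ x ∈ Finset.univ.filter (fun x => x < if x = p then q else if x = q then p else σ x),
            (z x ⬝ᵥ z (if x = p then q else if x = q then p else σ x)) := by
        intro p q hlt fp fq np nq z
        have : Finset.univ.filter (fun x => x < if x = p then q else if x = q then p else σ x) =
          insert p (Finset.univ.filter (fun p => p < σ p)) := by
          ext x
          simp only [Finset.mem_filter, Finset.mem_univ, true_and, Finset.mem_insert]
          by_cases hx : x = p
          · simp [hx, hlt]
          · by_cases hx' : x = q
            · subst hx'; simp [hx, fq, hlt.le]
            · simp [hx, hx']
        rw [this, Finset.prod_insert (by simp [fp])]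
        congr 1
        · simp
        · apply Finset.prod_congr rfl
          intro x hx
          simp only [Finset.mem_filter, Finset.mem_univ, true_and] at hx
          have n1 : x ≠ p := by rintro rfl; rw [fp] at hx; exact lt_irrefl _ hx
          have n2 : x ≠ q := by rintro rfl; rw [fq] at hx; exact lt_irrefl _ hx
          simp [n1, n2]
      funext z
      rw [h3]
      rcases lt_or_gt_of_ne hpq with hlt | hlt
      · exact aux p q hlt fp fq np nq z
      · have := aux q p hlt fq fp nq np z
        have hc : (fun x => if x = p then q else if x = q then p else σ x) =
          (fun x => if x = q then p else if x = p then q else σ x) := by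
          funext x; grind
        have hc' := fun x => congrFun hc x
        simp only [hc']
        rw [dotProduct_comm]
        exact this

/-- **First Fundamental Theorem for `O(n)`** (multilinear form).  Every
`O(n)`-invariant multilinear map `f : (ℝⁿ)^N → ℝ` lies in the span of the maps
`(z₁,…,z_N) ↦ ∏_{{p,q} ∈ β} ⟨z_p, z_q⟩` where `β` ranges over partitions of
`{1,…,N}` into disjoint pairs.  In particular, if `N` is odd then `f = 0`. -/
theorem stmt13 (n N : ℕ) (hn : 1 ≤ n)
    (f : MultilinearMap ℝ (fun _ : Fin N => (Fin n → ℝ)) ℝ)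
    (hf : ∀ g : Matrix (Fin n) (Fin n) ℝ, gᵀ * g = 1 →
      ∀ z : Fin N → (Fin n → ℝ), f (fun i => g.mulVec (z i)) = f z) :
    (⇑f ∈ Submodule.span ℝ
      {F : (Fin N → (Fin n → ℝ)) → ℝ | ∃ β : BrauerPairing N,
        F = fun z => ∏ p ∈ Finset.univ.filter (fun p => p < β.pair p),
          ∑ a, z p a * z (β.pair p) a}) ∧
    (Odd N → f = 0) := by
  refine ⟨?_, fun ho => odd_zero f hf (by simpa using ho)⟩
  have h := FFT_all n (Fin N) f hf
  refine Submodule.span_mono ?_ h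
  intro F hF
  obtain ⟨σ, h1, h2, h3⟩ := PM.brauer hF
  exact ⟨⟨σ, h1, fun p => (h2 p).2 (Finset.mem_univ p)⟩, h3⟩
end
end

section
/- Let n = 2m ≥ 2 and N ≥ 0 be integers, and let f : (ℝⁿ)^N → ℝ be a multilinear map that is Sp(n)-invariant, i.e. f(gz₁,…,gz_N) = f(z₁,…,z_N) for all g ∈ Sp(n) and all z₁,…,z_N ∈ ℝⁿ. Then f lies in the linear span of the multilinear maps (z₁,…,z_N) ↦ ∏_{{p,q}∈β, p<q} ω(z_p, z_q), where β ranges over all partitions of {1,…,N} into disjoint pairs and ω(x,y) = xᵀΩy is the standard skew-symmetric form. In particular, if N is odd then f = 0. -/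
open Matrix

noncomputable section

/-- The matrix `Ω` of the standard skew-symmetric form: block diagonal with `m`
blocks `[[0, 1], [-1, 0]]`. -/
def OmegaM (n : ℕ) : Matrix (Fin n) (Fin n) ℝ :=
  Matrix.of fun i j =>
    if (i : ℕ) % 2 = 0 ∧ (j : ℕ) = (i : ℕ) + 1 then 1
    else if (j : ℕ) % 2 = 0 ∧ (i : ℕ) = (j : ℕ) + 1 then -1 else 0

namespace SpFFT

open Finset Function

variable {n : ℕ}

/-- the bilinear form of a matrix -/
def w (K : Matrix (Fin n) (Fin n) ℝ) (x y : Fin n → ℝ) : ℝ := ∑ a, ∑ b, x a * K a b * y b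

lemma w_eq (K : Matrix (Fin n) (Fin n) ℝ) (x y : Fin n → ℝ) : w K x y = x ⬝ᵥ (K *ᵥ y) := by
  simp [w, dotProduct, mulVec, Finset.mul_sum, mul_assoc]

lemma w_skew (K : Matrix (Fin n) (Fin n) ℝ) (hK : Kᵀ = -K) (x y : Fin n → ℝ) :
    w K x y = - w K y x := by
  rw [w_eq, w_eq, dotProduct_mulVec, ← mulVec_transpose, hK, dotProduct_comm, neg_mulVec,
    dotProduct_neg]

/-- spanning set: oriented perfect matchings -/
def gens (K : Matrix (Fin n) (Fin n) ℝ) (ι : Type) : Set ((ι → Fin n → ℝ) → ℝ) :=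
  {F | ∃ (β : ι → ι) (s : Finset ι), (∀ p, β (β p) = p) ∧ (∀ p, p ∈ s ↔ β p ∉ s) ∧
    F = fun z => ∏ p ∈ s, w K (z p) (z (β p))}

/-- invariance -/
def Inv (K : Matrix (Fin n) (Fin n) ℝ) {ι : Type}
    (f : MultilinearMap ℝ (fun _ : ι => (Fin n → ℝ)) ℝ) : Prop :=
  ∀ g : Matrix (Fin n) (Fin n) ℝ, gᵀ * K * g = K →
      ∀ z : ι → (Fin n → ℝ), f (fun i => g.mulVec (z i)) = f z

section
variable (K : Matrix (Fin n) (Fin n) ℝ) {ι : Type} [Fintype ι] [DecidableEq ι]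
  (f : MultilinearMap ℝ (fun _ : ι => (Fin n → ℝ)) ℝ)

lemma linear_coeff (z h : ι → Fin n → ℝ) (H : ∀ t : ℝ, f (z + t • h) = f z) :
    ∑ i, f (update z i (h i)) = 0 := by
  set c : Finset ι → ℝ := fun s => f (s.piecewise h z)
  set L := ∑ i, f (update z i (h i)) with hL
  have key : ∀ t : ℝ, t * L + ∑ s : Finset ι with 2 ≤ #s, c s * t ^ #s = 0 := by
    intro t
    have := H t
    rw [f.map_add_eq_map_add_linearDeriv_add, MultilinearMap.linearDeriv_apply] at this
    have h1 : ∑ i, f (update z i ((t • h) i)) = t * L := by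
      simp [hL, Finset.mul_sum]
    have h2 : ∀ s : Finset ι, f (s.piecewise (t • h) z) = c s * t ^ #s := by
      intro s
      have : s.piecewise (t • h) z = s.piecewise (fun i => t • (s.piecewise h z) i) (s.piecewise h z) := by
        ext i a
        by_cases hi : i ∈ s <;> simp [hi]
      rw [this, f.map_piecewise_smul (fun _ => t)]
      simp [c, mul_comm]
    simp only [h1, h2] at this
    linarith
  let p : Polynomial ℝ := Polynomial.C L * Polynomial.X ^ 1 +
    ∑ s : Finset ι with 2 ≤ #s, Polynomial.C (c s) * Polynomial.X ^ #s
  have hp : p = 0 := by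
    apply Polynomial.funext
    intro t
    simp only [p, Polynomial.eval_add, Polynomial.eval_finsetSum, Polynomial.eval_mul,
      Polynomial.eval_C, Polynomial.eval_pow, Polynomial.eval_X, Polynomial.eval_zero]
    rw [← key t]; ring
  have h3 := congrArg (fun q => Polynomial.coeff q 1) hp
  simp only [p, Polynomial.coeff_add, Polynomial.finsetSum_coeff, Polynomial.coeff_C_mul_X_pow,
    Polynomial.coeff_zero] at h3
  rw [Finset.sum_eq_zero] at h3
  · simpa using h3
  · intro s hs
    have := (Finset.mem_filter.1 hs).2
    rw [if_neg (by omega)]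

lemma w_add_left (x y u : Fin n → ℝ) : w K (x + y) u = w K x u + w K y u := by
  simp [w_eq, add_dotProduct]

lemma trans_symp (hK : Kᵀ = -K) (v : Fin n → ℝ) (t : ℝ) :
    (1 + t • vecMulVec v (v ᵥ* K))ᵀ * K * (1 + t • vecMulVec v (v ᵥ* K)) = K := by
  have h0 : v ᵥ* K ⬝ᵥ v = 0 := by
    have := w_skew K hK v v
    rw [w_eq, dotProduct_mulVec] at this
    linarith
  have h1 : K *ᵥ v = - (v ᵥ* K) := by
    rw [← mulVec_transpose, hK, neg_mulVec, neg_neg]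
  simp only [transpose_add, transpose_one, transpose_smul, transpose_vecMulVec, add_mul, mul_add,
    one_mul, mul_one, smul_mul_assoc, mul_smul_comm, mul_vecMulVec, vecMulVec_mul, h1,
    vecMulVec_mulVec, neg_vecMulVec]
  simp [h0]

lemma deriv_inv (hK : Kᵀ = -K) (hf : Inv K f) (v : Fin n → ℝ) (z : ι → Fin n → ℝ) :
    ∑ i, w K v (z i) * f (update z i v) = 0 := by
  have := linear_coeff f z (fun i => w K v (z i) • v) (by
    intro t
    rw [← hf _ (trans_symp K hK v t) z]
    congr 1
    ext1 i
    simp [add_mulVec, smul_mulVec, vecMulVec_mulVec, w_eq, dotProduct_mulVec])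
  simpa using this

lemma deriv_inv2 (hK : Kᵀ = -K) (hf : Inv K f) (u v : Fin n → ℝ) (z : ι → Fin n → ℝ) :
    ∑ i, (w K u (z i) * f (update z i v) + w K v (z i) * f (update z i u)) = 0 := by
  have h1 := deriv_inv K f hK hf u z
  have h2 := deriv_inv K f hK hf v z
  have h3 := deriv_inv K f hK hf (u + v) z
  simp only [w_add_left, f.map_update_add, add_mul, mul_add, Finset.sum_add_distrib] at *
  linarith

/-- contraction, evaluated -/
def contr (i j : ι) (z : ι → Fin n → ℝ) : ℝ :=
  ∑ a, ∑ b, K a b * f (update (update z j (Pi.single b 1)) i (Pi.single a 1))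

lemma sum_update (c : Fin n → ℝ) (i : ι) (z : ι → Fin n → ℝ) :
    ∑ a, c a * f (update z i (Pi.single a 1)) = f (update z i c) := by
  have : c = ∑ a, c a • (Pi.single a 1 : Fin n → ℝ) := by
    ext k; simp [Finset.sum_apply, Pi.single_apply]
  conv_rhs => rw [this]
  rw [f.map_update_sum]
  simp

lemma w_single (a : Fin n) (y : Fin n → ℝ) : w K (Pi.single a 1) y = (K *ᵥ y) a := by
  simp [w_eq]

lemma main_identity (hK : Kᵀ = -K) (hK2 : K * K = -1) (hf : Inv K f) (j : ι)
    (z : ι → Fin n → ℝ) :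
    ((n : ℝ) + 1) * f z + ∑ i ∈ univ.erase j,
      (w K (z j) (z i) * contr K f i j z + f (fun k => z (Equiv.swap i j k))) = 0 := by
  have hKK : Kᵀ * K = 1 := by rw [hK, neg_mul, hK2, neg_neg]
  have hKK' : K * Kᵀ = 1 := by rw [hK, mul_neg, hK2, neg_neg]
  have H : ∀ a b, K a b * ∑ i, (w K (z j) (update z j (Pi.single b 1) i) *
      f (update (update z j (Pi.single b 1)) i (Pi.single a 1))
      + w K (Pi.single a 1) (update z j (Pi.single b 1) i) *
        f (update (update z j (Pi.single b 1)) i (z j))) = 0 := by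
    intro a b
    rw [deriv_inv2 K f hK hf, mul_zero]
  have H2 : ∑ a, ∑ b, (K a b * ∑ i, (w K (z j) (update z j (Pi.single b 1) i) *
      f (update (update z j (Pi.single b 1)) i (Pi.single a 1))
      + w K (Pi.single a 1) (update z j (Pi.single b 1) i) *
        f (update (update z j (Pi.single b 1)) i (z j)))) = 0 := by
    simp [H]
  simp only [Finset.mul_sum] at H2
  have H3 : ∀ F : Fin n → Fin n → ι → ℝ, ∑ a, ∑ b, ∑ i, F a b i = ∑ i, ∑ a, ∑ b, F a b i := by
    intro F
    refine Eq.trans ?_ Finset.sum_comm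
    exact Finset.sum_congr rfl fun a _ => Finset.sum_comm
  rw [H3, ← Finset.add_sum_erase _ _ (mem_univ j)] at H2
  rw [← H2]
  congr 1
  · simp only [update_self, update_idem, update_eq_self, mul_add, Finset.sum_add_distrib]
    have e1 : ∑ a, ∑ b, K a b * (w K (z j) (Pi.single b 1) * f (update z j (Pi.single a 1)))
        = f z := by
      have : ∀ a, ∑ b, K a b * (w K (z j) (Pi.single b 1) * f (update z j (Pi.single a 1)))
          = (K *ᵥ (Kᵀ *ᵥ z j)) a * f (update z j (Pi.single a 1)) := by
        intro a
        rw [mulVec, dotProduct, Finset.sum_mul]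
        refine Finset.sum_congr rfl fun b _ => ?_
        have : w K (z j) (Pi.single b 1) = (Kᵀ *ᵥ z j) b := by
          rw [w_eq, dotProduct_mulVec, mulVec_transpose]; simp
        rw [this]; ring
      simp only [this, sum_update, mulVec_mulVec, hKK', one_mulVec, update_eq_self]
    have e2 : ∑ a, ∑ b, K a b * (w K (Pi.single a 1) (Pi.single b 1) * f z) = n * f z := by
      have : (Kᵀ * K).trace = n := by rw [hKK]; simp
      rw [← this, Matrix.trace]
      simp only [Matrix.diag_apply, Matrix.mul_apply, transpose_apply, Finset.sum_mul, w_single, mulVec_single_one,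
        col_apply]
      rw [Finset.sum_comm]
      simp only [mul_assoc]
    rw [e1, e2]; ring
  · refine Finset.sum_congr rfl fun i hi => ?_
    have hij : i ≠ j := Finset.ne_of_mem_erase hi
    simp only [update_of_ne hij, mul_add, Finset.sum_add_distrib]
    congr 1
    · simp only [contr, Finset.mul_sum]
      refine Finset.sum_congr rfl fun a _ => Finset.sum_congr rfl fun b _ => by ring
    · rw [Finset.sum_comm]
      have : ∀ b, ∑ a, K a b * (w K (Pi.single a 1) (z i) *
          f (update (update z j (Pi.single b 1)) i (z j)))
          = (Kᵀ *ᵥ (K *ᵥ z i)) b * f (update (update z i (z j)) j (Pi.single b 1)) := by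
        intro b
        rw [mulVec, dotProduct, Finset.sum_mul]
        refine Finset.sum_congr rfl fun a _ => ?_
        rw [w_single, transpose_apply, update_comm hij]; ring
      simp only [this, sum_update, mulVec_mulVec, hKK, one_mulVec]
      congr 1
      ext1 k
      by_cases h1 : k = j
      · subst h1; simp
      · by_cases h2 : k = i
        · subst h2; simp [h1]
        · simp [h1, h2, Equiv.swap_apply_of_ne_of_ne]


/-! ### positivity -/

lemma sum_update_swap (i : ι) (G : (ι → Fin n) → Fin n → ℝ) :
    ∑ a, ∑ x : ι → Fin n, G (update x i a) (x i) = ∑ y, ∑ b, G y b := by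
  rw [Finset.sum_comm, ← Fintype.sum_prod_type', ← Fintype.sum_prod_type']
  let e : ((ι → Fin n) × Fin n) → ((ι → Fin n) × Fin n) := fun p => (update p.1 i p.2, p.1 i)
  have he : Function.Involutive e := by
    rintro ⟨x, a⟩
    simp [e]
  exact Equiv.sum_comp he.toPerm (fun p : (ι → Fin n) × Fin n => G p.1 p.2)

lemma term_diag (F : (ι → Fin n) → ℝ) (i : ι) :
    ∑ a, ∑ x : ι → Fin n, F (update x i a) * F (update x i a) = n * ∑ x, F x * F x := by
  rw [sum_update_swap i (fun y _ => F y * F y)]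
  simp [Finset.mul_sum]

lemma term_off (F : (ι → Fin n) → ℝ) (i j : ι) (hij : i ≠ j) :
    ∑ a, ∑ x : ι → Fin n, (if x i = x j then F (update x i a) * F (update x j a) else 0)
      = ∑ x, F x * F (fun k => x (Equiv.swap i j k)) := by
  have := sum_update_swap i (fun (y : ι → Fin n) b =>
    if b = y j then F y * F (update (update y i b) j (y i)) else 0)
  simp only [update_idem, update_self, update_eq_self, update_of_ne hij.symm] at this
  rw [this]
  refine Finset.sum_congr rfl fun y _ => ?_
  simp only [Finset.sum_ite_eq', mem_univ, if_true]
  congr 2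
  ext1 k
  by_cases h1 : k = j
  · subst h1; simp
  · by_cases h2 : k = i
    · subst h2; simp [h1]
    · simp [h1, h2, Equiv.swap_apply_of_ne_of_ne]

lemma pos (F : (ι → Fin n) → ℝ) :
    0 ≤ ∑ j, (n * ∑ x, F x * F x + ∑ i ∈ univ.erase j,
      ∑ x, F x * F (fun k => x (Equiv.swap i j k))) := by
  have h0 : 0 ≤ ∑ a, ∑ x : ι → Fin n, ∑ b,
      (∑ i, if x i = b then F (update x i a) else 0) ^ 2 := by positivity
  have h1 : ∀ (a : Fin n) (x : ι → Fin n),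
      ∑ b, (∑ i, if x i = b then F (update x i a) else 0) ^ 2 =
      ∑ j, ∑ i, if x i = x j then F (update x i a) * F (update x j a) else 0 := by
    intro a x
    simp only [sq, Finset.sum_mul_sum]
    rw [Finset.sum_comm]
    conv_rhs => rw [Finset.sum_comm]
    refine Finset.sum_congr rfl fun i _ => ?_
    rw [Finset.sum_comm]
    refine Finset.sum_congr rfl fun j _ => ?_
    simp only [ite_mul, zero_mul, Finset.sum_ite_eq, mem_univ, if_true]
    by_cases h : x i = x j
    · simp [h]
    · simp [h, Ne.symm h]
  simp only [h1] at h0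
  have h2 : ∑ a : Fin n, ∑ x : ι → Fin n, ∑ j : ι, ∑ i : ι,
      (if x i = x j then F (update x i a) * F (update x j a) else 0) =
      ∑ j : ι, ∑ i : ι, ∑ a : Fin n, ∑ x : ι → Fin n,
      (if x i = x j then F (update x i a) * F (update x j a) else 0) := by
    simp only [← Fintype.sum_prod_type' (f := fun (a : Fin n) (x : ι → Fin n) => _)]
    rw [Finset.sum_comm]
    exact Finset.sum_congr rfl fun j _ => Finset.sum_comm
  rw [h2] at h0
  convert! h0 using 2 with j
  rw [← Finset.add_sum_erase _ _ (mem_univ j)]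
  congr 1
  · simp [term_diag]
  · exact Finset.sum_congr rfl fun i hi => (term_off F i j (Finset.ne_of_mem_erase hi)).symm

/-- the operator -/
def A (n : ℕ) (ι : Type) [Fintype ι] [DecidableEq ι] :
    MultilinearMap ℝ (fun _ : ι => (Fin n → ℝ)) ℝ →ₗ[ℝ]
    MultilinearMap ℝ (fun _ : ι => (Fin n → ℝ)) ℝ :=
  ∑ j, (((n : ℝ) + 1) • LinearMap.id + ∑ i ∈ univ.erase j,
    (MultilinearMap.domDomCongrLinearEquiv ℝ ℝ (Fin n → ℝ) ℝ (Equiv.swap i j)).toLinearMap)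

lemma A_apply (z : ι → Fin n → ℝ) : A n ι f z = ∑ j, (((n : ℝ) + 1) * f z + ∑ i ∈ univ.erase j,
    f (fun k => z (Equiv.swap i j k))) := by
  simp only [A, LinearMap.sum_apply, LinearMap.add_apply, LinearMap.smul_apply, LinearMap.id_apply,
    _root_.sum_apply, _root_.add_apply, _root_.smul_apply, smul_eq_mul]
  rfl

lemma A_inj [Nonempty ι] (h : A n ι f = 0) : f = 0 := by
  let F : (ι → Fin n) → ℝ := fun x => f (fun i => Pi.single (x i) 1)
  have hA : ∀ x, ∑ j, (((n : ℝ) + 1) * F x + ∑ i ∈ univ.erase j,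
      F (fun k => x (Equiv.swap i j k))) = 0 := by
    intro x
    have := A_apply f (fun i => Pi.single (x i) 1)
    rw [h] at this
    exact this.symm
  have h1 : ∑ x, F x * (∑ j, (((n : ℝ) + 1) * F x + ∑ i ∈ univ.erase j,
      F (fun k => x (Equiv.swap i j k)))) = 0 :=
    Finset.sum_eq_zero fun x _ => by rw [hA, mul_zero]
  have h2 : ∑ x, F x * (∑ j, (((n : ℝ) + 1) * F x + ∑ i ∈ univ.erase j,
      F (fun k => x (Equiv.swap i j k)))) = (Fintype.card ι : ℝ) * ∑ x, F x * F x +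
      ∑ j, (n * ∑ x, F x * F x + ∑ i ∈ univ.erase j,
      ∑ x, F x * F (fun k => x (Equiv.swap i j k))) := by
    have e0 : (Fintype.card ι : ℝ) * ∑ x, F x * F x = ∑ j : ι, ∑ x, F x * F x := by simp
    rw [e0, ← Finset.sum_add_distrib]
    simp only [Finset.mul_sum]
    rw [Finset.sum_comm]
    refine Finset.sum_congr rfl fun j _ => ?_
    rw [Finset.sum_comm (s := univ.erase j), ← Finset.sum_add_distrib, ← Finset.sum_add_distrib]
    refine Finset.sum_congr rfl fun x _ => ?_
    rw [mul_add, Finset.mul_sum]; ring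
  have h3 := pos F
  have h4 : ∑ x, F x * F x = 0 := by
    have hc : (0 : ℝ) < Fintype.card ι := by exact_mod_cast Fintype.card_pos
    have h5 : 0 ≤ ∑ x, F x * F x := Finset.sum_nonneg fun x _ => mul_self_nonneg _
    by_contra hne
    have := mul_pos hc (lt_of_le_of_ne h5 (Ne.symm hne))
    linarith
  rw [Finset.sum_eq_zero_iff_of_nonneg (fun x _ => mul_self_nonneg _)] at h4
  refine Module.Basis.ext_multilinear (fun _ => Pi.basisFun ℝ (Fin n)) fun v => ?_
  have := mul_self_eq_zero.1 (h4 v (mem_univ _))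
  simpa [F] using this

/-! ### span -/

lemma gens_perm (σ : Equiv.Perm ι) (F : (ι → Fin n → ℝ) → ℝ)
    (hF : F ∈ Submodule.span ℝ (gens K ι)) :
    (fun z => F (fun k => z (σ k))) ∈ Submodule.span ℝ (gens K ι) := by
  let T : ((ι → Fin n → ℝ) → ℝ) →ₗ[ℝ] ((ι → Fin n → ℝ) → ℝ) :=
    LinearMap.funLeft ℝ ℝ (fun z k => z (σ k))
  suffices h : Submodule.span ℝ (gens K ι) ≤ (Submodule.span ℝ (gens K ι)).comap T from h hF
  rw [Submodule.span_le]
  rintro _ ⟨β, s, h1, h2, rfl⟩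
  apply Submodule.subset_span
  refine ⟨fun p => σ (β (σ.symm p)), s.map σ.toEmbedding, by simp [h1], ?_, ?_⟩
  · intro p
    simp only [Finset.mem_map_equiv, Equiv.symm_apply_apply]
    exact h2 _
  · ext z
    simp [T, LinearMap.funLeft]

lemma gens_extend (i j : ι) (hij : i ≠ j) (F : ({k : ι // k ≠ i ∧ k ≠ j} → Fin n → ℝ) → ℝ)
    (hF : F ∈ Submodule.span ℝ (gens K {k : ι // k ≠ i ∧ k ≠ j})) :
    (fun z : ι → Fin n → ℝ => w K (z j) (z i) * F (fun k => z k)) ∈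
      Submodule.span ℝ (gens K ι) := by
  let T : (({k : ι // k ≠ i ∧ k ≠ j} → Fin n → ℝ) → ℝ) →ₗ[ℝ] ((ι → Fin n → ℝ) → ℝ) :=
    { toFun := fun F z => w K (z j) (z i) * F (fun k => z k)
      map_add' := by intro F G; ext z; simp [mul_add]
      map_smul' := by intro c F; ext z; simp; ring }
  suffices h : Submodule.span ℝ (gens K {k : ι // k ≠ i ∧ k ≠ j}) ≤
    (Submodule.span ℝ (gens K ι)).comap T from h hF
  rw [Submodule.span_le]
  rintro _ ⟨β, s, h1, h2, rfl⟩
  apply Submodule.subset_span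
  let β' : ι → ι := fun k => if h : k ≠ i ∧ k ≠ j then (β ⟨k, h⟩ : ι) else if k = i then j else i
  have hβ : ∀ k : {k : ι // k ≠ i ∧ k ≠ j}, β' k = β k := by
    intro k; simp only [β']; rw [dif_pos k.2]
  have hi : β' i = j := by simp [β']
  have hj : β' j = i := by simp [β', hij.symm]
  have hjs : j ∉ s.map (Function.Embedding.subtype _) := by simp
  have cases : ∀ (P : ι → Prop), P i → P j → (∀ k : {k : ι // k ≠ i ∧ k ≠ j}, P k) → ∀ p, P p := by
    intro P a b c p
    by_cases h : p ≠ i ∧ p ≠ j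
    · exact c ⟨p, h⟩
    · by_cases h' : p = i
      · exact h' ▸ a
      · have : p = j := by tauto
        exact this ▸ b
  have hmem : ∀ k : {k : ι // k ≠ i ∧ k ≠ j},
      (k : ι) ∈ insert j (s.map (Function.Embedding.subtype _)) ↔ k ∈ s := by
    intro k
    simp [k.2.1, k.2.2]
  refine ⟨β', insert j (s.map (Function.Embedding.subtype _)), ?_, ?_, ?_⟩
  · apply cases
    · rw [hi, hj]
    · rw [hj, hi]
    · intro k; rw [hβ, hβ, h1]
  · apply cases
    · rw [hi]; simp [hij]
    · rw [hj]; simp [hij]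
    · intro k; rw [hβ, hmem, hmem]; exact h2 k
  · ext z
    rw [Finset.prod_insert hjs, hj, Finset.prod_map]
    simp [T, hβ]

/-- contraction -/
def cf (i j : ι) : MultilinearMap ℝ (fun _ : {k : ι // k ≠ i ∧ k ≠ j} => (Fin n → ℝ)) ℝ :=
  ∑ a, ∑ b, K a b • f.domDomRestrict (fun k => k ≠ i ∧ k ≠ j)
    (fun k => if k.1 = i then Pi.single a 1 else Pi.single b 1)

/-- extend by two vectors -/
def ext2 (i j : ι) (z : {k : ι // k ≠ i ∧ k ≠ j} → Fin n → ℝ) (x y : Fin n → ℝ) :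
    ι → Fin n → ℝ :=
  fun k => if h : k ≠ i ∧ k ≠ j then z ⟨k, h⟩ else if k = i then x else y

lemma cf_apply (i j : ι) (z) : cf K f i j z =
    ∑ a, ∑ b, K a b * f (ext2 i j z (Pi.single a 1) (Pi.single b 1)) := by
  simp only [cf, _root_.sum_apply, _root_.smul_apply, smul_eq_mul]
  rfl

lemma ext2_upd (i j : ι) (hij : i ≠ j) (z : {k : ι // k ≠ i ∧ k ≠ j} → Fin n → ℝ)
    (x y : Fin n → ℝ) : ext2 i j z x y = update (update (ext2 i j z 0 0) j y) i x := by
  ext1 k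
  by_cases h1 : k = i
  · subst h1; simp [ext2]
  · by_cases h2 : k = j
    · subst h2; simp [ext2, h1]
    · simp [ext2, h1, h2]

lemma cf_contr (i j : ι) (hij : i ≠ j) (z : ι → Fin n → ℝ) :
    cf K f i j (fun k => z k) = contr K f i j z := by
  rw [cf_apply, contr]
  refine Finset.sum_congr rfl fun a _ => Finset.sum_congr rfl fun b _ => ?_
  congr 2
  ext1 k
  by_cases h1 : k = i
  · subst h1; simp [ext2]
  · by_cases h2 : k = j
    · subst h2; simp [ext2, h1]
    · simp [ext2, h1, h2]

lemma ext2_sum (i j : ι) (hij : i ≠ j) (z : {k : ι // k ≠ i ∧ k ≠ j} → Fin n → ℝ)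
    (x y : Fin n → ℝ) : f (ext2 i j z x y) =
      ∑ a, ∑ b, x a * y b * f (ext2 i j z (Pi.single a 1) (Pi.single b 1)) := by
  have H := ext2_upd i j hij z
  generalize ext2 i j z 0 0 = Z at H
  simp only [H]
  rw [← sum_update]
  refine Finset.sum_congr rfl fun a _ => ?_
  simp only [mul_assoc]
  rw [← Finset.mul_sum]
  congr 1
  rw [update_comm hij.symm, ← sum_update]
  refine Finset.sum_congr rfl fun b _ => ?_
  rw [update_comm hij]

lemma cf_inv (hK : Kᵀ = -K) (hK2 : K * K = -1) (hf : Inv K f) (i j : ι) (hij : i ≠ j) :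
    Inv K (cf K f i j) := by
  intro g hg z
  have hg2 : g * K * gᵀ = K := by
    have h1 : (-K * gᵀ * K) * g = 1 := by
      have : (-K * gᵀ * K) * g = -K * (gᵀ * K * g) := by simp only [Matrix.mul_assoc]
      rw [this, hg, neg_mul, hK2, neg_neg]
    have h2 := mul_eq_one_comm.1 h1
    have h3 : g * (-K * gᵀ * K) * (-K) = g * (-K) * gᵀ := by
      have : g * (-K * gᵀ * K) * (-K) = g * (-K) * gᵀ * -(K * K) := by
        simp only [Matrix.mul_assoc, mul_neg, neg_mul]
      rw [this, hK2, neg_neg, mul_one]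
    rw [h2, one_mul] at h3
    simpa using h3.symm
  have hR : cf K f i j z = ∑ c, ∑ d, K c d *
      f (ext2 i j (fun k => g *ᵥ z k) (g *ᵥ Pi.single c 1) (g *ᵥ Pi.single d 1)) := by
    rw [cf_apply]
    refine Finset.sum_congr rfl fun a _ => Finset.sum_congr rfl fun b _ => ?_
    rw [← hf g hg]
    congr 2
    ext1 k
    by_cases h1 : k = i
    · subst h1; simp [ext2]
    · by_cases h2 : k = j
      · subst h2; simp [ext2, h1]
      · simp [ext2, h1, h2]
  rw [hR, cf_apply]
  simp only [ext2_sum f i j hij _ (g *ᵥ _) _, Finset.mul_sum]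
  have H3 : ∀ F : Fin n → Fin n → Fin n → Fin n → ℝ,
      ∑ c, ∑ d, ∑ a, ∑ b, F c d a b = ∑ a, ∑ b, ∑ c, ∑ d, F c d a b := by
    intro F
    simp only [← Fintype.sum_prod_type' (f := fun (a : Fin n) (b : Fin n) => _)]
    rw [Finset.sum_comm]
  rw [H3]
  refine Finset.sum_congr rfl fun a _ => Finset.sum_congr rfl fun b _ => ?_
  conv_lhs => rw [← hg2]
  simp only [Matrix.mul_apply, transpose_apply, Finset.sum_mul, mulVec_single_one, col_apply]
  rw [Finset.sum_comm]
  refine Finset.sum_congr rfl fun c _ => Finset.sum_congr rfl fun d _ => by ring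

end

lemma inj_mem {V : Type*} [AddCommGroup V] [Module ℝ V] [FiniteDimensional ℝ V] (T : V →ₗ[ℝ] V)
    (hT : ∀ v, T v = 0 → v = 0) (S : Submodule ℝ V) (hS : ∀ v ∈ S, T v ∈ S) (f : V)
    (hf : T f ∈ S) : f ∈ S := by
  have hinj : Function.Injective (T.restrict hS) := by
    rw [← LinearMap.ker_eq_bot, LinearMap.ker_eq_bot']
    rintro ⟨g, hg⟩ h
    exact Subtype.ext (hT g (congrArg Subtype.val h))
  obtain ⟨⟨g, hg⟩, hgf⟩ := (LinearMap.injective_iff_surjective.1 hinj) ⟨T f, hf⟩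
  have h1 : T g = T f := congrArg Subtype.val hgf
  have h2 : f - g = 0 := hT _ (by rw [map_sub, h1, sub_self])
  rw [sub_eq_zero.1 h2]
  exact hg

theorem fft (K : Matrix (Fin n) (Fin n) ℝ) (hK : Kᵀ = -K) (hK2 : K * K = -1) (N : ℕ) :
    ∀ (ι : Type) [Fintype ι] [DecidableEq ι] (_ : Fintype.card ι = N)
      (f : MultilinearMap ℝ (fun _ : ι => (Fin n → ℝ)) ℝ), Inv K f →
      ⇑f ∈ Submodule.span ℝ (gens K ι) := by
  induction N using Nat.strong_induction_on with
  | _ N ih =>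
  intro ι _ _ hN f hf
  rcases isEmpty_or_nonempty ι with he | he
  · have : ⇑f = f 0 • (fun _ => (1 : ℝ)) := by
      ext z
      simp [Subsingleton.elim z 0]
    rw [this]
    refine Submodule.smul_mem _ _ (Submodule.subset_span ⟨id, ∅, by simp, fun p => he.elim p, ?_⟩)
    simp
  let S : Submodule ℝ (MultilinearMap ℝ (fun _ : ι => (Fin n → ℝ)) ℝ) :=
    (Submodule.span ℝ (gens K ι)).comap
      ({ toFun := fun f => ⇑f, map_add' := fun _ _ => rfl, map_smul' := fun _ _ => rfl } :
        MultilinearMap ℝ (fun _ : ι => (Fin n → ℝ)) ℝ →ₗ[ℝ] ((ι → Fin n → ℝ) → ℝ))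
  have hS : ∀ g, g ∈ S ↔ ⇑g ∈ Submodule.span ℝ (gens K ι) := fun g => Iff.rfl
  have hAS : ∀ g ∈ S, A n ι g ∈ S := by
    intro g hg
    rw [hS] at hg ⊢
    have : ⇑(A n ι g) = ∑ j, (((n : ℝ) + 1) • ⇑g + ∑ i ∈ univ.erase j,
        (fun z => g (fun k => z (Equiv.swap i j k)))) := by
      ext z
      simp [A_apply, Finset.sum_apply]
    rw [this]
    exact Submodule.sum_mem _ fun j _ => Submodule.add_mem _ (Submodule.smul_mem _ _ hg)
      (Submodule.sum_mem _ fun i _ => gens_perm K _ _ hg)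
  have hAf : A n ι f ∈ S := by
    rw [hS]
    have : ⇑(A n ι f) = ∑ j, ∑ i ∈ univ.erase j,
        (-1 : ℝ) • (fun z : ι → Fin n → ℝ => w K (z j) (z i) * cf K f i j (fun k => z k)) := by
      ext z
      rw [A_apply]
      simp only [Finset.sum_apply, Pi.smul_apply, smul_eq_mul, neg_mul, one_mul]
      refine Finset.sum_congr rfl fun j _ => ?_
      have := main_identity K f hK hK2 hf j z
      rw [Finset.sum_add_distrib] at this
      have h2 : ∑ i ∈ univ.erase j, -(w K (z j) (z i) * cf K f i j (fun k => z k)) =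
          - ∑ i ∈ univ.erase j, w K (z j) (z i) * contr K f i j z := by
        rw [← Finset.sum_neg_distrib]
        refine Finset.sum_congr rfl fun i hi => ?_
        rw [cf_contr K f i j (Finset.ne_of_mem_erase hi)]
      rw [h2]; linarith
    rw [this]
    refine Submodule.sum_mem _ fun j _ => Submodule.sum_mem _ fun i hi =>
      Submodule.smul_mem _ _ ?_
    have hij := Finset.ne_of_mem_erase hi
    refine gens_extend K i j hij _ (ih _ ?_ _ rfl _ (cf_inv K f hK hK2 hf i j hij))
    rw [← hN]
    exact Fintype.card_subtype_lt (x := i) (by simp)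
  exact inj_mem (A n ι) (fun g hg => A_inj g hg) S hAS f hAf

lemma omega_skew (n : ℕ) : (OmegaM n)ᵀ = -OmegaM n := by
  ext i j
  simp only [OmegaM, transpose_apply, of_apply, Matrix.neg_apply]
  split_ifs <;> first | omega | simp

lemma omega_sq (m : ℕ) : OmegaM (2 * m) * OmegaM (2 * m) = -1 := by
  ext i j
  rw [Matrix.mul_apply, Matrix.neg_apply, Matrix.one_apply]
  have hi := i.2
  let i' : Fin (2 * m) := ⟨if (i : ℕ) % 2 = 0 then i + 1 else i - 1, by split_ifs <;> omega⟩
  have hi' : (i' : ℕ) = if (i : ℕ) % 2 = 0 then (i : ℕ) + 1 else i - 1 := rfl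
  rw [Finset.sum_eq_single i']
  · simp only [OmegaM, of_apply, hi', Fin.ext_iff]
    split_ifs <;> first | omega | simp
  · intro k _ hk
    have hk' : (k : ℕ) ≠ if (i : ℕ) % 2 = 0 then (i : ℕ) + 1 else i - 1 := by
      rw [← hi']; exact fun h => hk (Fin.ext h)
    have : OmegaM (2 * m) i k = 0 := by
      simp only [OmegaM, of_apply]
      split_ifs at hk' ⊢ <;> first | omega | rfl
    rw [this, zero_mul]
  · simp

lemma gens_brauer (K : Matrix (Fin n) (Fin n) ℝ) (hK : Kᵀ = -K) (N : ℕ) :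
    Submodule.span ℝ (gens K (Fin N)) ≤ Submodule.span ℝ
      {F : (Fin N → (Fin n → ℝ)) → ℝ | ∃ β : BrauerPairing N,
        F = fun z => ∏ p ∈ Finset.univ.filter (fun p => p < β.pair p),
          w K (z p) (z (β.pair p))} := by
  rw [Submodule.span_le]
  rintro _ ⟨β, s, h1, h2, rfl⟩
  have hne : ∀ p, β p ≠ p := by
    intro p h
    have := h2 p
    rw [h] at this
    tauto
  let B : BrauerPairing N := ⟨β, h1, hne⟩
  have key : (fun z : Fin N → Fin n → ℝ => ∏ p ∈ s, w K (z p) (z (β p))) =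
      ((-1 : ℝ) ^ #(univ.filter (fun p => p < β p ∧ p ∉ s))) •
      (fun z => ∏ p ∈ Finset.univ.filter (fun p => p < B.pair p), w K (z p) (z (B.pair p))) := by
    ext z
    simp only [Pi.smul_apply, smul_eq_mul, B]
    rw [← Finset.prod_filter_mul_prod_filter_not s (fun p => p < β p),
      ← Finset.prod_filter_mul_prod_filter_not (univ.filter fun p => p < β p) (fun p => p ∈ s)]
    have e1 : s.filter (fun p => p < β p) =
        (univ.filter fun p => p < β p).filter (fun p => p ∈ s) := by
      ext p; simp [and_comm]
    have e2 : ∏ p ∈ s with ¬ p < β p, w K (z p) (z (β p)) =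
        ∏ p ∈ (univ.filter fun p => p < β p).filter (fun p => p ∉ s), - w K (z p) (z (β p)) := by
      refine Finset.prod_bij' (fun p _ => β p) (fun p _ => β p) ?_ ?_ ?_ ?_ ?_
      · intro p hp
        simp only [Finset.mem_filter, mem_univ, true_and, h1] at hp ⊢
        exact ⟨lt_of_le_of_ne (not_lt.1 hp.2) (hne p), (h2 p).1 hp.1⟩
      · intro p hp
        simp only [Finset.mem_filter, mem_univ, true_and, h1] at hp ⊢
        refine ⟨?_, not_lt.2 hp.1.le⟩
        have := h2 p
        tauto
      · intro p _; exact h1 p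
      · intro p _; exact h1 p
      · intro p _
        rw [h1]; exact w_skew K hK _ _
    rw [e1, e2, Finset.prod_neg, Finset.filter_filter, Finset.filter_filter]
    ring
  rw [key]
  exact Submodule.smul_mem _ _ (Submodule.subset_span ⟨B, rfl⟩)

end SpFFT

/-- **First Fundamental Theorem for `Sp(n)`** (multilinear form).  For `n = 2m`,
every `Sp(n)`-invariant multilinear map `f : (ℝⁿ)^N → ℝ` lies in the span of the
maps `(z₁,…,z_N) ↦ ∏_{{p,q} ∈ β, p < q} ω(z_p, z_q)`, with `ω(x,y) = xᵀ Ω y`,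
where `β` ranges over partitions of `{1,…,N}` into disjoint pairs.  In
particular, if `N` is odd then `f = 0`. -/
theorem stmt14 (n m N : ℕ) (hm : 1 ≤ m) (hn : n = 2 * m)
    (f : MultilinearMap ℝ (fun _ : Fin N => (Fin n → ℝ)) ℝ)
    (hf : ∀ g : Matrix (Fin n) (Fin n) ℝ, gᵀ * OmegaM n * g = OmegaM n →
      ∀ z : Fin N → (Fin n → ℝ), f (fun i => g.mulVec (z i)) = f z) :
    (⇑f ∈ Submodule.span ℝ
      {F : (Fin N → (Fin n → ℝ)) → ℝ | ∃ β : BrauerPairing N,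
        F = fun z => ∏ p ∈ Finset.univ.filter (fun p => p < β.pair p),
          ∑ a, ∑ b, z p a * OmegaM n a b * z (β.pair p) b}) ∧
    (Odd N → f = 0) := by
  subst hn
  constructor
  · have h := SpFFT.fft (OmegaM (2 * m)) (SpFFT.omega_skew _) (SpFFT.omega_sq m) N (Fin N)
      (by simp) f hf
    exact SpFFT.gens_brauer _ (SpFFT.omega_skew _) N h
  · intro hodd
    refine MultilinearMap.ext fun z => ?_
    have h := hf (-1) (by simp) z
    have h2 : (fun i => (-1 : Matrix (Fin (2 * m)) (Fin (2 * m)) ℝ).mulVec (z i)) =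
        fun i => (-1 : ℝ) • z i := by
      ext1 i
      simp [neg_mulVec]
    rw [h2, f.map_smul_univ (fun _ => (-1 : ℝ)) z] at h
    simp [hodd.neg_one_pow] at h
    simp only [MultilinearMap.zero_apply]
    linarith
end
end

section
/- Let n ≥ 1 and N ≥ 0 be integers, and let f : (ℝⁿ)^N → ℝ be a multilinear map that is SO(n)-invariant, i.e. f(gz₁,…,gz_N) = f(z₁,…,z_N) for all g ∈ SO(n) and all z₁,…,z_N ∈ ℝⁿ. Then f lies in the linear span of: (i) the multilinear maps (z₁,…,z_N) ↦ ∏_{{p,q}∈β} ⟨z_p, z_q⟩ for β a partition of {1,…,N} into disjoint pairs, together with (ii) the multilinear maps (z₁,…,z_N) ↦ det(z_{a₁},…,z_{a_n}) · ∏_{{p,q}∈π} ⟨z_p, z_q⟩, where a₁ < … < a_n is a choice of n elements of {1,…,N}, det(z_{a₁},…,z_{a_n}) is the determinant of the n×n matrix with these columns, and π is a partition of the remaining N−n elements into disjoint pairs. -/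
open Matrix

noncomputable section

namespace FFT
variable {κ : Type} [Fintype κ] [DecidableEq κ] {n : ℕ}

def Phi (c : (κ → Fin n) → ℝ) (z : κ → Fin n → ℝ) : ℝ := ∑ w, c w * ∏ i, z i (w i)

def Inv (c : (κ → Fin n) → ℝ) : Prop :=
  ∀ g : Matrix (Fin n) (Fin n) ℝ, gᵀ * g = 1 → g.det = 1 →
    ∀ w, ∑ u, c u * ∏ i, g (u i) (w i) = c w

def rotP (a b : Fin n) : Matrix (Fin n) (Fin n) ℝ := Matrix.single a a 1 + Matrix.single b b 1
def rotJ (a b : Fin n) : Matrix (Fin n) (Fin n) ℝ := Matrix.single b a 1 - Matrix.single a b 1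
def rot (a b : Fin n) (t : ℝ) : Matrix (Fin n) (Fin n) ℝ :=
  1 + (Real.cos t - 1) • rotP a b + Real.sin t • rotJ a b

lemma rot_mul {a b : Fin n} (h : a ≠ b) (s t : ℝ) : rot a b s * rot a b t = rot a b (s + t) := by
  have h' := h.symm
  have e1 : rotP a b * rotP a b = rotP a b := by
    simp [rotP, add_mul, mul_add, Matrix.single_mul_single_of_ne, h, h']
  have e2 : rotP a b * rotJ a b = rotJ a b := by
    simp [rotP, rotJ, add_mul, mul_add, mul_sub, sub_mul, Matrix.single_mul_single_of_ne, h, h']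
  have e3 : rotJ a b * rotP a b = rotJ a b := by
    simp [rotP, rotJ, add_mul, mul_add, mul_sub, sub_mul, Matrix.single_mul_single_of_ne, h, h']
    try abel
  have e4 : rotJ a b * rotJ a b = - rotP a b := by
    simp [rotP, rotJ, add_mul, mul_add, mul_sub, sub_mul, Matrix.single_mul_single_of_ne, h, h']
    abel
  simp only [rot, add_mul, mul_add, one_mul, mul_one, smul_mul_assoc, mul_smul_comm, e1, e2, e3, e4,
    Real.cos_add, Real.sin_add]
  module

lemma rot_zero (a b : Fin n) : rot a b 0 = 1 := by simp [rot]

lemma rot_transpose (a b : Fin n) (t : ℝ) : (rot a b t)ᵀ = rot a b (-t) := by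
  simp [rot, rotP, rotJ, Matrix.transpose_add, Matrix.transpose_sub, Matrix.transpose_smul]
  module

lemma rot_orth {a b : Fin n} (h : a ≠ b) (t : ℝ) : (rot a b t)ᵀ * rot a b t = 1 := by
  rw [rot_transpose, rot_mul h, neg_add_cancel, rot_zero]

lemma rot_det {a b : Fin n} (h : a ≠ b) (t : ℝ) : (rot a b t).det = 1 := by
  have e := rot_mul h (t/2) (t/2)
  rw [add_halves] at e
  have := congrArg Matrix.det (rot_orth h (t/2))
  rw [Matrix.det_mul, Matrix.det_transpose, Matrix.det_one] at this
  rw [← e, Matrix.det_mul, this]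

lemma rot_deriv (a b x y : Fin n) : HasDerivAt (fun t => rot a b t x y) (rotJ a b x y) 0 := by
  have h1 := ((Real.hasDerivAt_cos 0).sub_const 1).mul_const (rotP a b x y)
  have h2 := (Real.hasDerivAt_sin 0).mul_const (rotJ a b x y)
  have := (h1.add h2).const_add ((1 : Matrix (Fin n) (Fin n) ℝ) x y)
  refine (this.congr_deriv (by simp)).congr_of_eventuallyEq (Filter.Eventually.of_forall fun t => ?_)
  simp [rot, Matrix.add_apply, Matrix.smul_apply]
  ring

/-- the operator replacing a letter `a` by `b`. -/
def D (a b : Fin n) (c : (κ → Fin n) → ℝ) (w : κ → Fin n) : ℝ :=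
  ∑ i, if w i = a then c (Function.update w i b) else 0

lemma collapse (c : (κ → Fin n) → ℝ) (w : κ → Fin n) (i : κ) (F : Fin n → ℝ) :
    ∑ u, c u * ((∏ j ∈ Finset.univ.erase i, (1 : Matrix (Fin n) (Fin n) ℝ) (u j) (w j)) * F (u i))
      = ∑ x, F x * c (Function.update w i x) := by
  have : ∀ u : κ → Fin n, c u * ((∏ j ∈ Finset.univ.erase i, (1 : Matrix (Fin n) (Fin n) ℝ) (u j) (w j)) * F (u i))
      = ∑ x, if u = Function.update w i x then F x * c u else 0 := by
    intro u
    by_cases h : ∀ j, j ≠ i → u j = w j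
    · rw [Finset.prod_eq_one, Finset.sum_eq_single (u i), if_pos]
      · ring
      · ext j
        by_cases hj : j = i
        · subst hj; simp
        · simp [hj, h j hj]
      · intro x _ hx
        rw [if_neg]
        rintro rfl
        simp at hx
      · simp
      · intro j hj
        rw [h j (Finset.ne_of_mem_erase hj)]; simp
    · push Not at h
      obtain ⟨j, hj, hne⟩ := h
      rw [Finset.prod_eq_zero (i := j) (by simp [hj])]
      · rw [Finset.sum_eq_zero]; · simp
        intro x _
        rw [if_neg]
        rintro rfl
        simp [hj] at hne
      · simp [Matrix.one_apply, hne]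
  simp_rw [this]
  rw [Finset.sum_comm]
  simp

lemma Inv.lie {c : (κ → Fin n) → ℝ} (hc : Inv c) (a b : Fin n) : D a b c = D b a c := by
  by_cases h : a = b
  · rw [h]
  ext w
  have h1 : HasDerivAt (fun t => ∑ u, c u * ∏ i, rot a b t (u i) (w i))
      (∑ u, c u * ∑ i, (∏ j ∈ Finset.univ.erase i, rot a b 0 (u j) (w j)) • rotJ a b (u i) (w i)) 0 := by
    apply HasDerivAt.fun_sum
    intro u _
    apply HasDerivAt.const_mul
    apply HasDerivAt.fun_finsetProd
    intro i _
    exact rot_deriv a b _ _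
  have h2 : (fun t => ∑ u, c u * ∏ i, rot a b t (u i) (w i)) = fun _ => c w := by
    ext t
    exact hc _ (rot_orth h t) (rot_det h t) w
  rw [h2] at h1
  have h3 := h1.unique (hasDerivAt_const 0 (c w))
  simp only [rot_zero, smul_eq_mul, Finset.mul_sum] at h3
  rw [Finset.sum_comm] at h3
  simp_rw [fun i => collapse c w i (fun x => rotJ a b x (w i))] at h3
  rw [← sub_eq_zero, ← h3, D, D, ← Finset.sum_sub_distrib]
  apply Finset.sum_congr rfl
  intro i _
  simp only [rotJ, Matrix.sub_apply, Matrix.single_apply, sub_mul, Finset.sum_sub_distrib]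
  congr 1 <;> simp [ite_and, eq_comm]

end FFT
namespace FFT
variable {κ : Type} [Fintype κ] [DecidableEq κ] {n : ℕ}

lemma D_adj (a b : Fin n) (c d : (κ → Fin n) → ℝ) :
    ∑ w, d w * D a b c w = ∑ w, D b a d w * c w := by
  simp only [D, Finset.mul_sum, Finset.sum_mul, mul_ite, ite_mul, mul_zero, zero_mul]
  rw [Finset.sum_comm, Finset.sum_comm (f := fun w i => if w i = b then d (Function.update w i a) * c w else 0)]
  apply Finset.sum_congr rfl
  intro i _
  rw [← Finset.sum_filter, ← Finset.sum_filter]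
  apply Finset.sum_nbij' (fun w => Function.update w i b) (fun w => Function.update w i a)
  · simp
  · simp
  · intro w hw
    simp only [Finset.mem_filter] at hw
    simp [← hw.2]
  · intro w hw
    simp only [Finset.mem_filter] at hw
    simp [← hw.2]
  · intro w hw
    simp only [Finset.mem_filter] at hw
    simp [← hw.2]

def mult (a : Fin n) (w : κ → Fin n) : ℕ := (Finset.univ.filter (fun i => w i = a)).card

lemma D_self (a : Fin n) (c : (κ → Fin n) → ℝ) (w : κ → Fin n) :
    D a a c w = mult a w * c w := by
  have : ∀ i, (if w i = a then c (Function.update w i a) else 0) = if w i = a then c w else 0 := by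
    intro i
    split_ifs with h
    · rw [← h]; simp
    · rfl
  simp [D, this, mult, ← Finset.sum_filter]

lemma sum_mult (w : κ → Fin n) : ∑ a, mult a w = Fintype.card κ := by
  rw [← Finset.card_univ, Finset.card_eq_sum_card_fiberwise (f := w) (t := Finset.univ) (by simp)]
  rfl

lemma DD (c : (κ → Fin n) → ℝ)
    (htr : ∀ i j : κ, i ≠ j → ∀ w, ∑ x, c (Function.update (Function.update w i x) j x) = 0)
    (w : κ → Fin n) : ∑ a, ∑ b, D a b (D a b c) w = Fintype.card κ * c w := by
  have key : ∀ i j, ∑ a, ∑ b, (if w i = a then if Function.update w i b j = a then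
        c (Function.update (Function.update w i b) j b) else 0 else 0)
      = if i = j then c w else 0 := by
    intro i j
    rw [Finset.sum_eq_single (w i)]
    · simp only [if_true]
      by_cases h : i = j
      · subst h
        simp
      · simp only [h, if_false, Function.update_of_ne (Ne.symm h)]
        split_ifs
        · exact htr i j h w
        · simp
    · intro a _ ha
      simp [ha.symm]
    · simp
  calc ∑ a, ∑ b, D a b (D a b c) w 
      = ∑ i, ∑ j, ∑ a, ∑ b, (if w i = a then if Function.update w i b j = a then
        c (Function.update (Function.update w i b) j b) else 0 else 0) := by
        simp only [D, Finset.sum_ite_irrel, Finset.sum_const_zero]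
        have : ∀ (a b : Fin n) (i : κ), (if w i = a then ∑ j, (if Function.update w i b j = a then
          c (Function.update (Function.update w i b) j b) else 0) else 0) = ∑ j, (if w i = a then if Function.update w i b j = a then
          c (Function.update (Function.update w i b) j b) else 0 else 0) := by
            intro a b i; split_ifs <;> simp
        simp_rw [this]
        have e : ∀ F : Fin n → Fin n → κ → κ → ℝ, ∑ a, ∑ b, ∑ i, ∑ j, F a b i j = ∑ i, ∑ j, ∑ a, ∑ b, F a b i j := by
          intro F
          calc ∑ a, ∑ b, ∑ i, ∑ j, F a b i j = ∑ a, ∑ i, ∑ b, ∑ j, F a b i j :=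
                Finset.sum_congr rfl fun a _ => Finset.sum_comm
            _ = ∑ i, ∑ a, ∑ b, ∑ j, F a b i j := Finset.sum_comm
            _ = ∑ i, ∑ a, ∑ j, ∑ b, F a b i j :=
                Finset.sum_congr rfl fun i _ => Finset.sum_congr rfl fun a _ => Finset.sum_comm
            _ = _ := Finset.sum_congr rfl fun i _ => Finset.sum_comm
        rw [e]
        simp [Finset.sum_ite_irrel]
    _ = _ := by
        simp_rw [key]
        simp

lemma energy (c : (κ → Fin n) → ℝ) (hl : ∀ a b, D a b c = D b a c)
    (htr : ∀ i j : κ, i ≠ j → ∀ w, ∑ x, c (Function.update (Function.update w i x) j x) = 0) :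
    (∀ a b, a ≠ b → D a b c = 0) ∧ ∀ w, c w ≠ 0 → Function.Injective w := by
  have h1 : ∑ a : Fin n, ∑ b : Fin n, ∑ w, D a b c w ^ 2 = ∑ w, Fintype.card κ * c w ^ 2 := by
    have : ∀ a b : Fin n, ∑ w, D a b c w ^ 2 = ∑ w, c w * D a b (D a b c) w := by
      intro a b
      rw [D_adj a b (D a b c) c, hl b a]
      simp [sq]
    simp_rw [this]
    have e : ∀ F : Fin n → Fin n → (κ → Fin n) → ℝ, ∑ a, ∑ b, ∑ w, F a b w = ∑ w, ∑ a, ∑ b, F a b w := by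
      intro F
      rw [Finset.sum_comm (s := (Finset.univ : Finset (κ → Fin n)))]
      exact Finset.sum_congr rfl fun a _ => Finset.sum_comm
    rw [e]
    apply Finset.sum_congr rfl
    intro w _
    simp_rw [← Finset.mul_sum]
    rw [DD c htr]; ring
  have h2 : ∑ a : Fin n, ∑ b : Fin n, (if a = b then ∑ w, ((mult a w : ℝ)^2 - mult a w) * c w ^ 2 else ∑ w, D a b c w ^ 2) = 0 := by
    have : ∀ a b : Fin n, (if a = b then ∑ w, ((mult a w : ℝ)^2 - mult a w) * c w ^ 2 else ∑ w, D a b c w ^ 2)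
       = ∑ w, D a b c w ^ 2 - if a = b then ∑ w, mult a w * c w ^ 2 else 0 := by
      intro a b
      split_ifs with h
      · subst h
        simp_rw [D_self, ← Finset.sum_sub_distrib]
        apply Finset.sum_congr rfl
        intro w _; ring
      · simp
    simp_rw [this, Finset.sum_sub_distrib]
    rw [h1]
    simp only [Finset.sum_ite_eq, Finset.mem_univ, if_true]
    rw [Finset.sum_comm (f := fun a w => (mult a w : ℝ) * c w ^ 2)]
    have hs : ∀ w : κ → Fin n, ∑ a, (mult a w : ℝ) = Fintype.card κ := by
      intro w
      exact_mod_cast sum_mult w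
    simp_rw [← Finset.sum_mul, hs]
    simp
  have hm : ∀ (a : Fin n) (w : κ → Fin n), 0 ≤ ((mult a w : ℝ)^2 - mult a w) * c w ^ 2 := by
    intro a w
    apply mul_nonneg _ (sq_nonneg _)
    have : mult a w ≤ mult a w ^ 2 := Nat.le_self_pow (by norm_num) _
    have : (mult a w : ℝ) ≤ (mult a w : ℝ)^2 := by exact_mod_cast this
    linarith
  have hnn : ∀ a b : Fin n, 0 ≤ (if a = b then ∑ w, ((mult a w : ℝ)^2 - mult a w) * c w ^ 2 else ∑ w, D a b c w ^ 2) := by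
    intro a b
    split_ifs
    · exact Finset.sum_nonneg fun w _ => hm a w
    · exact Finset.sum_nonneg fun w _ => sq_nonneg _
  have h3 : ∀ a b : Fin n, (if a = b then ∑ w, ((mult a w : ℝ)^2 - mult a w) * c w ^ 2 else ∑ w, D a b c w ^ 2) = 0 := by
    intro a b
    rw [Finset.sum_eq_zero_iff_of_nonneg (fun a _ => Finset.sum_nonneg fun b _ => hnn a b)] at h2
    have := h2 a (Finset.mem_univ _)
    rw [Finset.sum_eq_zero_iff_of_nonneg (fun b _ => hnn a b)] at this
    exact this b (Finset.mem_univ _)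
  constructor
  · intro a b hab
    have := h3 a b
    rw [if_neg hab, Finset.sum_eq_zero_iff_of_nonneg (fun _ _ => sq_nonneg _)] at this
    ext w
    simpa using this w (Finset.mem_univ _)
  · intro w hw i j hij
    have := h3 (w i) (w i)
    rw [if_pos rfl, Finset.sum_eq_zero_iff_of_nonneg (fun w _ => hm _ w)] at this
    have := this w (Finset.mem_univ _)
    have h4 : ((mult (w i) w : ℝ)^2 - mult (w i) w) = 0 := by
      rcases mul_eq_zero.1 this with h | h
      · exact h
      · exact absurd (pow_eq_zero_iff (by norm_num) |>.1 h) hw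
    have h5 : mult (w i) w ^ 2 = mult (w i) w := by
      have : (mult (w i) w : ℝ)^2 = mult (w i) w := by linarith
      exact_mod_cast this
    have h6 : mult (w i) w ≤ 1 := by nlinarith
    exact Finset.card_le_one.1 h6 i (by simp) j (by simp [hij])

/-- the tensor of the determinant -/
def hdet (n : ℕ) (v : Fin n → Fin n) : ℝ :=
  Matrix.det (Matrix.of fun i r : Fin n => if i = v r then (1 : ℝ) else 0)

lemma hdet_perm (τ : Equiv.Perm (Fin n)) : hdet n τ = (Equiv.Perm.sign τ : ℤ) := by
  rw [← Matrix.det_permutation τ, ← Matrix.det_transpose]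
  unfold hdet
  congr 1
  ext i r
  simp [Equiv.Perm.permMatrix, PEquiv.toMatrix_apply, eq_comm]

lemma hdet_of_not (v : Fin n → Fin n) (hv : ¬ Function.Injective v) : hdet n v = 0 := by
  simp only [Function.Injective, not_forall] at hv
  obtain ⟨i, j, h, hne⟩ := hv
  apply Matrix.det_zero_of_column_eq hne
  intro k
  simp [h]

lemma swap_sign (c : (κ → Fin n) → ℝ) (hD : ∀ a b, a ≠ b → D a b c = 0)
    (v : κ → Fin n) (hv : Function.Bijective v) (a b : Fin n) (hab : a ≠ b) :
    c (Equiv.swap a b ∘ v) = - c v := by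
  obtain ⟨i, rfl⟩ := hv.2 a
  obtain ⟨j, rfl⟩ := hv.2 b
  have hij : i ≠ j := fun h => hab (by rw [h])
  have := congrFun (hD (v j) (v i) hab.symm) (Function.update v i (v j))
  have hz : ∀ k, k ≠ i → k ≠ j → (if Function.update v i (v j) k = v j then
      c (Function.update (Function.update v i (v j)) k (v i)) else 0) = 0 := by
    intro k hk hk'
    rw [if_neg]
    rw [Function.update_of_ne hk]
    exact fun h => hk' (hv.1 h)
  rw [D, ← Finset.sum_subset (Finset.subset_univ {i, j}), Finset.sum_pair hij] at this
  · simp [hij.symm] at this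
    have e : Function.update (Function.update v i (v j)) j (v i) = Equiv.swap (v i) (v j) ∘ v := by
      ext k
      by_cases hk : k = j
      · subst hk; simp
      by_cases hk' : k = i
      · subst hk'; simp [hk]
      simp [hk, hk']
      rw [Equiv.swap_apply_of_ne_of_ne] <;> simp [hv.1.eq_iff, hk, hk']
    rw [e] at this
    linarith
  · intro k _ hk
    simp at hk
    exact hz k hk.1 hk.2

lemma perm_sign (c : (κ → Fin n) → ℝ) (hD : ∀ a b, a ≠ b → D a b c = 0)
    (v : κ → Fin n) (hv : Function.Bijective v) (τ : Equiv.Perm (Fin n)) :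
    c (τ ∘ v) = (Equiv.Perm.sign τ : ℤ) * c v := by
  induction τ using Equiv.Perm.swap_induction_on with
  | one => simp
  | swap_mul f x y hxy ih =>
    have := swap_sign c hD (f ∘ v) (f.bijective.comp hv) x y hxy
    rw [Equiv.Perm.coe_mul, Function.comp_assoc, this, ih]
    simp [Equiv.Perm.sign_mul, Equiv.Perm.sign_swap hxy]

inductive Allowed (n : ℕ) : (k : ℕ) → ((Fin k → Fin n) → ℝ) → Prop
  | zero : Allowed n 0 (fun _ => 1)
  | det : Allowed n n (hdet n)

/-- coefficient tensor of a generator -/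
def gen {k : ℕ} (σ : κ → κ) (a : Fin k → κ) (h : (Fin k → Fin n) → ℝ) (w : κ → Fin n) : ℝ :=
  (if ∀ p, w (σ p) = w p then 1 else 0) * h (w ∘ a)

def Perp (c : (κ → Fin n) → ℝ) : Prop :=
  ∀ (k : ℕ) (h : (Fin k → Fin n) → ℝ), Allowed n k h → ∀ (σ : κ → κ) (a : Fin k → κ),
    (∀ p, σ (σ p) = p) → Function.Injective a → (∀ p, σ p = p ↔ p ∈ Set.range a) →
    ∑ w, gen σ a h w * c w = 0

lemma final_step (c : (κ → Fin n) → ℝ) (hc : Perp c) (hD : ∀ a b, a ≠ b → D a b c = 0)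
    (hinj : ∀ w, c w ≠ 0 → Function.Injective w) : c = 0 := by
  by_contra hne
  obtain ⟨w, hw⟩ := Function.ne_iff.1 hne
  simp only [Pi.zero_apply] at hw
  have hwi := hinj w hw
  rcases isEmpty_or_nonempty κ with hκ | ⟨⟨i0⟩⟩
  · have := hc 0 _ Allowed.zero id (fun i => i.elim0) (by simp) (fun i => i.elim0) (fun p => hκ.elim p)
    rw [Fintype.sum_eq_single w (fun w' hw' => (hw' (Subsingleton.elim _ _)).elim)] at this
    simp [gen, hw] at this
  have hws : Function.Surjective w := by
    by_contra hs
    simp only [Function.Surjective, not_forall, not_exists] at hs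
    obtain ⟨b, hb⟩ := hs
    have := congrFun (hD b (w i0) (fun h => hb i0 h.symm)) (Function.update w i0 b)
    rw [D, Finset.sum_eq_single i0] at this
    · simp [hw] at this
    · intro k _ hk
      simp [hk, hb k]
    · simp
  let e : κ ≃ Fin n := Equiv.ofBijective w ⟨hwi, hws⟩
  have := hc n _ Allowed.det id e.symm (by simp) e.symm.injective (by intro p; simp)
  have e2 : ∑ v, gen id e.symm (hdet n) v * c v = ∑ τ : Equiv.Perm (Fin n), c w := by
    symm
    apply Finset.sum_bij_ne_zero (fun (τ : Equiv.Perm (Fin n)) _ _ => (τ : Fin n → Fin n) ∘ w)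
    · simp
    · intro τ _ _ τ' _ _ h
      ext x
      obtain ⟨y, rfl⟩ := hws x
      exact congrArg Fin.val (congrFun h y)
    · intro v _ hv
      have hd : hdet n (v ∘ e.symm) ≠ 0 := by
        intro h0
        simp [gen, h0] at hv
      have hi : Function.Injective (v ∘ e.symm) := by
        by_contra h
        exact hd (hdet_of_not _ h)
      refine ⟨Equiv.ofBijective _ (Finite.injective_iff_bijective.1 hi), Finset.mem_univ _, hw, ?_⟩
      ext i
      have : e.symm (w i) = i := e.symm_apply_apply i
      simp [this]
    · intro τ _ _
      have : (τ ∘ w) ∘ e.symm = τ := by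
        ext x
        have : w (e.symm x) = x := e.apply_symm_apply x
        simp [this]
      rw [perm_sign c hD w ⟨hwi, hws⟩, gen, this, hdet_perm]
      rcases Int.units_eq_one_or (Equiv.Perm.sign τ) with h | h <;> simp [h]
  rw [e2] at this
  simp [hw, Nat.factorial_ne_zero, Fintype.card_perm] at this

end FFT
namespace FFT
variable {κ : Type} [Fintype κ] [DecidableEq κ] {n : ℕ}

abbrev Rest (i j : κ) : Type := {k : κ // k ≠ i ∧ k ≠ j}

def extw (i j : κ) (w : Rest i j → Fin n) (x y : Fin n) : κ → Fin n := fun k =>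
  if h : k = i then x else if h' : k = j then y else w ⟨k, h, h'⟩

lemma extw_i (i j : κ) (w : Rest i j → Fin n) (x y : Fin n) : extw i j w x y i = x := by
  simp [extw]

lemma extw_j {i j : κ} (hij : i ≠ j) (w : Rest i j → Fin n) (x y : Fin n) :
    extw i j w x y j = y := by
  simp [extw, hij.symm]

lemma extw_val {i j : κ} (w : Rest i j → Fin n) (x y : Fin n) (k : Rest i j) :
    extw i j w x y k = w k := by
  simp [extw, k.2.1, k.2.2]

lemma extw_self {i j : κ} (w : κ → Fin n) :
    extw i j (fun k => w k) (w i) (w j) = w := by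
  ext k
  by_cases h : k = i
  · subst h; simp [extw]
  by_cases h' : k = j
  · subst h'; simp [extw, h]
  simp [extw, h, h']

lemma sum_ext {i j : κ} (hij : i ≠ j) (F : (κ → Fin n) → ℝ) :
    ∑ w, F w = ∑ x, ∑ y, ∑ w' : Rest i j → Fin n, F (extw i j w' x y) := by
  let e : (Fin n × Fin n × (Rest i j → Fin n)) ≃ (κ → Fin n) :=
    { toFun := fun p => extw i j p.2.2 p.1 p.2.1
      invFun := fun w => (w i, w j, fun k => w k)
      left_inv := by
        rintro ⟨x, y, w⟩
        simp [extw_i, extw_j hij, extw_val]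
      right_inv := fun w => extw_self w }
  rw [← e.sum_comp, Fintype.sum_prod_type]
  apply Finset.sum_congr rfl
  intro x _
  rw [Fintype.sum_prod_type]
  rfl

lemma prod_ext {i j : κ} (hij : i ≠ j) (F : κ → ℝ) :
    ∏ k, F k = F i * F j * ∏ k : Rest i j, F k := by
  rw [← Finset.mul_prod_erase _ _ (Finset.mem_univ i),
    ← Finset.mul_prod_erase _ _ (show j ∈ Finset.univ.erase i by simp [hij.symm]), mul_assoc]
  congr 2
  apply Finset.prod_subtype
  intro x
  simp [and_comm]

def contr (i j : κ) (c : (κ → Fin n) → ℝ) (w : Rest i j → Fin n) : ℝ := ∑ x, c (extw i j w x x)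

lemma Inv.contr {c : (κ → Fin n) → ℝ} (hc : Inv c) {i j : κ} (hij : i ≠ j) :
    Inv (contr i j c) := by
  intro g hg hd w
  have hg' : g * gᵀ = 1 := mul_eq_one_comm.1 hg
  have hp : ∀ p q, ∑ x, g p x * g q x = if p = q then 1 else 0 := by
    intro p q
    have := congrFun (congrFun hg' p) q
    simpa [Matrix.mul_apply, Matrix.one_apply] using this
  symm
  calc FFT.contr i j c w
      = ∑ x, ∑ p, ∑ q, ∑ u : Rest i j → Fin n, (c (extw i j u p q) * ∏ k, g (u k) (w k)) * (g p x * g q x) := by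
        unfold FFT.contr
        apply Finset.sum_congr rfl
        intro x _
        rw [← hc g hg hd, sum_ext hij]
        refine Finset.sum_congr rfl fun p _ => Finset.sum_congr rfl fun q _ => Finset.sum_congr rfl fun u _ => ?_
        rw [prod_ext hij]
        simp only [extw_i, extw_j hij, extw_val]
        ring
    _ = ∑ p, ∑ q, ∑ u : Rest i j → Fin n, (c (extw i j u p q) * ∏ k, g (u k) (w k)) * ∑ x, (g p x * g q x) := by
        simp_rw [Finset.mul_sum]
        rw [Finset.sum_comm]
        refine Finset.sum_congr rfl fun p _ => ?_
        rw [Finset.sum_comm]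
        refine Finset.sum_congr rfl fun q _ => ?_
        rw [Finset.sum_comm]
    _ = ∑ u, FFT.contr i j c u * ∏ k, g (u k) (w k) := by
        simp_rw [hp]
        simp only [FFT.contr, Finset.sum_mul, mul_ite, mul_one, mul_zero, Finset.sum_ite_irrel,
          Finset.sum_const_zero, Finset.sum_ite_eq, Finset.mem_univ, if_true]
        rw [Finset.sum_comm]

lemma Perp.contr {c : (κ → Fin n) → ℝ} (hc : Perp c) {i j : κ} (hij : i ≠ j) :
    Perp (contr i j c) := by
  intro k h hk σ a hσ ha hfix
  let τ : κ → κ := fun k => if h : k = i then j else if h' : k = j then i else σ ⟨k, h, h'⟩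
  have ti : τ i = j := by simp [τ]
  have tj : τ j = i := by simp [τ, hij.symm]
  have tv : ∀ p : Rest i j, τ p = σ p := by
    intro p
    simp [τ, p.2.1, p.2.2]
  have hcase : ∀ p : κ, p = i ∨ p = j ∨ ∃ q : Rest i j, p = q := by
    intro p
    by_cases h : p = i
    · exact Or.inl h
    by_cases h' : p = j
    · exact Or.inr (Or.inl h')
    exact Or.inr (Or.inr ⟨⟨p, h, h'⟩, rfl⟩)
  have := hc k h hk τ (fun r => (a r : κ)) ?_ ?_ ?_
  · rw [sum_ext hij] at this
    rw [← this]
    have hgen : ∀ (x y : Fin n) (w : Rest i j → Fin n),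
        gen τ (fun r => (a r : κ)) h (extw i j w x y) = if x = y then gen σ a h w else 0 := by
      intro x y w
      have e1 : (extw i j w x y) ∘ (fun r => (a r : κ)) = w ∘ a := by
        ext r
        simp [extw_val]
      have e2 : (∀ p, extw i j w x y (τ p) = extw i j w x y p) ↔ x = y ∧ ∀ p, w (σ p) = w p := by
        constructor
        · intro H
          constructor
          · have := H j
            rwa [tj, extw_i, extw_j hij] at this
          · intro p
            have := H p
            rwa [tv, extw_val, extw_val] at this
        · rintro ⟨rfl, H⟩ p
          rcases hcase p with rfl | rfl | ⟨q, rfl⟩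
          · rw [ti, extw_i, extw_j hij]
          · rw [tj, extw_i, extw_j hij]
          · rw [tv, extw_val, extw_val, H]
      unfold gen
      rw [e1]
      simp only [e2]
      by_cases hxy : x = y <;> simp [hxy]
    simp_rw [hgen]
    simp only [FFT.contr, Finset.mul_sum, ite_mul, zero_mul, Finset.sum_ite_irrel,
          Finset.sum_const_zero, Finset.sum_ite_eq, Finset.mem_univ, if_true]
    rw [Finset.sum_comm]
  · intro p
    rcases hcase p with rfl | rfl | ⟨q, rfl⟩
    · rw [ti, tj]
    · rw [tj, ti]
    · rw [tv, tv, hσ]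
  · intro r s hrs
    exact ha (Subtype.ext hrs)
  · intro p
    rcases hcase p with rfl | rfl | ⟨q, rfl⟩
    · rw [ti]
      simp only [hij.symm, false_iff, Set.mem_range, not_exists]
      intro r hr
      exact (a r).2.1 hr
    · rw [tj]
      simp only [hij, false_iff, Set.mem_range, not_exists]
      intro r hr
      exact (a r).2.2 hr
    · rw [tv, ← Subtype.ext_iff, hfix]
      simp [Subtype.ext_iff]

theorem main_aux (N : ℕ) : ∀ (κ : Type) [Fintype κ] [DecidableEq κ], Fintype.card κ = N →
    ∀ c : (κ → Fin n) → ℝ, Inv c → Perp c → c = 0 := by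
  induction N using Nat.strong_induction_on with
  | _ N ih =>
    intro κ _ _ hN c hc hp
    have htr : ∀ i j : κ, i ≠ j → ∀ w, ∑ x, c (Function.update (Function.update w i x) j x) = 0 := by
      intro i j hij w
      have hlt : Fintype.card (Rest i j) < N := by
        rw [← hN]
        exact Fintype.card_subtype_lt (x := i) (by simp)
      have := congrFun (ih _ hlt (Rest i j) rfl (contr i j c) (hc.contr hij) (hp.contr hij))
        (fun k => w k)
      rw [contr] at this
      rw [← Pi.zero_apply (M := fun _ => ℝ) (fun k : Rest i j => w k), ← this]
      refine Finset.sum_congr rfl fun x _ => ?_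
      congr 1
      ext k
      by_cases h : k = i
      · subst h; simp [extw, hij]
      by_cases h' : k = j
      · subst h'; simp [extw, h]
      simp [extw, h, h']
    obtain ⟨h1, h2⟩ := energy c hc.lie htr
    exact final_step c hp h1 h2

end FFT
namespace FFT
variable {κ : Type} [Fintype κ] [DecidableEq κ] {n : ℕ}

lemma prod_split {N k : ℕ} (σ : Fin N → Fin N) (a : Fin k → Fin N) (hσ : ∀ p, σ (σ p) = p)
    (ha : Function.Injective a) (hfix : ∀ p, σ p = p ↔ p ∈ Set.range a) (F : Fin N → ℝ) :
    ∏ i, F i = (∏ r, F (a r)) * ∏ p ∈ Finset.univ.filter (fun p => p < σ p), (F p * F (σ p)) := by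
  rw [Finset.prod_mul_distrib, ← Finset.prod_filter_mul_prod_filter_not Finset.univ (fun p => σ p = p)]
  congr 1
  · symm
    apply Finset.prod_bij (fun r _ => a r)
    · intro r _
      simp [hfix]
    · intro r _ s _ h
      exact ha h
    · intro p hp
      simp only [Finset.mem_filter, Finset.mem_univ, true_and, hfix] at hp
      obtain ⟨r, hr⟩ := hp
      exact ⟨r, Finset.mem_univ _, hr⟩
    · simp
  · rw [← Finset.prod_filter_mul_prod_filter_not _ (fun p => p < σ p)]
    congr 1
    · apply Finset.prod_congr _ (fun _ _ => rfl)
      ext p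
      simp only [Finset.mem_filter, Finset.mem_univ, true_and]
      constructor
      · exact fun h => h.2
      · exact fun h => ⟨h.ne', h⟩
    · apply Finset.prod_nbij' σ σ
      · intro p hp
        simp only [Finset.mem_filter, Finset.mem_univ, true_and] at hp ⊢
        rw [hσ]
        exact lt_of_le_of_ne (not_lt.1 hp.2) hp.1
      · intro p hp
        simp only [Finset.mem_filter, Finset.mem_univ, true_and] at hp ⊢
        rw [hσ]
        exact ⟨hp.ne, not_lt.2 hp.le⟩
      · intro p _; exact hσ p
      · intro p _; exact hσ p
      · intro p _; rw [hσ]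

lemma Phi_gen {N k : ℕ} (σ : Fin N → Fin N) (a : Fin k → Fin N) (hσ : ∀ p, σ (σ p) = p)
    (ha : Function.Injective a) (hfix : ∀ p, σ p = p ↔ p ∈ Set.range a)
    (h : (Fin k → Fin n) → ℝ) (z : Fin N → Fin n → ℝ) :
    Phi (gen σ a h) z = (∑ v, h v * ∏ r, z (a r) (v r)) *
      ∏ p ∈ Finset.univ.filter (fun p => p < σ p), ∑ x, z p x * z (σ p) x := by
  have hP : ∏ p ∈ Finset.univ.filter (fun p => p < σ p), ∑ x, z p x * z (σ p) x
      = ∑ u : {p // p < σ p} → Fin n, ∏ p : {p // p < σ p}, z p (u p) * z (σ p) (u p) := by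
    rw [Finset.prod_subtype (p := fun p => p < σ p) _ (by simp), Finset.prod_univ_sum]
    simp
  rw [hP, Finset.sum_mul_sum, ← Fintype.sum_prod_type']
  have hL : Phi (gen σ a h) z = ∑ w ∈ Finset.univ.filter (fun w : Fin N → Fin n => ∀ p, w (σ p) = w p),
      h (w ∘ a) * ∏ i, z i (w i) := by
    rw [Finset.sum_filter]
    apply Finset.sum_congr rfl
    intro w _
    unfold gen
    split_ifs <;> simp
  rw [hL]
  apply Finset.sum_bij (fun w _ => (w ∘ a, fun p : {p // p < σ p} => w p))
  · simp
  · intro w hw w' hw' he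
    simp only [Finset.mem_filter, Finset.mem_univ, true_and] at hw hw'
    simp only [Prod.mk.injEq] at he
    ext p
    rcases lt_trichotomy p (σ p) with hp | hp | hp
    · exact congrArg Fin.val (congrFun he.2 ⟨p, hp⟩)
    · obtain ⟨r, rfl⟩ := (hfix p).1 hp.symm
      exact congrArg Fin.val (congrFun he.1 r)
    · have := congrArg Fin.val (congrFun he.2 ⟨σ p, by rwa [hσ]⟩)
      simpa [hw, hw'] using this
  · rintro ⟨v, u⟩ _
    let w : Fin N → Fin n := fun p =>
      if h1 : p < σ p then u ⟨p, h1⟩ else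
      if h2 : σ p < p then u ⟨σ p, by rwa [hσ]⟩ else
        v (Classical.choose ((hfix p).1 (le_antisymm (not_lt.1 h1) (not_lt.1 h2))))
    refine ⟨w, ?_, ?_⟩
    · simp only [Finset.mem_filter, Finset.mem_univ, true_and]
      intro p
      rcases lt_trichotomy p (σ p) with hp | hp | hp
      · simp [w, hσ, hp, hp.not_gt]
      · rw [← hp]
      · simp [w, hσ, hp, hp.not_gt]
    · ext r
      · have hr : σ (a r) = a r := (hfix _).2 ⟨r, rfl⟩
        have hch : ∀ H : a r ∈ Set.range a, Classical.choose H = r := fun H =>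
          ha (Classical.choose_spec H)
        simp [w, hr, hch]
      · simp [w, r.2]
  · intro w hw
    simp only [Finset.mem_filter, Finset.mem_univ, true_and] at hw
    rw [prod_split σ a hσ ha hfix, mul_assoc]
    congr 2
    have hs := Finset.prod_subtype (p := fun p => p < σ p) (F := inferInstance)
      (Finset.univ.filter (fun p => p < σ p)) (by simp)
      (fun p => z p (w p) * z (σ p) (w (σ p)))
    rw [hs]
    simp [hw]

lemma hdet_sum (y : Fin n → Fin n → ℝ) :
    ∑ v, hdet n v * ∏ r, y r (v r) = Matrix.det (Matrix.of fun i r : Fin n => y r i) := by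
  have : ∀ v : Fin n → Fin n, hdet n v = ∑ τ : Equiv.Perm (Fin n),
      (Equiv.Perm.sign τ : ℤ) * if v = τ then (1 : ℝ) else 0 := by
    intro v
    rw [hdet, Matrix.det_apply']
    apply Finset.sum_congr rfl
    intro τ _
    congr 1
    by_cases hv : v = τ
    · simp [hv]
    · obtain ⟨r, hr⟩ := Function.ne_iff.1 hv
      rw [if_neg hv, Finset.prod_eq_zero (Finset.mem_univ r)]
      simp [Ne.symm hr]
  simp_rw [this, Finset.sum_mul]
  rw [Finset.sum_comm, Matrix.det_apply']
  apply Finset.sum_congr rfl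
  intro τ _
  simp

lemma Phi_single (c : (κ → Fin n) → ℝ) (w : κ → Fin n) :
    Phi c (fun i => Pi.single (w i) 1) = c w := by
  rw [Phi, Finset.sum_eq_single w]
  · simp
  · intro u _ hu
    obtain ⟨i, hi⟩ := Function.ne_iff.1 hu
    rw [Finset.prod_eq_zero (Finset.mem_univ i), mul_zero]
    simp [hi]
  · simp

lemma inv_of_Phi (c : (κ → Fin n) → ℝ)
    (hf : ∀ g : Matrix (Fin n) (Fin n) ℝ, gᵀ * g = 1 → g.det = 1 →
      ∀ z : κ → (Fin n → ℝ), Phi c (fun i => g.mulVec (z i)) = Phi c z) : Inv c := by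
  intro g hg hd w
  have := hf g hg hd (fun i => Pi.single (w i) 1)
  rw [Phi_single] at this
  rw [← this, Phi]
  simp

lemma inner_inv (g : Matrix (Fin n) (Fin n) ℝ) (hg : gᵀ * g = 1) (x y : Fin n → ℝ) :
    ∑ a, (g.mulVec x) a * (g.mulVec y) a = ∑ a, x a * y a := by
  change (g *ᵥ x) ⬝ᵥ (g *ᵥ y) = x ⬝ᵥ y
  rw [Matrix.dotProduct_mulVec, Matrix.vecMul_mulVec, hg, ← Matrix.dotProduct_mulVec,
    Matrix.one_mulVec]

lemma inv_gen {N k : ℕ} (σ : Fin N → Fin N) (a : Fin k → Fin N) (hσ : ∀ p, σ (σ p) = p)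
    (ha : Function.Injective a) (hfix : ∀ p, σ p = p ↔ p ∈ Set.range a)
    (h : (Fin k → Fin n) → ℝ) (hk : Allowed n k h) : Inv (gen σ a h) := by
  apply inv_of_Phi
  intro g hg hd z
  rw [Phi_gen σ a hσ ha hfix, Phi_gen σ a hσ ha hfix]
  simp_rw [inner_inv g hg]
  congr 1
  cases hk with
  | zero => simp
  | det =>
    rw [hdet_sum (fun r => g.mulVec (z (a r))), hdet_sum (fun r => z (a r))]
    have : (Matrix.of fun i r : Fin n => (g.mulVec (z (a r))) i)
        = g * (Matrix.of fun i r : Fin n => z (a r) i) := by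
      ext i r
      simp [Matrix.mul_apply, Matrix.mulVec, dotProduct]
    rw [this, Matrix.det_mul, hd, one_mul]

lemma f_eq_Phi (f : MultilinearMap ℝ (fun _ : κ => (Fin n → ℝ)) ℝ) :
    ⇑f = Phi (fun w => f (fun i => Pi.single (w i) 1)) := by
  ext z
  have hz : z = fun i => ∑ x, z i x • (Pi.single x 1 : Fin n → ℝ) := by
    ext i y
    simp [Finset.sum_apply, Pi.single_apply]
  conv_lhs => rw [hz]
  rw [MultilinearMap.map_sum, Phi]
  apply Finset.sum_congr rfl
  intro w _
  rw [MultilinearMap.map_smul_univ, smul_eq_mul, mul_comm]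

lemma sorted_bij {N n : ℕ} (α : GroodPartition N n) (a : Fin n → Fin N)
    (ha : Function.Injective a) (hr : ∀ r, a r ∈ α.free) :
    ∃ π : Equiv.Perm (Fin n), ∀ r, a r = α.sorted (π r) := by
  have : ∀ r, ∃ s, α.sorted s = a r := by
    intro r
    have h1 : a r ∈ α.free.sort (· ≤ ·) := by simpa using hr r
    obtain ⟨s, hs⟩ := List.mem_iff_get.1 h1
    refine ⟨Fin.cast (by rw [Finset.length_sort, α.card_free]) s, ?_⟩
    rw [← hs]
    rfl
  choose π hπ using this
  have hi : Function.Injective π := by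
    intro r s h
    apply ha
    rw [← hπ, ← hπ, h]
  exact ⟨Equiv.ofBijective π (Finite.injective_iff_bijective.1 hi), fun r => (hπ r).symm⟩

end FFT

/-- **First Fundamental Theorem for `SO(n)`** (multilinear form).  Every
`SO(n)`-invariant multilinear map `f : (ℝⁿ)^N → ℝ` lies in the span of
(i) the maps `(z₁,…,z_N) ↦ ∏_{{p,q} ∈ β} ⟨z_p, z_q⟩` for `β` a partition of
`{1,…,N}` into disjoint pairs, together with (ii) the maps
`(z₁,…,z_N) ↦ det(z_{a₁},…,z_{a_n}) ⬝ ∏_{{p,q} ∈ π} ⟨z_p, z_q⟩` for a choice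
`a₁ < … < a_n` of `n` elements of `{1,…,N}` and `π` a pairing of the rest. -/
theorem stmt15 (n N : ℕ) (hn : 1 ≤ n)
    (f : MultilinearMap ℝ (fun _ : Fin N => (Fin n → ℝ)) ℝ)
    (hf : ∀ g : Matrix (Fin n) (Fin n) ℝ, gᵀ * g = 1 → g.det = 1 →
      ∀ z : Fin N → (Fin n → ℝ), f (fun i => g.mulVec (z i)) = f z) :
    ⇑f ∈ Submodule.span ℝ
      ({F : (Fin N → (Fin n → ℝ)) → ℝ | ∃ β : BrauerPairing N,
          F = fun z => ∏ p ∈ Finset.univ.filter (fun p => p < β.pair p),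
            ∑ a, z p a * z (β.pair p) a} ∪
       {F : (Fin N → (Fin n → ℝ)) → ℝ | ∃ α : GroodPartition N n,
          F = fun z =>
            Matrix.det (Matrix.of fun i r : Fin n => z (α.sorted r) i) *
              ∏ p ∈ Finset.univ.filter (fun p => p ∉ α.free ∧ p < α.pair p),
                ∑ a, z p a * z (α.pair p) a}) := by
    classical
  set T := Submodule.span ℝ
      ({F : (Fin N → (Fin n → ℝ)) → ℝ | ∃ β : BrauerPairing N,
          F = fun z => ∏ p ∈ Finset.univ.filter (fun p => p < β.pair p),
            ∑ a, z p a * z (β.pair p) a} ∪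
       {F : (Fin N → (Fin n → ℝ)) → ℝ | ∃ α : GroodPartition N n,
          F = fun z =>
            Matrix.det (Matrix.of fun i r : Fin n => z (α.sorted r) i) *
              ∏ p ∈ Finset.univ.filter (fun p => p ∉ α.free ∧ p < α.pair p),
                ∑ a, z p a * z (α.pair p) a}) with hT
  -- generators
  let G : Set (EuclideanSpace ℝ (Fin N → Fin n)) := {x | ∃ (k : ℕ) (h : (Fin k → Fin n) → ℝ)
    (σ : Fin N → Fin N) (a : Fin k → Fin N), FFT.Allowed n k h ∧
    (∀ p, σ (σ p) = p) ∧ Function.Injective a ∧ (∀ p, σ p = p ↔ p ∈ Set.range a) ∧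
    x = WithLp.toLp 2 (FFT.gen σ a h)}
  have hPhi : ∀ x ∈ Submodule.span ℝ G, FFT.Phi (x : (Fin N → Fin n) → ℝ) ∈ T := by
    intro x hx
    induction hx using Submodule.span_induction with
    | zero =>
      convert T.zero_mem
      ext z
      simp [FFT.Phi]
    | add x y _ _ hx hy =>
      convert T.add_mem hx hy
      ext z
      simp [FFT.Phi, add_mul, Finset.sum_add_distrib]
    | smul t x _ hx =>
      convert T.smul_mem t hx
      ext z
      simp [FFT.Phi, Finset.mul_sum, mul_assoc]
    | mem x hx =>
      obtain ⟨k, h, σ, a, hk, hσ, ha, hfix, rfl⟩ := hx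
      have e : FFT.Phi (FFT.gen σ a h) = _ := funext (FFT.Phi_gen σ a hσ ha hfix h)
      change FFT.Phi (FFT.gen σ a h) ∈ T
      rw [e]
      cases hk with
      | zero =>
        apply Submodule.subset_span
        left
        refine ⟨⟨σ, hσ, fun p hp => ?_⟩, ?_⟩
        · obtain ⟨r, _⟩ := (hfix p).1 hp
          exact r.elim0
        · ext z
          simp
      | det =>
        let α : GroodPartition N n :=
          { free := Finset.univ.image a
            card_free := by rw [Finset.card_image_of_injective _ ha]; simp
            pair := σ
            invol := hσ
            fixed_iff_free := by intro p; rw [hfix]; simp }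
        obtain ⟨π, hπ⟩ := FFT.sorted_bij α a ha (by simp [α])
        have hmem : (fun z : Fin N → (Fin n → ℝ) =>
            Matrix.det (Matrix.of fun i r : Fin n => z (α.sorted r) i) *
              ∏ p ∈ Finset.univ.filter (fun p => p ∉ α.free ∧ p < α.pair p),
                ∑ a, z p a * z (α.pair p) a) ∈ T := by
          apply Submodule.subset_span
          right
          exact ⟨α, rfl⟩
        convert T.smul_mem ((Equiv.Perm.sign π : ℤ) : ℝ) hmem using 1
        ext z
        rw [FFT.hdet_sum (fun r => z (a r)), Pi.smul_apply, smul_eq_mul, ← mul_assoc,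
          ← Matrix.det_permute']
        congr 1
        · congr 1
          ext i r
          simp [hπ r]
        · apply Finset.prod_congr _ (fun _ _ => rfl)
          ext p
          simp only [Finset.mem_filter, Finset.mem_univ, true_and]
          refine ⟨fun hp => ⟨fun hf => ?_, hp⟩, fun hp => hp.2⟩
          exact hp.ne' ((α.fixed_iff_free p).2 hf)
  have hInv : ∀ x ∈ Submodule.span ℝ G, FFT.Inv (x : (Fin N → Fin n) → ℝ) := by
    intro x hx
    induction hx using Submodule.span_induction with
    | zero => intro g _ _ w; simp
    | add x y _ _ hx hy =>
      intro g hg hd w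
      have h1 := hx g hg hd w
      have h2 := hy g hg hd w
      simp [add_mul, Finset.sum_add_distrib, h1, h2]
    | smul t x _ hx =>
      intro g hg hd w
      have h1 := hx g hg hd w
      simp [mul_assoc, ← Finset.mul_sum, h1]
    | mem x hx =>
      obtain ⟨k, h, σ, a, hk, hσ, ha, hfix, rfl⟩ := hx
      exact FFT.inv_gen σ a hσ ha hfix h hk
  let c : (Fin N → Fin n) → ℝ := fun w => f (fun i => Pi.single (w i) 1)
  have hfc : ⇑f = FFT.Phi c := FFT.f_eq_Phi f
  have hc : FFT.Inv c := by
    apply FFT.inv_of_Phi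
    rw [← hfc]
    exact hf
  obtain ⟨y, hy, u, hu, hyu⟩ := Submodule.exists_add_mem_mem_orthogonal (K := Submodule.span ℝ G)
    (WithLp.toLp 2 c : EuclideanSpace ℝ (Fin N → Fin n))
  have hu0 : (u : (Fin N → Fin n) → ℝ) = 0 := by
    apply FFT.main_aux _ (Fin N) rfl
    · intro g hg hd w
      have h1 := hc g hg hd w
      have h2 := hInv y hy g hg hd w
      have h3 : ∀ w, u w = c w - y w := by
        intro w
        have := congrArg (fun x : EuclideanSpace ℝ (Fin N → Fin n) => x w) hyu
        simp at this
        linarith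
      simp [h3, sub_mul, Finset.sum_sub_distrib, h1, h2]
    · intro k h hk σ a hσ ha hfix
      have := (Submodule.mem_orthogonal _ _).1 hu (WithLp.toLp 2 (FFT.gen σ a h))
        (Submodule.subset_span ⟨k, h, σ, a, hk, hσ, ha, hfix, rfl⟩)
      simp only [PiLp.inner_apply] at this
      rw [← this]
      apply Finset.sum_congr rfl
      intro w _
      simp [mul_comm]
  have hcy : c = y := by
    ext w
    have := congrArg (fun x : EuclideanSpace ℝ (Fin N → Fin n) => x w) hyu
    have h0 := congrFun hu0 w
    simp at this h0
    rw [this, h0, add_zero]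
  rw [hfc, hcy]
  exact hPhi y hy
end
end
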